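/- arXiv:math/0608131 — 9 statements merged into one kernel-verified Lean document; each statement's English description precedes it below -/
import Mathlib

section
/- There exists a constant c > 0 such that for every integer n ≥ 15 and every arithmetic progression P = {a + i·d : 0 ≤ i ≤ n−1} of integers with common difference d ≠ 0, the number of difference-dominant subsets of P exceeds c·2^n, the number of sum-dominant subsets of P exceeds c·2^n, and the number of sum-difference-balanced subsets of P exceeds c·2^n. -/
open Finset Pointwise

/-- Subsets of `X` containing none of `t` disjoint pairs make up at most `(3/4)^t` of all subsets. -/
lemma card_filter_avoiding_pairs_le (t : ℕ) (f g : ℕ → ℤ) (X : Finset ℤ)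
    (hf : ∀ i < t, f i ∈ X) (hg : ∀ i < t, g i ∈ X)
    (hfg : ∀ i < t, ∀ j < t, f i ≠ g j)
    (hff : ∀ i < t, ∀ j < t, i ≠ j → f i ≠ f j)
    (hgg : ∀ i < t, ∀ j < t, i ≠ j → g i ≠ g j) :
    4 ^ t * (X.powerset.filter (fun M => ∀ i < t, ¬ (f i ∈ M ∧ g i ∈ M))).card
      ≤ 3 ^ t * 2 ^ X.card := by
  induction t generalizing X with
  | zero => simp
  | succ t ih =>
    have hne : f t ≠ g t := hfg t (by omega) t (by omega)
    set Y := X \ {f t, g t} with hY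
    have hsub : ({f t, g t} : Finset ℤ) ⊆ X := by
      intro x hx
      simp only [mem_insert, mem_singleton] at hx
      rcases hx with rfl | rfl
      · exact hf t (by omega)
      · exact hg t (by omega)
    have hcard : X.card = Y.card + 2 := by
      have h := card_sdiff_add_card_eq_card hsub
      rw [card_pair hne, ← hY] at h
      omega
    have ih' := ih Y
      (fun i hi => by
        simp only [hY, mem_sdiff, mem_insert, mem_singleton, not_or]
        exact ⟨hf i (by omega), hff i (by omega) t (by omega) (by omega),
          hfg i (by omega) t (by omega)⟩)
      (fun i hi => by
        simp only [hY, mem_sdiff, mem_insert, mem_singleton, not_or]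
        exact ⟨hg i (by omega), (hfg t (by omega) i (by omega)).symm,
          hgg i (by omega) t (by omega) (by omega)⟩)
      (fun i hi j hj => hfg i (by omega) j (by omega))
      (fun i hi j hj => hff i (by omega) j (by omega))
      (fun i hi j hj => hgg i (by omega) j (by omega))
    have hle : (X.powerset.filter (fun M => ∀ i < t + 1, ¬ (f i ∈ M ∧ g i ∈ M))).card
        ≤ ((Y.powerset.filter (fun M => ∀ i < t, ¬ (f i ∈ M ∧ g i ∈ M))) ×ˢ
          ({∅, {f t}, {g t}} : Finset (Finset ℤ))).card := by
      apply card_le_card_of_injOn (fun M => (M \ {f t, g t}, M ∩ {f t, g t}))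
      · intro M hM
        simp only [coe_filter, mem_powerset, Set.mem_ofPred_eq] at hM
        obtain ⟨hMX, hM⟩ := hM
        simp only [coe_product, Set.mem_prod, mem_coe, mem_filter, mem_powerset]
        refine ⟨⟨sdiff_subset_sdiff hMX le_rfl, fun i hi h => hM i (by omega)
          ⟨(mem_sdiff.1 h.1).1, (mem_sdiff.1 h.2).1⟩⟩, ?_⟩
        have := hM t (by omega)
        simp only [mem_insert, mem_singleton]
        by_cases h1 : f t ∈ M
        · have h2 : g t ∉ M := fun h => this ⟨h1, h⟩
          right; left
          ext x
          simp only [mem_inter, mem_insert, mem_singleton]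
          grind
        · by_cases h2 : g t ∈ M
          · right; right
            ext x
            simp only [mem_inter, mem_insert, mem_singleton]
            grind
          · left
            ext x
            simp only [mem_inter, mem_insert, mem_singleton, notMem_empty]
            grind
      · intro M _ M' _ h
        simp only [Prod.mk.injEq] at h
        rw [← sdiff_union_inter M {f t, g t}, ← sdiff_union_inter M' {f t, g t}, h.1, h.2]
    rw [card_product] at hle
    have h3 : ({∅, {f t}, {g t}} : Finset (Finset ℤ)).card ≤ 3 := card_le_three
    have hle' := hle.trans (Nat.mul_le_mul_left _ h3)
    rw [hcard, pow_succ, pow_succ, pow_add]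
    nlinarith [Nat.mul_le_mul_left (4 ^ t * 4) hle']

lemma card_filter_avoiding_pairs_le_real (t j : ℕ) (ht : j ≤ 2 * t) (f g : ℕ → ℤ) (X : Finset ℤ)
    (hf : ∀ i < t, f i ∈ X) (hg : ∀ i < t, g i ∈ X)
    (hfg : ∀ i < t, ∀ j < t, f i ≠ g j)
    (hff : ∀ i < t, ∀ j < t, i ≠ j → f i ≠ f j)
    (hgg : ∀ i < t, ∀ j < t, i ≠ j → g i ≠ g j)
    (p : Finset ℤ → Prop) [DecidablePred p]
    (hp : ∀ M, p M → ∀ i < t, ¬ (f i ∈ M ∧ g i ∈ M)) :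
    ((X.powerset.filter p).card : ℝ) ≤ 2 ^ X.card * (7 / 8) ^ j := by
  have h := card_filter_avoiding_pairs_le t f g X hf hg hfg hff hgg
  have h1 : (X.powerset.filter p).card ≤
      (X.powerset.filter (fun M => ∀ i < t, ¬ (f i ∈ M ∧ g i ∈ M))).card :=
    card_le_card (monotone_filter_right _ (fun M _ hM => hp M hM))
  have h2 : (4 : ℝ) ^ t * (X.powerset.filter p).card ≤ 3 ^ t * 2 ^ X.card := by
    exact_mod_cast (Nat.mul_le_mul_left _ h1).trans h
  have h3 : ((X.powerset.filter p).card : ℝ) ≤ 2 ^ X.card * (3 / 4) ^ t := by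
    rw [div_pow, mul_div_assoc', le_div_iff₀ (by positivity)]
    linarith
  refine h3.trans (mul_le_mul_of_nonneg_left ?_ (by positivity))
  calc (3 / 4 : ℝ) ^ t ≤ ((7 / 8) ^ 2) ^ t := by gcongr; norm_num
    _ = (7 / 8) ^ (2 * t) := by rw [pow_mul]
    _ ≤ (7 / 8) ^ j := pow_le_pow_of_le_one (by norm_num) (by norm_num) ht

lemma card_filter_notMem_add_low_le (N k : ℕ) (hk : k < N) :
    (((Ico (0 : ℤ) N).powerset.filter (fun M => (k : ℤ) ∉ M + M)).card : ℝ)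
      ≤ 2 ^ N * (7 / 8) ^ k := by
  have h := card_filter_avoiding_pairs_le_real ((k + 1) / 2) k (by omega) (fun i => (i : ℤ))
    (fun i => (k : ℤ) - i) (Ico (0 : ℤ) N)
    (fun i hi => by simp only [mem_Ico]; omega) (fun i hi => by simp only [mem_Ico]; omega)
    (fun i hi j hj => by omega) (fun i hi j hj hij => by omega)
    (fun i hi j hj hij => by omega) (fun M => (k : ℤ) ∉ M + M)
    (fun M hM i hi h => hM (mem_add.2 ⟨_, h.1, _, h.2, by ring⟩))
  simpa using h

lemma card_filter_notMem_add_high_le (N k : ℕ) (hk : k < N) :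
    (((Ico (0 : ℤ) N).powerset.filter (fun M => 2 * (N : ℤ) - 2 - k ∉ M + M)).card : ℝ)
      ≤ 2 ^ N * (7 / 8) ^ k := by
  have h := card_filter_avoiding_pairs_le_real ((k + 1) / 2) k (by omega)
    (fun i => (N : ℤ) - 1 - i) (fun i => (N : ℤ) - 1 - k + i) (Ico (0 : ℤ) N)
    (fun i hi => by simp only [mem_Ico]; omega) (fun i hi => by simp only [mem_Ico]; omega)
    (fun i hi j hj => by omega) (fun i hi j hj hij => by omega)
    (fun i hi j hj hij => by omega) (fun M => 2 * (N : ℤ) - 2 - k ∉ M + M)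
    (fun M hM i hi h => hM (mem_add.2 ⟨_, h.1, _, h.2, by ring⟩))
  simpa using h

lemma card_filter_notMem_sub_le (N k j : ℕ) (hjk : j ≤ k) (hk : k + j ≤ N) :
    (((Ico (0 : ℤ) N).powerset.filter (fun M => (k : ℤ) ∉ M - M)).card : ℝ)
      ≤ 2 ^ N * (7 / 8) ^ j := by
  have h := card_filter_avoiding_pairs_le_real j j (by omega) (fun i => (i : ℤ))
    (fun i => (i : ℤ) + k) (Ico (0 : ℤ) N)
    (fun i hi => by simp only [mem_Ico]; omega) (fun i hi => by simp only [mem_Ico]; omega)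
    (fun i hi j hj => by omega) (fun i hi j hj hij => by omega)
    (fun i hi j hj hij => by omega) (fun M => (k : ℤ) ∉ M - M)
    (fun M hM i hi h => hM (mem_sub.2 ⟨_, h.2, _, h.1, by ring⟩))
  simpa using h

/-- `M ⊆ [0, N)` has all sums and differences that are at least `32` away from the extremes. -/
def IsMiddleFull (N : ℕ) (M : Finset ℤ) : Prop :=
  ∀ k ∈ Ico 32 N, (k : ℤ) ∈ M + M ∧ 2 * (N : ℤ) - 2 - k ∈ M + M ∧
    (2 * k ≤ N → (k : ℤ) ∈ M - M ∧ (N : ℤ) - k ∈ M - M)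

instance (N : ℕ) : DecidablePred (IsMiddleFull N) := fun _ => by
  unfold IsMiddleFull; infer_instance

lemma sum_Ico_geometric_le (N : ℕ) : ∑ k ∈ Ico 32 N, (7 / 8 : ℝ) ^ k ≤ 1 / 8 := by
  have h : ∑ k ∈ Ico 32 N, (7 / 8 : ℝ) ^ k ≤ (7 / 8) ^ 32 / (1 - 7 / 8) :=
    geom_sum_Ico_le_of_lt_one (by norm_num) (by norm_num)
  exact h.trans (by norm_num)

lemma two_pow_le_card_middleFull (N : ℕ) :
    (2 : ℝ) ^ N / 2 ≤ (((Ico (0 : ℤ) N).powerset.filter (IsMiddleFull N)).card : ℝ) := by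
  set P := (Ico (0 : ℤ) N).powerset with hP
  have hPcard : P.card = 2 ^ N := by simp [hP]
  have hsplit := card_filter_add_card_filter_not (s := P) (IsMiddleFull N)
  let bad : ℕ → Finset (Finset ℤ) := fun k =>
    (P.filter (fun M => (k : ℤ) ∉ M + M) ∪ P.filter (fun M => 2 * (N : ℤ) - 2 - k ∉ M + M)) ∪
      (P.filter (fun M => 2 * k ≤ N ∧ (k : ℤ) ∉ M - M) ∪
        P.filter (fun M => 2 * k ≤ N ∧ (N : ℤ) - k ∉ M - M))
  have hbad : ∀ k ∈ Ico 32 N, ((bad k).card : ℝ) ≤ 4 * 2 ^ N * (7 / 8) ^ k := by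
    intro k hk
    have hkN := (mem_Ico.1 hk).2
    have h1 := card_filter_notMem_add_low_le N k hkN
    have h2 := card_filter_notMem_add_high_le N k hkN
    have h3 : ((P.filter (fun M => 2 * k ≤ N ∧ (k : ℤ) ∉ M - M)).card : ℝ)
        ≤ 2 ^ N * (7 / 8) ^ k := by
      by_cases hk2 : 2 * k ≤ N
      · simpa [hk2] using card_filter_notMem_sub_le N k k le_rfl (by omega)
      · simp only [hk2, false_and, filter_false, card_empty, Nat.cast_zero]; positivity
    have h4 : ((P.filter (fun M => 2 * k ≤ N ∧ (N : ℤ) - k ∉ M - M)).card : ℝ)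
        ≤ 2 ^ N * (7 / 8) ^ k := by
      by_cases hk2 : 2 * k ≤ N
      · have := card_filter_notMem_sub_le N (N - k) k (by omega) (by omega)
        rw [Nat.cast_sub hkN.le] at this
        simpa [hk2] using this
      · simp only [hk2, false_and, filter_false, card_empty, Nat.cast_zero]; positivity
    have hu : (bad k).card ≤ _ := (card_union_le _ _).trans
      (add_le_add (card_union_le _ _) (card_union_le _ _))
    have hu' : ((bad k).card : ℝ) ≤ _ := Nat.cast_le.2 hu
    push_cast at hu'
    linarith
  have hsub : P.filter (fun M => ¬ IsMiddleFull N M) ⊆ (Ico 32 N).biUnion bad := by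
    intro M hM
    obtain ⟨hMP, hM⟩ := mem_filter.1 hM
    unfold IsMiddleFull at hM
    push Not at hM
    obtain ⟨k, hk, h⟩ := hM
    refine mem_biUnion.2 ⟨k, hk, ?_⟩
    simp only [bad, mem_union, mem_filter, hMP, true_and]
    tauto
  have hle : ((P.filter (fun M => ¬ IsMiddleFull N M)).card : ℝ) ≤ 2 ^ N / 2 := by
    calc ((P.filter (fun M => ¬ IsMiddleFull N M)).card : ℝ)
        ≤ ∑ k ∈ Ico 32 N, ((bad k).card : ℝ) := by
          exact_mod_cast (card_le_card hsub).trans card_biUnion_le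
      _ ≤ ∑ k ∈ Ico 32 N, 4 * 2 ^ N * (7 / 8 : ℝ) ^ k := sum_le_sum hbad
      _ = 4 * 2 ^ N * ∑ k ∈ Ico 32 N, (7 / 8 : ℝ) ^ k := by rw [mul_sum]
      _ ≤ 4 * 2 ^ N * (1 / 8) := by gcongr; exact sum_Ico_geometric_le N
      _ = 2 ^ N / 2 := by ring
  have hsplit' : ((P.filter (IsMiddleFull N)).card : ℝ) +
      (P.filter (fun M => ¬ IsMiddleFull N M)).card = 2 ^ N := by
    rw [hPcard] at hsplit
    exact_mod_cast hsplit
  linarith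

/-- The number of elements of `A + B` in `[0, 22)`. -/
def lowSumCount (A B : Finset ℤ) : ℕ := ((A + B).filter (fun x => x < 22)).card

section Fringe

variable {S A B : Finset ℤ} {m : ℤ}

lemma card_add_of_fringe (hm : 44 ≤ m) (hS : S ⊆ Icc 0 m)
    (hA : ∀ x, x ∈ A ↔ x < 22 ∧ x ∈ S) (hB : ∀ x, x ∈ B ↔ x < 22 ∧ m - x ∈ S)
    (hmid : Icc 22 (2 * m - 22) ⊆ S + S) :
    (S + S).card = lowSumCount A A + (Icc 22 (2 * m - 22)).card + lowSumCount B B := by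
  have hS' : ∀ x ∈ S, 0 ≤ x ∧ x ≤ m := fun x hx => mem_Icc.1 (hS hx)
  have h : S + S = ((A + A).filter (fun x => x < 22) ∪ Icc 22 (2 * m - 22)) ∪
      ((B + B).filter (fun x => x < 22)).image (fun x => 2 * m - x) := by
    ext k
    simp only [mem_union, mem_filter, mem_image]
    constructor
    · intro hk
      obtain ⟨x, hx, y, hy, rfl⟩ := mem_add.1 hk
      have := hS' x hx
      have := hS' y hy
      by_cases h1 : x + y < 22
      · exact Or.inl (Or.inl ⟨mem_add.2 ⟨x, (hA x).2 ⟨by omega, hx⟩, y,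
          (hA y).2 ⟨by omega, hy⟩, rfl⟩, h1⟩)
      by_cases h2 : x + y ≤ 2 * m - 22
      · exact Or.inl (Or.inr (mem_Icc.2 ⟨by omega, h2⟩))
      · refine Or.inr ⟨2 * m - (x + y), ⟨mem_add.2 ⟨m - x, (hB _).2 ⟨by omega, by simpa⟩,
          m - y, (hB _).2 ⟨by omega, by simpa⟩, by ring⟩, by omega⟩, by ring⟩
    · rintro ((⟨hk, -⟩ | hk) | ⟨l, ⟨hl, -⟩, rfl⟩)
      · obtain ⟨x, hx, y, hy, rfl⟩ := mem_add.1 hk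
        exact add_mem_add ((hA x).1 hx).2 ((hA y).1 hy).2
      · exact hmid hk
      · obtain ⟨x, hx, y, hy, rfl⟩ := mem_add.1 hl
        exact mem_add.2 ⟨_, ((hB x).1 hx).2, _, ((hB y).1 hy).2, by ring⟩
  rw [h, card_union_of_disjoint, card_union_of_disjoint, card_image_of_injective]
  · rfl
  · exact fun x y hxy => by simpa using hxy
  · rw [disjoint_left]
    intro x hx hx'
    have := (mem_filter.1 hx).2
    have := mem_Icc.1 hx'
    omega
  · rw [disjoint_left]
    intro x hx hx'
    obtain ⟨l, hl, rfl⟩ := mem_image.1 hx'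
    have h1 := (mem_filter.1 hl).2
    rcases mem_union.1 hx with h | h
    · have := (mem_filter.1 h).2
      omega
    · have := mem_Icc.1 h
      omega

lemma card_sub_of_fringe (hm : 44 ≤ m) (hS : S ⊆ Icc 0 m)
    (hA : ∀ x, x ∈ A ↔ x < 22 ∧ x ∈ S) (hB : ∀ x, x ∈ B ↔ x < 22 ∧ m - x ∈ S)
    (hmid : Icc (22 - m) (m - 22) ⊆ S - S) :
    (S - S).card = lowSumCount A B + (Icc 22 (2 * m - 22)).card + lowSumCount A B := by
  have hS' : ∀ x ∈ S, 0 ≤ x ∧ x ≤ m := fun x hx => mem_Icc.1 (hS hx)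
  have h : S - S = (((A + B).filter (fun x => x < 22)).image (fun x => x - m) ∪
      Icc (22 - m) (m - 22)) ∪
      ((A + B).filter (fun x => x < 22)).image (fun x => m - x) := by
    ext k
    simp only [mem_union, mem_filter, mem_image]
    constructor
    · intro hk
      obtain ⟨x, hx, y, hy, rfl⟩ := mem_sub.1 hk
      have := hS' x hx
      have := hS' y hy
      by_cases h1 : x - y < 22 - m
      · exact Or.inl (Or.inl ⟨x + (m - y), ⟨add_mem_add ((hA x).2 ⟨by omega, hx⟩)
          ((hB _).2 ⟨by omega, by simpa⟩), by omega⟩, by ring⟩)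
      by_cases h2 : x - y ≤ m - 22
      · exact Or.inl (Or.inr (mem_Icc.2 ⟨by omega, h2⟩))
      · exact Or.inr ⟨y + (m - x), ⟨add_mem_add ((hA y).2 ⟨by omega, hy⟩)
          ((hB _).2 ⟨by omega, by simpa⟩), by omega⟩, by ring⟩
    · rintro ((⟨l, ⟨hl, -⟩, rfl⟩ | hk) | ⟨l, ⟨hl, -⟩, rfl⟩)
      · obtain ⟨x, hx, y, hy, rfl⟩ := mem_add.1 hl
        exact mem_sub.2 ⟨_, ((hA x).1 hx).2, _, ((hB y).1 hy).2, by ring⟩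
      · exact hmid hk
      · obtain ⟨x, hx, y, hy, rfl⟩ := mem_add.1 hl
        exact mem_sub.2 ⟨_, ((hB y).1 hy).2, _, ((hA x).1 hx).2, by ring⟩
  have hcard : (Icc (22 - m) (m - 22)).card = (Icc 22 (2 * m - 22)).card := by
    simp only [Int.card_Icc]; congr 1; ring
  rw [h, card_union_of_disjoint, card_union_of_disjoint, card_image_of_injective,
    card_image_of_injective, hcard]
  · rfl
  · exact fun x y hxy => by simpa using hxy
  · exact fun x y hxy => by simpa using hxy
  · rw [disjoint_left]
    intro x hx hx'
    obtain ⟨l, hl, rfl⟩ := mem_image.1 hx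
    have := (mem_filter.1 hl).2
    have := mem_Icc.1 hx'
    omega
  · rw [disjoint_left]
    intro x hx hx'
    obtain ⟨l, hl, rfl⟩ := mem_image.1 hx'
    have h1 := (mem_filter.1 hl).2
    rcases mem_union.1 hx with h | h
    · obtain ⟨l', hl', h'⟩ := mem_image.1 h
      have := (mem_filter.1 hl').2
      omega
    · have := mem_Icc.1 h
      omega

end Fringe

/-- Fill the margins of width `32` of `M ⊆ [0, N)`. -/
noncomputable def fillMargins (N : ℕ) (M : Finset ℤ) : Finset ℤ := M ∪ (Ico 0 32 ∪ Ico ((N : ℤ) - 32) N)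

lemma mem_add_fillMargins {N : ℕ} {M : Finset ℤ} (hN : 64 ≤ N) (hM : IsMiddleFull N M)
    {k : ℤ} (h0 : 0 ≤ k) (h1 : k ≤ 2 * N - 2) :
    k ∈ fillMargins N M + fillMargins N M := by
  have hsub : M ⊆ fillMargins N M := subset_union_left
  by_cases hk : k < 32
  · refine mem_add.2 ⟨0, ?_, k, ?_, by ring⟩ <;>
      simp only [fillMargins, mem_union, mem_Ico] <;> omega
  by_cases hk' : 2 * N - 2 - k < 32
  · refine mem_add.2 ⟨N - 1, ?_, k - (N - 1), ?_, by ring⟩ <;>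
      simp only [fillMargins, mem_union, mem_Ico] <;> omega
  by_cases hkN : k < N
  · obtain ⟨j, rfl⟩ := Int.eq_ofNat_of_zero_le h0
    exact add_subset_add hsub hsub (hM j (mem_Ico.2 ⟨by omega, by omega⟩)).1
  · obtain ⟨j, hj⟩ := Int.eq_ofNat_of_zero_le (a := 2 * N - 2 - k) (by omega)
    have := (hM j (mem_Ico.2 ⟨by omega, by omega⟩)).2.1
    rw [show k = 2 * (N : ℤ) - 2 - j by omega]
    exact add_subset_add hsub hsub this

lemma mem_sub_fillMargins_of_nonneg {N : ℕ} {M : Finset ℤ} (hN : 64 ≤ N) (hM : IsMiddleFull N M)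
    {k : ℤ} (h0 : 0 ≤ k) (h1 : k ≤ N - 1) :
    k ∈ fillMargins N M - fillMargins N M := by
  have hsub : M ⊆ fillMargins N M := subset_union_left
  by_cases hk : k < 32
  · refine mem_sub.2 ⟨k, ?_, 0, ?_, by ring⟩ <;>
      simp only [fillMargins, mem_union, mem_Ico] <;> omega
  by_cases hk' : N - k < 32
  · refine mem_sub.2 ⟨N - 1, ?_, N - 1 - k, ?_, by ring⟩ <;>
      simp only [fillMargins, mem_union, mem_Ico] <;> omega
  by_cases hkN : 2 * k ≤ N
  · obtain ⟨j, rfl⟩ := Int.eq_ofNat_of_zero_le h0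
    exact sub_subset_sub hsub hsub ((hM j (mem_Ico.2 ⟨by omega, by omega⟩)).2.2 (by omega)).1
  · obtain ⟨j, hj⟩ := Int.eq_ofNat_of_zero_le (a := N - k) (by omega)
    have := ((hM j (mem_Ico.2 ⟨by omega, by omega⟩)).2.2 (by omega)).2
    rw [show k = (N : ℤ) - j by omega]
    exact sub_subset_sub hsub hsub this

lemma mem_sub_fillMargins {N : ℕ} {M : Finset ℤ} (hN : 64 ≤ N) (hM : IsMiddleFull N M)
    {k : ℤ} (h0 : -(N - 1) ≤ k) (h1 : k ≤ N - 1) :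
    k ∈ fillMargins N M - fillMargins N M := by
  rcases le_total 0 k with hk | hk
  · exact mem_sub_fillMargins_of_nonneg hN hM hk h1
  · obtain ⟨x, hx, y, hy, h⟩ := mem_sub.1
      (mem_sub_fillMargins_of_nonneg hN hM (k := -k) (by omega) (by omega))
    exact mem_sub.2 ⟨y, hy, x, hx, by omega⟩

/-- The subset of `[0, N + 22)` with left fringe `A`, right fringe the reflection of `B`, and
middle part `M` with filled margins. -/
noncomputable def withFringes (A B : Finset ℤ) (N : ℕ) (M : Finset ℤ) : Finset ℤ :=
  (A ∪ B.image (fun x => (N : ℤ) + 21 - x)) ∪ (fillMargins N M).image (fun x => x + 11)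

lemma mem_withFringes {A B : Finset ℤ} {N : ℕ} {M : Finset ℤ} {x : ℤ} :
    x ∈ withFringes A B N M ↔ x ∈ A ∨ (N : ℤ) + 21 - x ∈ B ∨ x - 11 ∈ M ∨
      (11 ≤ x ∧ x < 43) ∨ ((N : ℤ) - 21 ≤ x ∧ x < N + 11) := by
  simp only [withFringes, fillMargins, mem_union, mem_image, mem_Ico]
  constructor
  · rintro ((h | ⟨y, hy, rfl⟩) | ⟨y, hy | hy | hy, rfl⟩)
    · exact Or.inl h
    · right; left; simpa using hy
    · right; right; left; simpa using hy
    · right; right; right; left; omega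
    · right; right; right; right; omega
  · rintro (h | h | h | h | h)
    · exact Or.inl (Or.inl h)
    · exact Or.inl (Or.inr ⟨_, h, by ring⟩)
    · exact Or.inr ⟨_, Or.inl h, by ring⟩
    · exact Or.inr ⟨x - 11, Or.inr (Or.inl (by omega)), by ring⟩
    · exact Or.inr ⟨x - 11, Or.inr (Or.inr (by omega)), by ring⟩

lemma withFringes_subset (A B : Finset ℤ) (hA : A ⊆ Ico 0 11) (hB : B ⊆ Ico 0 11)
    {N : ℕ} {M : Finset ℤ} (hN : 64 ≤ N) (hMN : M ⊆ Ico (0 : ℤ) N) :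
    withFringes A B N M ⊆ Ico (0 : ℤ) ((N + 22 : ℕ) : ℤ) := by
  intro x hx
  rw [mem_Ico]
  push_cast
  rcases mem_withFringes.1 hx with h | h | h | h | h
  · have := mem_Ico.1 (hA h); omega
  · have := mem_Ico.1 (hB h); omega
  · have := mem_Ico.1 (hMN h); omega
  · omega
  · omega

lemma card_withFringes (A B : Finset ℤ) (hA : A ⊆ Ico 0 11) (hB : B ⊆ Ico 0 11)
    (Q : ℕ → ℕ → Prop)
    (hQ : ∀ c, Q (lowSumCount (A ∪ Ico 11 22) (A ∪ Ico 11 22) + c +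
        lowSumCount (B ∪ Ico 11 22) (B ∪ Ico 11 22))
      (lowSumCount (A ∪ Ico 11 22) (B ∪ Ico 11 22) + c +
        lowSumCount (A ∪ Ico 11 22) (B ∪ Ico 11 22)))
    {N : ℕ} {M : Finset ℤ} (hN : 64 ≤ N) (hMN : M ⊆ Ico (0 : ℤ) N)
    (hM : IsMiddleFull N M) :
    Q (withFringes A B N M + withFringes A B N M).card
      (withFringes A B N M - withFringes A B N M).card := by
  have hA' : ∀ x ∈ A, 0 ≤ x ∧ x < 11 := fun x hx => mem_Ico.1 (hA hx)
  have hB' : ∀ x ∈ B, 0 ≤ x ∧ x < 11 := fun x hx => mem_Ico.1 (hB hx)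
  have hM' : ∀ x ∈ M, 0 ≤ x ∧ x < N := fun x hx => mem_Ico.1 (hMN hx)
  have hS : withFringes A B N M ⊆ Icc 0 ((N : ℤ) + 21) := by
    intro x hx
    have := mem_Ico.1 (withFringes_subset A B hA hB hN hMN hx)
    rw [mem_Icc]
    push_cast at this
    omega
  have hlow : ∀ x, x ∈ A ∪ Ico 11 22 ↔ x < 22 ∧ x ∈ withFringes A B N M := by
    intro x
    rw [mem_withFringes, mem_union, mem_Ico]
    have := hA' x
    have := hB' (N + 21 - x)
    have := hM' (x - 11)
    grind
  have hhigh : ∀ x, x ∈ B ∪ Ico 11 22 ↔ x < 22 ∧ (N : ℤ) + 21 - x ∈ withFringes A B N M := by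
    intro x
    rw [mem_withFringes, mem_union, mem_Ico, sub_sub_cancel]
    have := hB' x
    have := hA' (N + 21 - x)
    have := hM' (N + 21 - x - 11)
    grind
  have hfill : ∀ x ∈ fillMargins N M, x + 11 ∈ withFringes A B N M := fun x hx =>
    mem_union_right _ (mem_image_of_mem _ hx)
  rw [card_add_of_fringe (by omega) hS hlow hhigh, card_sub_of_fringe (by omega) hS hlow hhigh]
  · exact hQ _
  · intro k hk
    rw [mem_Icc] at hk
    obtain ⟨x, hx, y, hy, h⟩ := mem_sub.1
      (mem_sub_fillMargins hN hM (k := k) (by omega) (by omega))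
    exact mem_sub.2 ⟨_, hfill x hx, _, hfill y hy, by omega⟩
  · intro k hk
    rw [mem_Icc] at hk
    obtain ⟨x, hx, y, hy, h⟩ := mem_add.1
      (mem_add_fillMargins hN hM (k := k - 22) (by omega) (by omega))
    exact mem_add.2 ⟨_, hfill x hx, _, hfill y hy, by omega⟩

lemma card_middleFull_le (A B : Finset ℤ) (hA : A ⊆ Ico 0 11) (hB : B ⊆ Ico 0 11)
    (Q : ℕ → ℕ → Prop) [∀ x y, Decidable (Q x y)]
    (hQ : ∀ c, Q (lowSumCount (A ∪ Ico 11 22) (A ∪ Ico 11 22) + c +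
        lowSumCount (B ∪ Ico 11 22) (B ∪ Ico 11 22))
      (lowSumCount (A ∪ Ico 11 22) (B ∪ Ico 11 22) + c +
        lowSumCount (A ∪ Ico 11 22) (B ∪ Ico 11 22)))
    (N : ℕ) (hN : 64 ≤ N) :
    ((Ico (0 : ℤ) N).powerset.filter (IsMiddleFull N)).card ≤
      ((Ico (0 : ℤ) ((N + 22 : ℕ) : ℤ)).powerset.filter
        (fun S => Q (S + S).card (S - S).card)).card * 2 ^ 64 := by
  set E := Ico (0 : ℤ) 32 ∪ Ico ((N : ℤ) - 32) N with hE
  have hEcard : E.card = 64 := by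
    rw [hE, card_union_of_disjoint]
    · simp
    · rw [disjoint_left]
      intro x hx hx'
      rw [mem_Ico] at hx hx'
      omega
  rw [← hEcard, ← card_powerset, ← card_product]
  apply card_le_card_of_injOn (fun M => (withFringes A B N M, M ∩ E))
  · intro M hM
    simp only [coe_filter, mem_powerset, Set.mem_ofPred_eq] at hM
    simp only [coe_product, Set.mem_prod, mem_coe, mem_filter, mem_powerset]
    exact ⟨⟨withFringes_subset A B hA hB hN hM.1, card_withFringes A B hA hB Q hQ hN hM.1 hM.2⟩,
      inter_subset_right⟩
  · have key : ∀ M ⊆ Ico (0 : ℤ) N, ∀ x, x ∈ M ↔ x ∈ Ico (0 : ℤ) N ∧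
        ((x ∈ E ∧ x ∈ M ∩ E) ∨ (x ∉ E ∧ x + 11 ∈ withFringes A B N M)) := by
      intro M hM x
      have hA' : x + 11 ∈ A → _ := fun h => mem_Ico.1 (hA h)
      have hB' : (N : ℤ) + 21 - (x + 11) ∈ B → _ := fun h => mem_Ico.1 (hB h)
      have hM' : x ∈ M → _ := fun h => mem_Ico.1 (hM h)
      rw [mem_withFringes, mem_inter, add_sub_cancel_right]
      simp only [hE, mem_union, mem_Ico]
      grind
    intro M hM M' hM' h
    simp only [coe_filter, mem_powerset, Set.mem_ofPred_eq] at hM hM'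
    simp only [Prod.mk.injEq] at h
    ext x
    rw [key M hM.1, key M' hM'.1, h.1, h.2]

lemma lt_card_filter_powerset_Ico (A B T : Finset ℤ) (hA : A ⊆ Ico 0 11) (hB : B ⊆ Ico 0 11)
    (Q : ℕ → ℕ → Prop) [∀ x y, Decidable (Q x y)]
    (hQ : ∀ c, Q (lowSumCount (A ∪ Ico 11 22) (A ∪ Ico 11 22) + c +
        lowSumCount (B ∪ Ico 11 22) (B ∪ Ico 11 22))
      (lowSumCount (A ∪ Ico 11 22) (B ∪ Ico 11 22) + c +
        lowSumCount (A ∪ Ico 11 22) (B ∪ Ico 11 22)))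
    (hT : T ⊆ Ico 0 15) (hQT : Q (T + T).card (T - T).card)
    (n : ℕ) (hn : 15 ≤ n) :
    (1 / 2 ^ 100 : ℝ) * 2 ^ n < (((Ico (0 : ℤ) n).powerset.filter
      (fun S => Q (S + S).card (S - S).card)).card : ℝ) := by
  rcases lt_or_ge n 86 with h | h
  · have h1 : 1 ≤ ((Ico (0 : ℤ) n).powerset.filter
        (fun S => Q (S + S).card (S - S).card)).card :=
      card_pos.2 ⟨T, mem_filter.2 ⟨mem_powerset.2 (hT.trans
        (Ico_subset_Ico_right (by exact_mod_cast hn))), hQT⟩⟩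
    have h2 : (1 : ℝ) ≤ _ := Nat.one_le_cast.2 h1
    have h3 : (2 : ℝ) ^ n ≤ 2 ^ 86 := pow_le_pow_right₀ (by norm_num) h.le
    refine lt_of_lt_of_le ?_ h2
    calc (1 / 2 ^ 100 : ℝ) * 2 ^ n ≤ 1 / 2 ^ 100 * 2 ^ 86 := by gcongr
      _ < 1 := by norm_num
  · obtain ⟨N, rfl⟩ : ∃ N, n = N + 22 := ⟨n - 22, by omega⟩
    have h1 : (_ : ℝ) ≤ _ := Nat.cast_le.2 (card_middleFull_le A B hA hB Q hQ N (by omega))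
    have h2 := (two_pow_le_card_middleFull N).trans h1
    push_cast at h2 ⊢
    have hpos : (0 : ℝ) < 2 ^ N := by positivity
    rw [pow_add]
    norm_num at h2 ⊢
    linarith

lemma lt_card_filter_powerset_progression (A B T : Finset ℤ) (hA : A ⊆ Ico 0 11) (hB : B ⊆ Ico 0 11)
    (Q : ℕ → ℕ → Prop) [∀ x y, Decidable (Q x y)]
    (hQ : ∀ c, Q (lowSumCount (A ∪ Ico 11 22) (A ∪ Ico 11 22) + c +
        lowSumCount (B ∪ Ico 11 22) (B ∪ Ico 11 22))
      (lowSumCount (A ∪ Ico 11 22) (B ∪ Ico 11 22) + c +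
        lowSumCount (A ∪ Ico 11 22) (B ∪ Ico 11 22)))
    (hT : T ⊆ Ico 0 15) (hQT : Q (T + T).card (T - T).card)
    (n : ℕ) (hn : 15 ≤ n) (a d : ℤ) (hd : d ≠ 0) :
    (1 / 2 ^ 100 : ℝ) * 2 ^ n <
      ((((Finset.range n).image (fun i : ℕ => a + (i : ℤ) * d)).powerset.filter
        (fun S : Finset ℤ => Q (S + S).card (S - S).card)).card : ℝ) := by
  refine (lt_card_filter_powerset_Ico A B T hA hB Q hQ hT hQT n hn).trans_le ?_
  rw [Nat.cast_le]
  have hinj : ∀ b : ℤ, Function.Injective (fun x : ℤ => b + x * d) := fun b x y h => by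
    simpa [hd] using h
  apply card_le_card_of_injOn (fun S => S.image (fun x => a + x * d))
  · intro S hS
    simp only [coe_filter, mem_powerset, Set.mem_ofPred_eq] at hS ⊢
    have hadd : S.image (fun x => a + x * d) + S.image (fun x => a + x * d) =
        (S + S).image (fun x => 2 * a + x * d) := by
      ext k
      simp only [mem_add, mem_image]
      constructor
      · rintro ⟨_, ⟨x, hx, rfl⟩, _, ⟨y, hy, rfl⟩, rfl⟩
        exact ⟨_, ⟨x, hx, y, hy, rfl⟩, by ring⟩
      · rintro ⟨_, ⟨x, hx, y, hy, rfl⟩, rfl⟩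
        exact ⟨_, ⟨x, hx, rfl⟩, _, ⟨y, hy, rfl⟩, by ring⟩
    have hsub : S.image (fun x => a + x * d) - S.image (fun x => a + x * d) =
        (S - S).image (fun x => 0 + x * d) := by
      ext k
      simp only [mem_sub, mem_image]
      constructor
      · rintro ⟨_, ⟨x, hx, rfl⟩, _, ⟨y, hy, rfl⟩, rfl⟩
        exact ⟨_, ⟨x, hx, y, hy, rfl⟩, by ring⟩
      · rintro ⟨_, ⟨x, hx, y, hy, rfl⟩, rfl⟩
        exact ⟨_, ⟨x, hx, rfl⟩, _, ⟨y, hy, rfl⟩, by ring⟩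
    refine ⟨?_, ?_⟩
    · intro k hk
      obtain ⟨x, hx, rfl⟩ := mem_image.1 hk
      have := mem_Ico.1 (hS.1 hx)
      exact mem_image.2 ⟨x.toNat, mem_range.2 (by omega), by rw [Int.toNat_of_nonneg this.1]⟩
    · rw [hadd, hsub, card_image_of_injective _ (hinj _), card_image_of_injective _ (hinj _)]
      exact hS.2
  · exact (image_injective (hinj a)).injOn

set_option maxRecDepth 100000 in
theorem many_sets_all_three_types :
    ∃ c : ℝ, 0 < c ∧ ∀ n : ℕ, 15 ≤ n → ∀ a d : ℤ, d ≠ 0 →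
      ((((Finset.range n).image (fun i : ℕ => a + (i : ℤ) * d)).powerset.filter
          (fun S : Finset ℤ => (S + S).card < (S - S).card)).card : ℝ) > c * 2 ^ n ∧
      ((((Finset.range n).image (fun i : ℕ => a + (i : ℤ) * d)).powerset.filter
          (fun S : Finset ℤ => (S - S).card < (S + S).card)).card : ℝ) > c * 2 ^ n ∧
      ((((Finset.range n).image (fun i : ℕ => a + (i : ℤ) * d)).powerset.filter
          (fun S : Finset ℤ => (S + S).card = (S - S).card)).card : ℝ) > c * 2 ^ n := by
  refine ⟨1 / 2 ^ 100, by positivity, fun n hn a d hd => ⟨?_, ?_, ?_⟩⟩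
  · refine lt_card_filter_powerset_progression {0, 2, 3, 4, 5, 6, 7, 8, 9, 10} (Ico 0 11) {0, 1, 3}
      (by decide) (by decide) (fun x y => x < y) (fun c => ?_) (by decide) (by decide) n hn a d hd
    have h : lowSumCount ({0, 2, 3, 4, 5, 6, 7, 8, 9, 10} ∪ Ico 11 22)
          ({0, 2, 3, 4, 5, 6, 7, 8, 9, 10} ∪ Ico 11 22) +
        lowSumCount (Ico 0 11 ∪ Ico 11 22) (Ico 0 11 ∪ Ico 11 22) <
        2 * lowSumCount ({0, 2, 3, 4, 5, 6, 7, 8, 9, 10} ∪ Ico 11 22) (Ico 0 11 ∪ Ico 11 22) := by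
      decide
    omega
  · refine lt_card_filter_powerset_progression {0, 2, 3, 7, 8, 9, 10} {0, 1, 2, 5, 7, 8, 9, 10}
      {0, 2, 3, 4, 7, 11, 12, 14}
      (by decide) (by decide) (fun x y => y < x) (fun c => ?_) (by decide) (by decide) n hn a d hd
    have h : 2 * lowSumCount ({0, 2, 3, 7, 8, 9, 10} ∪ Ico 11 22)
          ({0, 1, 2, 5, 7, 8, 9, 10} ∪ Ico 11 22) <
        lowSumCount ({0, 2, 3, 7, 8, 9, 10} ∪ Ico 11 22) ({0, 2, 3, 7, 8, 9, 10} ∪ Ico 11 22) +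
        lowSumCount ({0, 1, 2, 5, 7, 8, 9, 10} ∪ Ico 11 22)
          ({0, 1, 2, 5, 7, 8, 9, 10} ∪ Ico 11 22) := by
      decide
    omega
  · exact lt_card_filter_powerset_progression ∅ ∅ ∅ (by simp) (by simp) (fun x y => x = y)
      (fun c => rfl) (by simp) (by simp) n hn a d hd
end

section
/- For every integer n ≥ 15, the number of sum-dominant subsets S of {0, 1, ..., n−1} is at least (2×10⁻⁷)·2^n. -/
open Finset Pointwise

/-- Sets avoiding a pair `{x, y}` make up at most three quarters of any family of finite sets
that is closed under adjoining both `x` and `y`. -/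
lemma four_mul_card_filter_not_pair_le {α : Type*} [DecidableEq α] (Y : Finset (Finset α))
    (x y : α) (hY : ∀ R ∈ Y, insert x (insert y R) ∈ Y) :
    4 * (Y.filter fun R => ¬(x ∈ R ∧ y ∈ R)).card ≤ 3 * Y.card := by
  have hsplit := Finset.card_filter_add_card_filter_not (s := Y) (fun R => x ∈ R ∧ y ∈ R)
  have hfib : Y.card ≤ 4 * (Y.filter fun R => x ∈ R ∧ y ∈ R).card := by
    refine Finset.card_le_mul_card_image_of_maps_to (f := fun R => insert x (insert y R))
      (fun R hR => ?_) 4 (fun T _ => ?_)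
    · simp only [Finset.mem_filter]
      exact ⟨hY R hR, by simp, by simp⟩
    · have hsub : (Y.filter fun R => insert x (insert y R) = T) ⊆
          {T, T.erase x, T.erase y, (T.erase x).erase y} := by
        intro R hR
        obtain ⟨-, rfl⟩ := Finset.mem_filter.mp hR
        simp only [Finset.mem_insert, Finset.mem_singleton]
        by_cases hx : x ∈ R <;> by_cases hy : y ∈ R
        · left; ext z; grind
        · right; right; left; ext z; grind
        · right; left; ext z; grind
        · right; right; right; ext z; grind
      exact (Finset.card_le_card hsub).trans Finset.card_le_four
  omega

/-- Among the subsets of `M`, those containing none of `p` disjoint pairs `{lo + i, hi - i}` make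
up a proportion of at most `(3 / 4) ^ p`. -/
lemma card_filter_avoid_pairs_le (M : Finset ℤ) (lo hi : ℤ) (hM : Finset.Icc lo hi ⊆ M) (p : ℕ)
    (hp : 2 * (p : ℤ) ≤ hi - lo + 1) :
    4 ^ p * (M.powerset.filter fun R =>
      ∀ i : ℕ, i < p → ¬(lo + i ∈ R ∧ hi - i ∈ R)).card ≤ 3 ^ p * 2 ^ M.card := by
  induction p with
  | zero => simp
  | succ p ih =>
    push_cast at hp
    specialize ih (by omega)
    have hstep := four_mul_card_filter_not_pair_le
      (M.powerset.filter fun R => ∀ i : ℕ, i < p → ¬(lo + i ∈ R ∧ hi - i ∈ R))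
      (lo + p) (hi - p) (by
        intro R hR
        simp only [Finset.mem_filter, Finset.mem_powerset] at hR ⊢
        refine ⟨?_, fun i hip => ?_⟩
        · refine Finset.insert_subset (hM ?_) (Finset.insert_subset (hM ?_) hR.1) <;>
            rw [Finset.mem_Icc] <;> omega
        · have h := hR.2 i hip
          have h1 : lo + (i : ℤ) ≠ lo + p := by omega
          have h2 : lo + (i : ℤ) ≠ hi - p := by omega
          have h3 : hi - (i : ℤ) ≠ lo + p := by omega
          have h4 : hi - (i : ℤ) ≠ hi - p := by omega
          simpa [h1, h2, h3, h4] using h)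
    have heq : (M.powerset.filter fun R =>
        ∀ i : ℕ, i < p + 1 → ¬(lo + i ∈ R ∧ hi - i ∈ R)) =
        ((M.powerset.filter fun R => ∀ i : ℕ, i < p → ¬(lo + i ∈ R ∧ hi - i ∈ R)).filter
          fun R => ¬(lo + (p : ℤ) ∈ R ∧ hi - p ∈ R)) := by
      ext R
      simp only [Finset.mem_filter, Nat.lt_succ_iff_lt_or_eq, and_assoc]
      grind
    rw [heq]
    calc _ = 4 ^ p * (4 * _) := by rw [pow_succ, mul_assoc]
      _ ≤ 4 ^ p * (3 * _) := Nat.mul_le_mul_left _ hstep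
      _ = 3 * (4 ^ p * _) := by ring
      _ ≤ 3 * _ := Nat.mul_le_mul_left _ ih
      _ = _ := by ring

/-- Bound on the number of subsets `R` of `M` such that `k` is not a sum of an element of
`G ∪ R` and an element of `R`. -/
lemma card_filter_notMem_add_le (M G : Finset ℤ) (k lo hi : ℤ) (p : ℕ) (hk : lo + hi = k)
    (hM : Finset.Icc lo hi ⊆ M) (hG : ∀ g ∈ G, k - g ∈ M ∧ k - g ∉ Finset.Icc lo hi)
    (hp : 2 * (p : ℤ) ≤ hi - lo + 1) :
    ((M.powerset.filter fun R => k ∉ (G ∪ R) + R).card : ℝ) ≤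
      2 ^ M.card / 2 ^ G.card * (3 / 4) ^ p := by
  set F := G.image (k - ·)
  have hFcard : F.card = G.card := Finset.card_image_of_injective _ sub_right_injective
  have hFM : F ⊆ M := by
    intro x hx
    obtain ⟨g, hg, rfl⟩ := Finset.mem_image.mp hx
    exact (hG g hg).1
  have hsub : (M.powerset.filter fun R => k ∉ (G ∪ R) + R) ⊆
      ((M \ F).powerset.filter fun R => ∀ i : ℕ, i < p → ¬(lo + i ∈ R ∧ hi - i ∈ R)) := by
    intro R hR
    simp only [Finset.mem_filter, Finset.mem_powerset] at hR ⊢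
    obtain ⟨hRM, hR⟩ := hR
    refine ⟨fun x hx => Finset.mem_sdiff.mpr ⟨hRM hx, fun hxF => hR ?_⟩, fun i _ h => hR ?_⟩
    · obtain ⟨g, hg, rfl⟩ := Finset.mem_image.mp hxF
      exact Finset.mem_add.mpr ⟨g, Finset.mem_union_left _ hg, _, hx, by ring⟩
    · exact Finset.mem_add.mpr ⟨_, Finset.mem_union_right _ h.1, _, h.2, by rw [← hk]; ring⟩
  have hIcc : Finset.Icc lo hi ⊆ M \ F := by
    intro x hx
    refine Finset.mem_sdiff.mpr ⟨hM hx, fun hxF => ?_⟩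
    obtain ⟨g, hg, rfl⟩ := Finset.mem_image.mp hxF
    exact (hG g hg).2 hx
  have hcount := (Nat.mul_le_mul_left (4 ^ p) (Finset.card_le_card hsub)).trans
    (card_filter_avoid_pairs_le (M \ F) lo hi hIcc p hp)
  have hpow : (2 : ℝ) ^ M.card / 2 ^ G.card = 2 ^ (M \ F).card := by
    rw [div_eq_iff (by positivity), ← pow_add, ← hFcard, Finset.card_sdiff_add_card_eq_card hFM]
  rw [hpow, div_pow, ← mul_div_assoc, le_div_iff₀ (by positivity)]
  have hcount' : (4 : ℝ) ^ p * ((M.powerset.filter fun R => k ∉ (G ∪ R) + R).card : ℝ) ≤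
      3 ^ p * 2 ^ (M \ F).card := by exact_mod_cast hcount
  linarith

lemma sum_three_quarters_pow_half_le (N : ℕ) :
    ∑ j ∈ Finset.range N, (3 / 4 : ℝ) ^ (j / 2) ≤ 8 := by
  have heven : ∀ t : ℕ,
      ∑ j ∈ Finset.range (2 * t), (3 / 4 : ℝ) ^ (j / 2) = 8 - 8 * (3 / 4) ^ t := by
    intro t
    induction t with
    | zero => simp
    | succ t ih =>
      rw [show 2 * (t + 1) = 2 * t + 1 + 1 by ring, Finset.sum_range_succ,
        Finset.sum_range_succ, ih, show 2 * t / 2 = t by omega,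
        show (2 * t + 1) / 2 = t by omega]
      ring
  calc _ ≤ ∑ j ∈ Finset.range (2 * N), (3 / 4 : ℝ) ^ (j / 2) :=
        Finset.sum_le_sum_of_subset_of_nonneg
          (Finset.range_subset_range.mpr (by omega)) (fun _ _ _ => by positivity)
    _ ≤ 8 := by
        rw [heven]
        have : (0 : ℝ) ≤ (3 / 4) ^ N := by positivity
        linarith

/-- The elements below `11` of the sets under construction. -/
def lowerFringe : Finset ℤ := {0, 2, 3, 7, 8, 9, 10}

/-- The distances from `n - 1` of the elements of `upperFringe n`. -/
def upperOffsets : Finset ℤ := {0, 1, 2, 5, 7, 8, 9, 10}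

/-- The elements above `n - 12` of the sets under construction. -/
def upperFringe (n : ℕ) : Finset ℤ := upperOffsets.image ((n : ℤ) - 1 - ·)

lemma mem_Icc_of_mem_lowerFringe : ∀ a ∈ lowerFringe, a ∈ Finset.Icc (0 : ℤ) 10 := by
  decide

lemma mem_Icc_of_mem_upperOffsets : ∀ v ∈ upperOffsets, v ∈ Finset.Icc (0 : ℤ) 10 := by
  decide

lemma mem_Icc_of_mem_upperFringe {n : ℕ} {x : ℤ} (hx : x ∈ upperFringe n) :
    x ∈ Finset.Icc ((n : ℤ) - 11) (n - 1) := by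
  obtain ⟨v, hv, rfl⟩ := Finset.mem_image.mp hx
  have := Finset.mem_Icc.mp (mem_Icc_of_mem_upperOffsets v hv)
  rw [Finset.mem_Icc]
  omega

lemma card_upperFringe (n : ℕ) : (upperFringe n).card = 8 := by
  rw [upperFringe, Finset.card_image_of_injective _ sub_right_injective]
  rfl

/-- The middle part `R` fills in all sums that the two fringes leave undetermined. -/
def FillsSums (n : ℕ) (R : Finset ℤ) : Prop :=
  (∀ j < n - 32, (21 + j : ℤ) ∈ (lowerFringe ∪ R) + R) ∧
    ∀ j < n - 32, (2 * n - 23 - j : ℤ) ∈ (upperFringe n ∪ R) + R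

instance (n : ℕ) : DecidablePred (FillsSums n) := fun R => by
  unfold FillsSums
  infer_instance

lemma card_filter_lower_notMem_le {n j : ℕ} (hj : j < n - 32) :
    (((Finset.Icc (11 : ℤ) (n - 12)).powerset.filter
      fun R => (21 + j : ℤ) ∉ (lowerFringe ∪ R) + R).card : ℝ) ≤
      2 ^ (n - 22) / 2 ^ 7 * (3 / 4) ^ (j / 2) := by
  have h := card_filter_notMem_add_le (Finset.Icc (11 : ℤ) (n - 12)) lowerFringe (21 + j)
    11 (10 + j) (j / 2) (by ring) (Finset.Icc_subset_Icc_right (by omega))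
    (fun g hg => by
      have := Finset.mem_Icc.mp (mem_Icc_of_mem_lowerFringe g hg)
      simp only [Finset.mem_Icc]
      omega) (by omega)
  rwa [Int.card_Icc, show ((n : ℤ) - 12 + 1 - 11).toNat = n - 22 by omega,
    show lowerFringe.card = 7 from rfl] at h

lemma card_filter_upper_notMem_le {n j : ℕ} (hj : j < n - 32) :
    (((Finset.Icc (11 : ℤ) (n - 12)).powerset.filter
      fun R => (2 * n - 23 - j : ℤ) ∉ (upperFringe n ∪ R) + R).card : ℝ) ≤
      2 ^ (n - 22) / 2 ^ 8 * (3 / 4) ^ (j / 2) := by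
  have h := card_filter_notMem_add_le (Finset.Icc (11 : ℤ) (n - 12)) (upperFringe n)
    (2 * n - 23 - j) (n - 11 - j) (n - 12) (j / 2) (by ring)
    (Finset.Icc_subset_Icc_left (by omega))
    (fun g hg => by
      have := Finset.mem_Icc.mp (mem_Icc_of_mem_upperFringe hg)
      simp only [Finset.mem_Icc]
      omega) (by omega)
  rwa [Int.card_Icc, show ((n : ℤ) - 12 + 1 - 11).toNat = n - 22 by omega,
    card_upperFringe] at h

lemma le_card_filter_fillsSums (n : ℕ) (hn : 22 ≤ n) :
    (29 / 32 : ℝ) * 2 ^ (n - 22) ≤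
      ((Finset.Icc (11 : ℤ) (n - 12)).powerset.filter (FillsSums n)).card := by
  set P := (Finset.Icc (11 : ℤ) (n - 12)).powerset with hP
  set B₁ := fun j : ℕ => P.filter fun R => (21 + j : ℤ) ∉ (lowerFringe ∪ R) + R with hB₁
  set B₂ := fun j : ℕ => P.filter fun R => (2 * n - 23 - j : ℤ) ∉ (upperFringe n ∪ R) + R
    with hB₂
  have hcover : (P.filter fun R => ¬FillsSums n R) ⊆
      (Finset.range (n - 32)).biUnion B₁ ∪ (Finset.range (n - 32)).biUnion B₂ := by
    intro R hR
    obtain ⟨hRP, hR⟩ := Finset.mem_filter.mp hR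
    rw [FillsSums, not_and_or] at hR
    push Not at hR
    simp only [hB₁, hB₂, Finset.mem_union, Finset.mem_biUnion, Finset.mem_range,
      Finset.mem_filter]
    rcases hR with ⟨j, hj, h⟩ | ⟨j, hj, h⟩
    · exact Or.inl ⟨j, hj, hRP, h⟩
    · exact Or.inr ⟨j, hj, hRP, h⟩
  have hbad : (P.filter fun R => ¬FillsSums n R).card ≤
      ∑ j ∈ Finset.range (n - 32), (B₁ j).card + ∑ j ∈ Finset.range (n - 32), (B₂ j).card :=
    (Finset.card_le_card hcover).trans <| (Finset.card_union_le _ _).trans <|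
      Nat.add_le_add Finset.card_biUnion_le Finset.card_biUnion_le
  have hbad' : ((P.filter fun R => ¬FillsSums n R).card : ℝ) ≤
      ∑ j ∈ Finset.range (n - 32), ((B₁ j).card : ℝ) +
        ∑ j ∈ Finset.range (n - 32), ((B₂ j).card : ℝ) := by exact_mod_cast hbad
  have hsum₁ : ∑ j ∈ Finset.range (n - 32), ((B₁ j).card : ℝ) ≤ 2 ^ (n - 22) / 2 ^ 7 * 8 := by
    refine (Finset.sum_le_sum fun j hj =>
      card_filter_lower_notMem_le (Finset.mem_range.mp hj)).trans ?_
    rw [← Finset.mul_sum]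
    exact mul_le_mul_of_nonneg_left (sum_three_quarters_pow_half_le _) (by positivity)
  have hsum₂ : ∑ j ∈ Finset.range (n - 32), ((B₂ j).card : ℝ) ≤ 2 ^ (n - 22) / 2 ^ 8 * 8 := by
    refine (Finset.sum_le_sum fun j hj =>
      card_filter_upper_notMem_le (Finset.mem_range.mp hj)).trans ?_
    rw [← Finset.mul_sum]
    exact mul_le_mul_of_nonneg_left (sum_three_quarters_pow_half_le _) (by positivity)
  have htotal : ((P.filter (FillsSums n)).card : ℝ) + (P.filter fun R => ¬FillsSums n R).card =
      2 ^ (n - 22) := by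
    have h := Finset.card_filter_add_card_filter_not (s := P) (FillsSums n)
    rw [hP, Finset.card_powerset, Int.card_Icc,
      show ((n : ℤ) - 12 + 1 - 11).toNat = n - 22 by omega] at h
    exact_mod_cast h
  linarith

lemma mem_lowerFringe_add_self :
    ∀ k ∈ Finset.Icc (0 : ℤ) 20, k ≠ 1 → ∃ a ∈ lowerFringe, ∃ b ∈ lowerFringe, a + b = k := by
  decide

lemma mem_upperOffsets_add_self :
    ∀ k ∈ Finset.Icc (0 : ℤ) 20, ∃ a ∈ upperOffsets, ∃ b ∈ upperOffsets, a + b = k := by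
  decide

lemma mem_lowerFringe_sub_upperOffsets :
    ∀ k ∈ Finset.Icc (-10 : ℤ) 10, ∃ a ∈ lowerFringe, ∃ v ∈ upperOffsets, a - v = k := by
  decide

lemma lowerFringe_add_upperOffsets_ne_six :
    ∀ a ∈ lowerFringe, ∀ v ∈ upperOffsets, a + v ≠ 6 := by
  decide

section Construction

variable {n : ℕ} {R : Finset ℤ}

lemma Icc_erase_one_subset_add_self (hR : FillsSums n R) :
    (Finset.Icc (0 : ℤ) (2 * n - 2)).erase 1 ⊆
      (lowerFringe ∪ R ∪ upperFringe n) + (lowerFringe ∪ R ∪ upperFringe n) := by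
  intro k hk
  obtain ⟨hk1, hk⟩ := Finset.mem_erase.mp hk
  rw [Finset.mem_Icc] at hk
  have hL : lowerFringe ⊆ lowerFringe ∪ R ∪ upperFringe n := by grind
  have hU : upperFringe n ⊆ lowerFringe ∪ R ∪ upperFringe n := by grind
  have hoff : ∀ v ∈ upperOffsets, (n : ℤ) - 1 - v ∈ upperFringe n := fun v hv =>
    Finset.mem_image_of_mem _ hv
  by_cases h₁ : k ≤ 20
  · obtain ⟨a, ha, b, hb, hab⟩ :=
      mem_lowerFringe_add_self k (Finset.mem_Icc.mpr ⟨hk.1, h₁⟩) hk1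
    exact Finset.mem_add.mpr ⟨a, hL ha, b, hL hb, hab⟩
  by_cases h₂ : k ≤ n - 12
  · have h := hR.1 (k - 21).toNat (by omega)
    rw [show (21 + ((k - 21).toNat : ℤ)) = k by omega] at h
    exact Finset.add_subset_add (by grind) (by grind) h
  by_cases h₃ : k ≤ n + 9
  · obtain ⟨a, ha, v, hv, hav⟩ := mem_lowerFringe_sub_upperOffsets (k - (n - 1))
      (Finset.mem_Icc.mpr (by omega))
    exact Finset.mem_add.mpr ⟨a, hL ha, n - 1 - v, hU (hoff v hv), by omega⟩
  by_cases h₄ : k ≤ 2 * n - 23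
  · have h := hR.2 (2 * n - 23 - k).toNat (by omega)
    rw [show (2 * (n : ℤ) - 23 - ((2 * (n : ℤ) - 23 - k).toNat : ℤ)) = k by omega] at h
    exact Finset.add_subset_add (by grind) (by grind) h
  · obtain ⟨a, ha, b, hb, hab⟩ := mem_upperOffsets_add_self (2 * n - 2 - k)
      (Finset.mem_Icc.mpr (by omega))
    exact Finset.mem_add.mpr ⟨n - 1 - a, hU (hoff a ha), n - 1 - b, hU (hoff b hb), by omega⟩

lemma union_fringes_subset_Icc (hn : 22 ≤ n) (hR : R ⊆ Finset.Icc (11 : ℤ) (n - 12)) :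
    lowerFringe ∪ R ∪ upperFringe n ⊆ Finset.Icc (0 : ℤ) (n - 1) := by
  intro x hx
  rw [Finset.mem_union, Finset.mem_union] at hx
  rw [Finset.mem_Icc]
  rcases hx with (hx | hx) | hx
  · have := Finset.mem_Icc.mp (mem_Icc_of_mem_lowerFringe x hx)
    omega
  · have := Finset.mem_Icc.mp (hR hx)
    omega
  · have := Finset.mem_Icc.mp (mem_Icc_of_mem_upperFringe hx)
    omega

lemma sub_ne_of_mem_union_fringes (hn : 22 ≤ n) (hR : R ⊆ Finset.Icc (11 : ℤ) (n - 12))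
    {x y : ℤ} (hx : x ∈ lowerFringe ∪ R ∪ upperFringe n)
    (hy : y ∈ lowerFringe ∪ R ∪ upperFringe n) : x - y ≠ n - 7 := by
  intro h
  have hx' := Finset.mem_Icc.mp (union_fringes_subset_Icc hn hR hx)
  have hy' := Finset.mem_Icc.mp (union_fringes_subset_Icc hn hR hy)
  have hxU : x ∈ upperFringe n := by
    rw [Finset.mem_union, Finset.mem_union] at hx
    rcases hx with (hx | hx) | hx
    · have := Finset.mem_Icc.mp (mem_Icc_of_mem_lowerFringe x hx)
      omega
    · have := Finset.mem_Icc.mp (hR hx)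
      omega
    · exact hx
  have hyL : y ∈ lowerFringe := by
    rw [Finset.mem_union, Finset.mem_union] at hy
    rcases hy with (hy | hy) | hy
    · exact hy
    · have := Finset.mem_Icc.mp (hR hy)
      omega
    · have := Finset.mem_Icc.mp (mem_Icc_of_mem_upperFringe hy)
      omega
  obtain ⟨v, hv, rfl⟩ := Finset.mem_image.mp hxU
  exact lowerFringe_add_upperOffsets_ne_six y hyL v hv (by omega)

lemma sub_self_subset (hn : 22 ≤ n) (hR : R ⊆ Finset.Icc (11 : ℤ) (n - 12)) :
    (lowerFringe ∪ R ∪ upperFringe n) - (lowerFringe ∪ R ∪ upperFringe n) ⊆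
      ((Finset.Icc (-(n - 1) : ℤ) (n - 1)).erase (n - 7)).erase (-(n - 7)) := by
  intro d hd
  obtain ⟨x, hx, y, hy, rfl⟩ := Finset.mem_sub.mp hd
  have hxy := sub_ne_of_mem_union_fringes hn hR hx hy
  have hyx := sub_ne_of_mem_union_fringes hn hR hy hx
  have hx' := Finset.mem_Icc.mp (union_fringes_subset_Icc hn hR hx)
  have hy' := Finset.mem_Icc.mp (union_fringes_subset_Icc hn hR hy)
  simp only [Finset.mem_erase, Finset.mem_Icc]
  omega

lemma card_sub_lt_card_add_of_fillsSums (hn : 22 ≤ n)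
    (hR : R ⊆ Finset.Icc (11 : ℤ) (n - 12)) (hfill : FillsSums n R) :
    ((lowerFringe ∪ R ∪ upperFringe n) - (lowerFringe ∪ R ∪ upperFringe n)).card <
      ((lowerFringe ∪ R ∪ upperFringe n) + (lowerFringe ∪ R ∪ upperFringe n)).card := by
  have hadd := Finset.card_le_card (Icc_erase_one_subset_add_self hfill)
  have hsub := Finset.card_le_card (sub_self_subset hn hR)
  rw [Finset.card_erase_of_mem (by rw [Finset.mem_Icc]; omega), Int.card_Icc] at hadd
  rw [Finset.card_erase_of_mem (by rw [Finset.mem_erase, Finset.mem_Icc]; omega),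
    Finset.card_erase_of_mem (by rw [Finset.mem_Icc]; omega), Int.card_Icc] at hsub
  omega

end Construction

lemma injOn_union_fringes (n : ℕ) :
    Set.InjOn (fun R => lowerFringe ∪ R ∪ upperFringe n)
      ((Finset.Icc (11 : ℤ) (n - 12)).powerset : Set (Finset ℤ)) := by
  have hinter : ∀ R ⊆ Finset.Icc (11 : ℤ) (n - 12),
      (lowerFringe ∪ R ∪ upperFringe n) ∩ Finset.Icc (11 : ℤ) (n - 12) = R := by
    intro R hR
    ext x
    rw [Finset.mem_inter, Finset.mem_union, Finset.mem_union]
    refine ⟨?_, fun hx => ⟨Or.inl (Or.inr hx), hR hx⟩⟩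
    rintro ⟨(hx | hx) | hx, hxM⟩
    · have := Finset.mem_Icc.mp (mem_Icc_of_mem_lowerFringe x hx)
      rw [Finset.mem_Icc] at hxM
      omega
    · exact hx
    · have := Finset.mem_Icc.mp (mem_Icc_of_mem_upperFringe hx)
      rw [Finset.mem_Icc] at hxM
      omega
  intro R hR R' hR' h
  rw [Finset.mem_coe, Finset.mem_powerset] at hR hR'
  rw [← hinter R hR, ← hinter R' hR']
  exact congrArg (· ∩ Finset.Icc (11 : ℤ) (n - 12)) h

/-- Conway's set. -/
lemma card_sub_lt_card_add_conway :
    (({0, 2, 3, 4, 7, 11, 12, 14} : Finset ℤ) - {0, 2, 3, 4, 7, 11, 12, 14}).card <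
      (({0, 2, 3, 4, 7, 11, 12, 14} : Finset ℤ) + {0, 2, 3, 4, 7, 11, 12, 14}).card := by
  decide

theorem many_sum_dominant_sets (n : ℕ) (hn : 15 ≤ n) :
    (((Finset.Icc (0 : ℤ) (n - 1)).powerset.filter
        (fun S : Finset ℤ => (S - S).card < (S + S).card)).card : ℝ)
      ≥ (2 / 10 ^ 7) * 2 ^ n := by
  rcases Nat.lt_or_ge n 22 with hlt | hge
  · have hpos : 1 ≤ ((Finset.Icc (0 : ℤ) (n - 1)).powerset.filter
        (fun S : Finset ℤ => (S - S).card < (S + S).card)).card := by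
      refine Finset.card_pos.mpr ⟨{0, 2, 3, 4, 7, 11, 12, 14}, Finset.mem_filter.mpr
        ⟨Finset.mem_powerset.mpr fun x hx => ?_, card_sub_lt_card_add_conway⟩⟩
      simp only [Finset.mem_insert, Finset.mem_singleton] at hx
      rw [Finset.mem_Icc]
      omega
    have hpow : (2 : ℝ) ^ n ≤ 2 ^ 22 := pow_le_pow_right₀ (by norm_num) hlt.le
    have hpos' : (1 : ℝ) ≤ ((Finset.Icc (0 : ℤ) (n - 1)).powerset.filter
        (fun S : Finset ℤ => (S - S).card < (S + S).card)).card := by exact_mod_cast hpos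
    norm_num at hpow ⊢
    linarith
  · have hcard : ((Finset.Icc (11 : ℤ) (n - 12)).powerset.filter (FillsSums n)).card ≤
        ((Finset.Icc (0 : ℤ) (n - 1)).powerset.filter
          (fun S : Finset ℤ => (S - S).card < (S + S).card)).card := by
      refine Finset.card_le_card_of_injOn (fun R => lowerFringe ∪ R ∪ upperFringe n)
        (fun R hR => ?_) ((injOn_union_fringes n).mono fun R hR => (Finset.mem_filter.mp hR).1)
      obtain ⟨hRM, hfill⟩ := Finset.mem_filter.mp hR
      rw [Finset.mem_powerset] at hRM
      exact Finset.mem_filter.mpr ⟨Finset.mem_powerset.mpr (union_fringes_subset_Icc hge hRM),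
        card_sub_lt_card_add_of_fillsSums hge hRM hfill⟩
    have hcard' : (((Finset.Icc (11 : ℤ) (n - 12)).powerset.filter (FillsSums n)).card : ℝ) ≤
        ((Finset.Icc (0 : ℤ) (n - 1)).powerset.filter
          (fun S : Finset ℤ => (S - S).card < (S + S).card)).card := by exact_mod_cast hcard
    refine le_trans ?_ ((le_card_filter_fillsSums n hge).trans hcard')
    obtain ⟨m, rfl⟩ := Nat.exists_eq_add_of_le hge
    rw [Nat.add_sub_cancel_left, pow_add, ← mul_assoc]
    exact mul_le_mul_of_nonneg_right (by norm_num) (by positivity)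
end

section
/- For every integer n ≥ 4, the number of difference-dominant subsets S of {0, 1, ..., n−1} is at least 0.0015·2^n. -/
open Finset Pointwise

/-- If every difference occurs in `S ⊆ [0, n - 1]` and `1 ∉ S`, so that the sum `1` is missing,
then `S` is difference-dominant. -/
theorem card_add_lt_card_sub_of_one_notMem {n : ℕ} (hn : 2 ≤ n) {S : Finset ℤ}
    (hS : S ⊆ Icc (0 : ℤ) (n - 1)) (h1 : (1 : ℤ) ∉ S)
    (hd : ∀ d ∈ Icc (0 : ℤ) (n - 1), d ∈ S - S) : (S + S).card < (S - S).card := by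
  have hadd : S + S ⊆ (Icc (0 : ℤ) (2 * n - 2)).erase 1 := by
    intro x hx
    obtain ⟨a, ha, b, hb, rfl⟩ := mem_add.1 hx
    have ha' := mem_Icc.1 (hS ha)
    have hb' := mem_Icc.1 (hS hb)
    refine mem_erase.2 ⟨fun h => ?_, mem_Icc.2 ⟨by lia, by lia⟩⟩
    rcases (show a = 1 ∨ b = 1 by lia) with rfl | rfl
    exacts [h1 ha, h1 hb]
  have hsub : Icc (-(n - 1) : ℤ) (n - 1) ⊆ S - S := by
    intro x hx
    have hx' := mem_Icc.1 hx
    rcases le_total 0 x with h | h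
    · exact hd x (mem_Icc.2 ⟨h, hx'.2⟩)
    · obtain ⟨a, ha, b, hb, hab⟩ := mem_sub.1 (hd (-x) (mem_Icc.2 ⟨by lia, by lia⟩))
      exact mem_sub.2 ⟨b, hb, a, ha, by lia⟩
  have h₁ := card_le_card hadd
  have h₂ := card_le_card hsub
  rw [card_erase_of_mem (mem_Icc.2 ⟨by lia, by lia⟩), Int.card_Icc] at h₁
  rw [Int.card_Icc] at h₂
  lia

/-- The number of subsets of `U` containing none of the disjoint sets `Q i`. -/
theorem card_filter_forall_not_subset_le {ι α : Type*} [DecidableEq ι] [DecidableEq α]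
    {c : ℝ} (hc : 0 ≤ c) (Q : ι → Finset α) (I : Finset ι) (U : Finset α)
    (hQU : ∀ i ∈ I, Q i ⊆ U) (hdisj : ∀ i ∈ I, ∀ j ∈ I, i ≠ j → Disjoint (Q i) (Q j))
    (hQc : ∀ i ∈ I, 1 - (1 / 2 : ℝ) ^ (Q i).card ≤ c) :
    ((U.powerset.filter (fun T => ∀ i ∈ I, ¬ Q i ⊆ T)).card : ℝ) ≤ 2 ^ U.card * c ^ I.card := by
  induction I using Finset.induction_on generalizing U with
  | empty => simp
  | insert j I hj ih =>
    have hjU := hQU j (mem_insert_self _ _)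
    have hle : (U.powerset.filter (fun T => ∀ i ∈ insert j I, ¬ Q i ⊆ T)).card ≤
        (((Q j).powerset.erase (Q j)) ×ˢ
          ((U \ Q j).powerset.filter (fun T => ∀ i ∈ I, ¬ Q i ⊆ T))).card := by
      refine card_le_card_of_injOn (fun T => (T ∩ Q j, T \ Q j)) ?_ ?_
      · intro T hT
        obtain ⟨hTU, hT⟩ := mem_filter.1 hT
        refine mem_product.2 ⟨mem_erase.2 ⟨fun h => hT j (mem_insert_self _ _) ?_,
          mem_powerset.2 inter_subset_right⟩, mem_filter.2 ⟨mem_powerset.2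
          (sdiff_subset_sdiff (mem_powerset.1 hTU) le_rfl), fun i hi h => ?_⟩⟩
        · exact inter_eq_right.1 h
        · exact hT i (mem_insert_of_mem hi) (h.trans sdiff_subset)
      · intro T _ T' _ h
        have h₁ : T ∩ Q j = T' ∩ Q j := congrArg Prod.fst h
        have h₂ : T \ Q j = T' \ Q j := congrArg Prod.snd h
        rw [← sdiff_union_inter T (Q j), ← sdiff_union_inter T' (Q j), h₁, h₂]
    have hrec := ih (U \ Q j)
      (fun i hi => subset_sdiff.2 ⟨hQU i (mem_insert_of_mem hi),
        hdisj i (mem_insert_of_mem hi) j (mem_insert_self _ _) (fun h => hj (h ▸ hi))⟩)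
      (fun i hi k hk => hdisj i (mem_insert_of_mem hi) k (mem_insert_of_mem hk))
      (fun i hi => hQc i (mem_insert_of_mem hi))
    rw [card_product, card_erase_of_mem (mem_powerset_self _), card_powerset] at hle
    have hcU : U.card = (Q j).card + (U \ Q j).card := by
      rw [card_sdiff_of_subset hjU]
      have := card_le_card hjU
      lia
    have hq : ((2 ^ (Q j).card - 1 : ℕ) : ℝ) ≤ 2 ^ (Q j).card * c := by
      rw [Nat.cast_sub Nat.one_le_two_pow]
      push_cast
      have h2 : (2 : ℝ) ^ (Q j).card * (1 / 2) ^ (Q j).card = 1 := by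
        rw [← mul_pow]; norm_num
      have := mul_le_mul_of_nonneg_left (hQc j (mem_insert_self _ _))
        (by positivity : (0 : ℝ) ≤ 2 ^ (Q j).card)
      linarith
    calc _ ≤ ((2 ^ (Q j).card - 1 : ℕ) : ℝ) *
          ((U \ Q j).powerset.filter (fun T => ∀ i ∈ I, ¬ Q i ⊆ T)).card := by exact_mod_cast hle
      _ ≤ (2 ^ (Q j).card * c) * (2 ^ (U \ Q j).card * c ^ I.card) := by gcongr
      _ = _ := by rw [hcU, card_insert_of_notMem hj]; ring

/-- The sets `T` for which `d` is not a difference of `T ∪ F`, bounded through the elements `a`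
at distance `d` from `F`. -/
theorem card_filter_notMem_sub_le_of_dist {F U A : Finset ℤ} {d : ℤ} (hAU : A ⊆ U)
    (hA : ∀ a ∈ A, ∃ f ∈ F, a - f = d ∨ f - a = d) :
    ((U.powerset.filter (fun T => d ∉ (T ∪ F) - (T ∪ F))).card : ℝ) ≤
      2 ^ U.card * (1 / 2) ^ A.card := by
  refine le_trans ?_ (card_filter_forall_not_subset_le (by norm_num : (0 : ℝ) ≤ 1 / 2)
    (fun a : ℤ => {a}) A U (fun a ha => singleton_subset_iff.2 (hAU ha))
    (fun a _ b _ hab => disjoint_singleton.2 hab) (fun a _ => by norm_num))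
  refine Nat.cast_le.2 (card_le_card (monotone_filter_right _ fun T _ hT a ha haT => hT ?_))
  have haT := mem_union_left F (singleton_subset_iff.1 haT)
  obtain ⟨f, hf, h | h⟩ := hA a ha
  · exact mem_sub.2 ⟨a, haT, f, mem_union_right _ hf, h⟩
  · exact mem_sub.2 ⟨f, mem_union_right _ hf, a, haT, h⟩

/-- The sets `T` for which `d` is not a difference of `T ∪ F`, bounded through disjoint pairs
`{i, i + d}`. -/
theorem card_filter_notMem_sub_le_of_pairs {F U I : Finset ℤ} {d : ℤ}
    (hI : ∀ i ∈ I, i ∈ U ∪ F) (hId : ∀ i ∈ I, i + d ∈ U ∪ F)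
    (hdisj : ∀ i ∈ I, ∀ j ∈ I, i ≠ j + d) :
    ((U.powerset.filter (fun T => d ∉ (T ∪ F) - (T ∪ F))).card : ℝ) ≤
      2 ^ U.card * (3 / 4) ^ I.card := by
  refine le_trans ?_ (card_filter_forall_not_subset_le (by norm_num : (0 : ℝ) ≤ 3 / 4)
    (fun i : ℤ => ({i, i + d} : Finset ℤ) \ F) I U ?_ ?_ ?_)
  · refine Nat.cast_le.2 (card_le_card (monotone_filter_right _ fun T _ hT i hi hiT => hT ?_))
    have hsub : ({i, i + d} : Finset ℤ) ⊆ T ∪ F := by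
      rw [union_comm]
      exact sdiff_le_iff.1 hiT
    exact mem_sub.2 ⟨i + d, hsub (by simp), i, hsub (by simp), by ring⟩
  · intro i hi
    refine sdiff_le_iff.2 ?_
    rw [sup_eq_union, union_comm]
    simp only [insert_subset_iff, singleton_subset_iff]
    exact ⟨hI i hi, hId i hi⟩
  · intro i hi j hj hij
    refine Disjoint.mono sdiff_subset sdiff_subset ?_
    have h₁ := hdisj i hi j hj
    have h₂ := hdisj j hj i hi
    simp only [disjoint_insert_left, disjoint_singleton_left, mem_insert, mem_singleton]
    lia
  · intro i _
    have hcard : (({i, i + d} : Finset ℤ) \ F).card ≤ 2 :=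
      (card_le_card sdiff_subset).trans card_le_two
    have := pow_le_pow_of_le_one (by norm_num : (0 : ℝ) ≤ 1 / 2) (by norm_num) hcard
    norm_num at this ⊢
    linarith

/-- Union bound over the differences `n - m`, `m ∈ M`, not already realised by the forced
elements `F`. -/
theorem le_card_difference_dominant {n : ℕ} (hn : 2 ≤ n) {F : Finset ℤ} {M : Finset ℕ}
    (hF : F ⊆ Icc (0 : ℤ) (n - 1)) (h1 : (1 : ℤ) ∉ F) {U : Finset ℤ}
    (hU : U = (Icc (0 : ℤ) (n - 1) \ F).erase 1)
    (hM : ∀ d ∈ Icc (0 : ℤ) (n - 1), d ∉ F - F → ∃ m ∈ M, d = n - (m : ℕ)) {p : ℕ → ℝ}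
    (hp : ∀ m ∈ M, ((U.powerset.filter
      (fun T => ((n : ℤ) - (m : ℕ)) ∉ (T ∪ F) - (T ∪ F))).card : ℝ) ≤ 2 ^ U.card * p m) :
    2 ^ U.card * (1 - ∑ m ∈ M, p m) ≤ (((Icc (0 : ℤ) (n - 1)).powerset.filter
        (fun S : Finset ℤ => (S + S).card < (S - S).card)).card : ℝ) := by
  set good := U.powerset.filter (fun T => ∀ m ∈ M, ((n : ℤ) - (m : ℕ)) ∈ (T ∪ F) - (T ∪ F))
  have hgood : good.card ≤ ((Icc (0 : ℤ) (n - 1)).powerset.filter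
      (fun S : Finset ℤ => (S + S).card < (S - S).card)).card := by
    refine card_le_card_of_injOn (fun T => T ∪ F) ?_ ?_
    · intro T hT
      obtain ⟨hTU, hT⟩ := mem_filter.1 hT
      rw [mem_powerset, hU] at hTU
      have hsub : T ∪ F ⊆ Icc (0 : ℤ) (n - 1) :=
        union_subset (hTU.trans ((erase_subset _ _).trans sdiff_subset)) hF
      refine mem_filter.2 ⟨mem_powerset.2 hsub,
        card_add_lt_card_sub_of_one_notMem hn hsub ?_ fun d hd => ?_⟩
      · rw [mem_union]
        rintro (h | h)
        exacts [(mem_erase.1 (hTU h)).1 rfl, h1 h]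
      · by_cases hdF : d ∈ F - F
        · exact sub_subset_sub subset_union_right subset_union_right hdF
        · obtain ⟨m, hm, rfl⟩ := hM d hd hdF
          exact hT m hm
    · intro T hT T' hT' h
      have key : ∀ V ∈ good, (V ∪ F) \ F = V := by
        intro V hV
        have hVU := mem_powerset.1 (mem_filter.1 hV).1
        rw [hU] at hVU
        exact union_sdiff_cancel_right
          ((subset_sdiff.1 (hVU.trans (erase_subset _ _))).2)
      rw [← key T hT, ← key T' hT']
      exact congrArg (· \ F) h
  have hcover : U.powerset ⊆ good ∪ M.biUnion (fun m => U.powerset.filter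
      (fun T => ((n : ℤ) - (m : ℕ)) ∉ (T ∪ F) - (T ∪ F))) := by
    intro T hT
    by_cases h : ∀ m ∈ M, ((n : ℤ) - (m : ℕ)) ∈ (T ∪ F) - (T ∪ F)
    · exact mem_union_left _ (mem_filter.2 ⟨hT, h⟩)
    · push Not at h
      obtain ⟨m, hm, h⟩ := h
      exact mem_union_right _ (mem_biUnion.2 ⟨m, hm, mem_filter.2 ⟨hT, h⟩⟩)
  have hcard : 2 ^ U.card ≤ good.card + ∑ m ∈ M, (U.powerset.filter
      (fun T => ((n : ℤ) - (m : ℕ)) ∉ (T ∪ F) - (T ∪ F))).card := by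
    rw [← card_powerset]
    exact (card_le_card hcover).trans ((card_union_le _ _).trans
      (Nat.add_le_add_left card_biUnion_le _))
  have hcard' : (2 : ℝ) ^ U.card ≤ good.card + ∑ m ∈ M, ((U.powerset.filter
      (fun T => ((n : ℤ) - (m : ℕ)) ∉ (T ∪ F) - (T ∪ F))).card : ℝ) := by exact_mod_cast hcard
  have hsum := sum_le_sum hp
  rw [← mul_sum] at hsum
  have hgood' : (good.card : ℝ) ≤ _ := Nat.cast_le.2 hgood
  linarith

/-- A set of forced elements at both ends of `[0, n - 1]` that realises the twelve largest
differences. -/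
def fringe (n : ℕ) : Finset ℤ :=
  {0, 2, 4, (n : ℤ) - 1, (n : ℤ) - 2, (n : ℤ) - 7, (n : ℤ) - 8}

theorem mem_fringe {n : ℕ} {x : ℤ} : x ∈ fringe n ↔ x = 0 ∨ x = 2 ∨ x = 4 ∨ x = (n : ℤ) - 1 ∨
    x = (n : ℤ) - 2 ∨ x = (n : ℤ) - 7 ∨ x = (n : ℤ) - 8 := by
  simp [fringe]

/-- The elements of `[0, n - 1]` that are neither forced into the set nor equal to `1`. -/
noncomputable def fringeCompl (n : ℕ) : Finset ℤ := (Icc (0 : ℤ) (n - 1) \ fringe n).erase 1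

theorem mem_fringeCompl {n : ℕ} {x : ℤ} :
    x ∈ fringeCompl n ↔ x ≠ 1 ∧ (0 ≤ x ∧ x ≤ (n : ℤ) - 1) ∧ x ∉ fringe n := by
  simp [fringeCompl]

theorem mem_fringeCompl_union {n : ℕ} {x : ℤ} (h1 : x ≠ 1) (h0 : 0 ≤ x) (hx : x ≤ (n : ℤ) - 1) :
    x ∈ fringeCompl n ∪ fringe n := by
  by_cases h : x ∈ fringe n
  · exact mem_union_right _ h
  · exact mem_union_left _ (mem_fringeCompl.2 ⟨h1, ⟨h0, hx⟩, h⟩)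

theorem le_card_fringeCompl {n : ℕ} : n - 8 ≤ (fringeCompl n).card := by
  have h₁ : (fringe n).card ≤ 7 := by
    unfold fringe
    exact (card_insert_le _ _).trans (Nat.succ_le_succ card_le_six)
  have h₂ : (Icc (0 : ℤ) (n - 1)).card - (fringe n).card ≤ (Icc (0 : ℤ) (n - 1) \ fringe n).card :=
    le_card_sdiff _ _
  have h₃ := pred_card_le_card_erase (s := Icc (0 : ℤ) (n - 1) \ fringe n) (a := 1)
  rw [Int.card_Icc] at h₂
  unfold fringeCompl
  lia

theorem mem_fringe_sub_fringe {n : ℕ} {d : ℤ} (h₀ : (n : ℤ) - 13 < d) (h₁ : d ≤ (n : ℤ) - 1) :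
    d ∈ fringe n - fringe n := by
  have key : ∀ l r : ℤ, l ∈ fringe n → (n : ℤ) - 1 - r ∈ fringe n → d = n - 1 - r - l →
      d ∈ fringe n - fringe n := fun l r hl hr h => mem_sub.2 ⟨_, hr, l, hl, h.symm⟩
  obtain ⟨l, hl, r, hr, h⟩ : ∃ l ∈ ({0, 2, 4} : Finset ℤ), ∃ r ∈ ({0, 1, 6, 7} : Finset ℤ),
      d = n - 1 - r - l := by
    simp only [mem_insert, mem_singleton, exists_eq_or_imp, exists_eq_left]
    lia
  simp only [mem_insert, mem_singleton] at hl hr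
  exact key l r (mem_fringe.2 (by lia)) (mem_fringe.2 (by lia)) h

theorem card_fringe_avoiding_le {n m : ℕ} (hm : 13 ≤ m) (hmn : m < n) :
    (((fringeCompl n).powerset.filter (fun T => ((n : ℤ) - (m : ℕ)) ∉
      (T ∪ fringe n) - (T ∪ fringe n))).card : ℝ) ≤ 2 ^ (fringeCompl n).card * (1 / 64) := by
  by_cases hdF : ((n : ℤ) - (m : ℕ)) ∈ fringe n - fringe n
  · rw [filter_false_of_mem fun T _ => not_not.2
      (sub_subset_sub subset_union_right subset_union_right hdF)]
    simp
  set d : ℤ := (n : ℤ) - (m : ℕ) with hd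
  set L : Finset ℤ := {d, d + 2, d + 4} with hL
  set R : Finset ℤ := {(n : ℤ) - 1 - d, (n : ℤ) - 2 - d, (n : ℤ) - 7 - d, (n : ℤ) - 8 - d} with hR
  have hdist : ∀ a ∈ L ∪ R, ∃ f ∈ fringe n, a - f = d ∨ f - a = d := by
    intro a ha
    simp only [hL, hR, mem_union, mem_insert, mem_singleton] at ha
    rcases ha with (h | h | h) | (h | h | h | h)
    · exact ⟨0, mem_fringe.2 (by lia), by lia⟩
    · exact ⟨2, mem_fringe.2 (by lia), by lia⟩
    · exact ⟨4, mem_fringe.2 (by lia), by lia⟩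
    · exact ⟨n - 1, mem_fringe.2 (by lia), by lia⟩
    · exact ⟨n - 2, mem_fringe.2 (by lia), by lia⟩
    · exact ⟨n - 7, mem_fringe.2 (by lia), by lia⟩
    · exact ⟨n - 8, mem_fringe.2 (by lia), by lia⟩
  have hd1 : d ≠ 1 := by
    intro h
    exact hdF (mem_sub.2 ⟨(n : ℤ) - 1, mem_fringe.2 (by lia), (n : ℤ) - 2,
      mem_fringe.2 (by lia), by lia⟩)
  have hsub : L ∪ R ⊆ fringeCompl n := by
    intro a ha
    obtain ⟨f, hf, h⟩ := hdist a ha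
    refine mem_fringeCompl.2 ⟨?_, ?_, fun haF => hdF ?_⟩
    · simp only [hL, hR, mem_union, mem_insert, mem_singleton] at ha
      lia
    · simp only [hL, hR, mem_union, mem_insert, mem_singleton] at ha
      lia
    · rcases h with h | h
      exacts [mem_sub.2 ⟨a, haF, f, hf, h⟩, mem_sub.2 ⟨f, hf, a, haF, h⟩]
  have hLc : L.card = 3 := by
    rw [card_eq_three]
    exact ⟨d, d + 2, d + 4, by lia, by lia, by lia, rfl⟩
  have hRc : R.card = 4 := by
    rw [hR, card_insert_of_notMem, card_insert_of_notMem, card_pair] <;>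
      (try simp only [mem_insert, mem_singleton]) <;> lia
  have hinter : (L ∩ R).card ≤ 1 := by
    refine card_le_one.2 fun a ha b hb => ?_
    simp only [hL, hR, mem_inter, mem_insert, mem_singleton] at ha hb
    lia
  have hcard : 6 ≤ (L ∪ R).card := by
    have := card_union_add_card_inter L R
    lia
  refine (card_filter_notMem_sub_le_of_dist hsub hdist).trans ?_
  have := pow_le_pow_of_le_one (by norm_num : (0 : ℝ) ≤ 1 / 2) (by norm_num) hcard
  gcongr
  exact this.trans (by norm_num)

theorem card_fringe_avoiding_le_of_pairs {n m : ℕ} (hmn : m < n) {I : Finset ℤ}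
    (hI : ∀ i ∈ I, 0 ≤ i ∧ i < m ∧ i ≠ 1)
    (hdisj : ∀ i ∈ I, ∀ j ∈ I, i ≠ j + (n - (m : ℕ))) {k : ℕ} (hk : k ≤ I.card) :
    (((fringeCompl n).powerset.filter (fun T => ((n : ℤ) - (m : ℕ)) ∉
      (T ∪ fringe n) - (T ∪ fringe n))).card : ℝ) ≤
      2 ^ (fringeCompl n).card * (3 / 4) ^ k := by
  by_cases hd1 : (n : ℤ) - (m : ℕ) = 1
  · rw [filter_false_of_mem fun T _ => not_not.2 (sub_subset_sub subset_union_right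
      subset_union_right (mem_sub.2 ⟨(n : ℤ) - 1, mem_fringe.2 (by lia), (n : ℤ) - 2,
      mem_fringe.2 (by lia), by lia⟩))]
    simp only [card_empty, Nat.cast_zero]
    positivity
  refine (card_filter_notMem_sub_le_of_pairs (I := I) (fun i hi => ?_) (fun i hi => ?_)
    hdisj).trans ?_
  · have := hI i hi
    exact mem_fringeCompl_union this.2.2 this.1 (by lia)
  · have := hI i hi
    exact mem_fringeCompl_union (by lia) (by lia) (by lia)
  · have := pow_le_pow_of_le_one (by norm_num : (0 : ℝ) ≤ 3 / 4) (by norm_num) hk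
    gcongr

theorem card_fringe_avoiding_le_of_two_mul_le {n m : ℕ} (hmn : m < n) (h : 2 * m ≤ n) :
    (((fringeCompl n).powerset.filter (fun T => ((n : ℤ) - (m : ℕ)) ∉
      (T ∪ fringe n) - (T ∪ fringe n))).card : ℝ) ≤
      2 ^ (fringeCompl n).card * (3 / 4) ^ (m - 1) := by
  refine card_fringe_avoiding_le_of_pairs hmn (I := (Ico (0 : ℤ) m).erase 1) ?_ ?_ ?_
  · intro i hi
    simp only [mem_erase, mem_Ico] at hi
    lia
  · intro i hi j hj
    simp only [mem_erase, mem_Ico] at hi hj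
    lia
  · have := pred_card_le_card_erase (s := Ico (0 : ℤ) m) (a := 1)
    rw [Int.card_Ico] at this
    lia

/-- At least half of an initial segment lies in the even blocks of length `d`. -/
theorem le_two_mul_card_filter_emod_lt (m : ℕ) {d : ℤ} (hd : 0 < d) :
    m ≤ 2 * ((Ico (0 : ℤ) m).filter (fun i => i % (2 * d) < d)).card := by
  have hle : ((Ico (0 : ℤ) m).filter (fun i => ¬ i % (2 * d) < d)).card ≤
      ((Ico (0 : ℤ) m).filter (fun i => i % (2 * d) < d)).card := by
    refine card_le_card_of_injOn (fun i => i - d) ?_ fun i _ j _ h => by simpa using h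
    intro i hi
    obtain ⟨hi, h⟩ := mem_filter.1 hi
    rw [mem_Ico] at hi
    have h₁ := Int.emod_add_mul_ediv i (2 * d)
    have h₂ := Int.emod_lt_of_pos i (by lia : 0 < 2 * d)
    have h₃ : (i - d) % (2 * d) = i % (2 * d) - d := by
      rw [← Int.emod_eq_of_lt (by lia : 0 ≤ i % (2 * d) - d) (by lia : _ < 2 * d)]
      simp [Int.sub_emod]
    have h₄ : i % (2 * d) ≤ i := by
      have := mul_nonneg (by lia : 0 ≤ 2 * d) (Int.ediv_nonneg hi.1 (by lia : 0 ≤ 2 * d))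
      lia
    exact mem_filter.2 ⟨mem_Ico.2 ⟨by lia, by lia⟩, by simp only [h₃]; lia⟩
  have := card_filter_add_card_filter_not (s := Ico (0 : ℤ) m) (fun i => i % (2 * d) < d)
  rw [Int.card_Ico] at this
  lia

theorem card_fringe_avoiding_le_half {n m : ℕ} (hmn : m < n) :
    (((fringeCompl n).powerset.filter (fun T => ((n : ℤ) - (m : ℕ)) ∉
      (T ∪ fringe n) - (T ∪ fringe n))).card : ℝ) ≤
      2 ^ (fringeCompl n).card * (3 / 4) ^ ((m - 1) / 2) := by
  set d : ℤ := (n : ℤ) - (m : ℕ) with hd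
  have hd0 : 0 < d := by lia
  refine card_fringe_avoiding_le_of_pairs hmn
    (I := ((Ico (0 : ℤ) m).filter (fun i => i % (2 * d) < d)).erase 1) ?_ ?_ ?_
  · intro i hi
    simp only [mem_erase, mem_filter, mem_Ico] at hi
    lia
  · rintro i hi j hj rfl
    simp only [mem_erase, mem_filter, mem_Ico] at hi hj
    have hj0 := Int.emod_nonneg j (by lia : 2 * d ≠ 0)
    have h₃ : (j + d) % (2 * d) = j % (2 * d) + d := by
      rw [← Int.emod_eq_of_lt (by lia : 0 ≤ j % (2 * d) + d) (by lia : _ < 2 * d)]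
      simp [Int.add_emod]
    rw [← hd, h₃] at hi
    lia
  · have h₁ := le_two_mul_card_filter_emod_lt m hd0
    have h₂ := pred_card_le_card_erase
      (s := (Ico (0 : ℤ) m).filter (fun i => i % (2 * d) < d)) (a := 1)
    lia

theorem sum_three_quarters_pow_le (k : ℕ) : ∑ i ∈ range k, (3 / 4 : ℝ) ^ i ≤ 4 := by
  have : (0 : ℝ) ≤ (3 / 4) ^ k := by positivity
  linarith [geom_sum_mul (3 / 4 : ℝ) k]

theorem sum_three_quarters_pow_half_le_s2 (k : ℕ) :
    ∑ i ∈ range k, (3 / 4 : ℝ) ^ (i / 2) ≤ 8 := by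
  have heven : ∀ k : ℕ, ∑ i ∈ range (2 * k), (3 / 4 : ℝ) ^ (i / 2) =
      2 * ∑ i ∈ range k, (3 / 4 : ℝ) ^ i := by
    intro k
    induction k with
    | zero => simp
    | succ k ih =>
      rw [show 2 * (k + 1) = 2 * k + 1 + 1 by ring, sum_range_succ, sum_range_succ, ih,
        sum_range_succ, show 2 * k / 2 = k by lia, show (2 * k + 1) / 2 = k by lia]
      ring
  have hle : ∑ i ∈ range k, (3 / 4 : ℝ) ^ (i / 2) ≤ ∑ i ∈ range (2 * k), (3 / 4 : ℝ) ^ (i / 2) :=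
    sum_le_sum_of_subset_of_nonneg (range_mono (by lia)) fun _ _ _ => by positivity
  linarith [heven k, sum_three_quarters_pow_le k]

theorem sum_avoidance_bounds_le {n : ℕ} (hn : 52 ≤ n) :
    ∑ m ∈ Ico 13 n, (if 2 * m ≤ n then (3 / 4 : ℝ) ^ (m - 1) else (3 / 4) ^ ((m - 1) / 2)) ≤
      1 / 2 := by
  have h₁ : ∑ m ∈ Ico 13 27, (3 / 4 : ℝ) ^ (m - 1) ≤ (3 / 4) ^ 12 * 4 := by
    rw [sum_Ico_eq_sum_range]
    refine (mul_le_mul_of_nonneg_left (sum_three_quarters_pow_le 14)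
      (by positivity : (0 : ℝ) ≤ (3 / 4) ^ 12)).trans' (le_of_eq ?_)
    rw [mul_sum]
    refine sum_congr rfl fun i _ => ?_
    rw [← pow_add]
    congr 1
    lia
  have h₂ : ∑ m ∈ Ico 27 n, (3 / 4 : ℝ) ^ ((m - 1) / 2) ≤ (3 / 4) ^ 13 * 8 := by
    rw [sum_Ico_eq_sum_range]
    refine (mul_le_mul_of_nonneg_left (sum_three_quarters_pow_half_le_s2 (n - 27))
      (by positivity : (0 : ℝ) ≤ (3 / 4) ^ 13)).trans' (le_of_eq ?_)
    rw [mul_sum]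
    refine sum_congr rfl fun i _ => ?_
    rw [← pow_add]
    congr 1
    lia
  rw [← sum_Ico_consecutive _ (by lia : 13 ≤ 27) (by lia : 27 ≤ n)]
  have h₃ : ∑ m ∈ Ico 13 27, (if 2 * m ≤ n then (3 / 4 : ℝ) ^ (m - 1)
      else (3 / 4) ^ ((m - 1) / 2)) ≤ ∑ m ∈ Ico 13 27, (3 / 4 : ℝ) ^ (m - 1) := by
    refine sum_le_sum fun m hm => ?_
    rw [mem_Ico] at hm
    rw [if_pos (by lia)]
  have h₄ : ∑ m ∈ Ico 27 n, (if 2 * m ≤ n then (3 / 4 : ℝ) ^ (m - 1)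
      else (3 / 4) ^ ((m - 1) / 2)) ≤ ∑ m ∈ Ico 27 n, (3 / 4 : ℝ) ^ ((m - 1) / 2) := by
    refine sum_le_sum fun m _ => ?_
    split_ifs
    · exact pow_le_pow_of_le_one (by norm_num) (by norm_num) (Nat.div_le_self _ _)
    · exact le_rfl
  norm_num at h₁ h₂
  linarith

theorem many_difference_dominant_sets (n : ℕ) (hn : 4 ≤ n) :
    (((Finset.Icc (0 : ℤ) (n - 1)).powerset.filter
        (fun S : Finset ℤ => (S + S).card < (S - S).card)).card : ℝ)
      ≥ 0.0015 * 2 ^ n := by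
  rcases lt_or_ge n 10 with hn10 | hn10
  · have hmem : ({0, 1, 3} : Finset ℤ) ∈ (Finset.Icc (0 : ℤ) (n - 1)).powerset.filter
        (fun S : Finset ℤ => (S + S).card < (S - S).card) := by
      refine mem_filter.2 ⟨mem_powerset.2 fun x hx => ?_, by decide⟩
      simp only [mem_insert, mem_singleton] at hx
      exact mem_Icc.2 (by lia)
    have hpos : (1 : ℝ) ≤ _ := Nat.one_le_cast.2 (card_pos.2 ⟨_, hmem⟩)
    have hpow := pow_le_pow_right₀ (by norm_num : (1 : ℝ) ≤ 2) (by lia : n ≤ 9)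
    norm_num at hpow ⊢
    linarith
  have hF : fringe n ⊆ Icc (0 : ℤ) (n - 1) := by
    intro x hx
    rw [mem_fringe] at hx
    exact mem_Icc.2 (by lia)
  have h1 : (1 : ℤ) ∉ fringe n := by
    rw [mem_fringe]
    lia
  have hM : ∀ d ∈ Icc (0 : ℤ) (n - 1), d ∉ fringe n - fringe n →
      ∃ m ∈ Ico 13 n, d = n - (m : ℕ) := by
    intro d hd hdF
    rw [mem_Icc] at hd
    have h13 : d ≤ (n : ℤ) - 13 := by
      by_contra! h
      exact hdF (mem_fringe_sub_fringe h hd.2)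
    have h0 : d ≠ 0 := by
      rintro rfl
      exact hdF (mem_sub.2 ⟨0, mem_fringe.2 (by lia), 0, mem_fringe.2 (by lia), by lia⟩)
    exact ⟨(n - d).toNat, mem_Ico.2 ⟨by lia, by lia⟩, by lia⟩
  obtain ⟨p, hp, hsum⟩ : ∃ p : ℕ → ℝ, (∀ m ∈ Ico 13 n,
      (((fringeCompl n).powerset.filter (fun T => ((n : ℤ) - (m : ℕ)) ∉
        (T ∪ fringe n) - (T ∪ fringe n))).card : ℝ) ≤ 2 ^ (fringeCompl n).card * p m) ∧
      ∑ m ∈ Ico 13 n, p m ≤ 0.6 := by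
    rcases lt_or_ge n 52 with h | h
    · refine ⟨fun _ => 1 / 64, fun m hm => ?_, ?_⟩
      · rw [mem_Ico] at hm
        exact card_fringe_avoiding_le hm.1 hm.2
      · rw [sum_const, Nat.card_Ico, nsmul_eq_mul]
        have : ((n - 13 : ℕ) : ℝ) ≤ 38 := by exact_mod_cast (by lia : n - 13 ≤ 38)
        linarith
    · refine ⟨_, fun m hm => ?_, (sum_avoidance_bounds_le h).trans (by norm_num)⟩
      rw [mem_Ico] at hm
      split_ifs with h2
      · exact card_fringe_avoiding_le_of_two_mul_le hm.2 h2
      · exact card_fringe_avoiding_le_half hm.2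
  refine ge_iff_le.2 (le_trans ?_ (le_card_difference_dominant (by lia) hF h1 rfl hM hp))
  have hU : (2 : ℝ) ^ (n - 8) ≤ 2 ^ (fringeCompl n).card :=
    pow_le_pow_right₀ (by norm_num) le_card_fringeCompl
  have hpow : (2 : ℝ) ^ n = 2 ^ (n - 8) * 256 := by
    rw [show (256 : ℝ) = 2 ^ 8 by norm_num, ← pow_add, Nat.sub_add_cancel (by lia)]
  calc (0.0015 : ℝ) * 2 ^ n = 2 ^ (n - 8) * 0.384 := by rw [hpow]; ring
    _ ≤ 2 ^ (fringeCompl n).card * (1 - ∑ m ∈ Ico 13 n, p m) := by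
      gcongr
      linarith
end

section
/- For any positive integer n, the sum over all subsets S of {0, 1, ..., n−1} of |S+S| equals 2^n·(2n−11) + 19·3^{(n−1)/2} if n is odd, and equals 2^n·(2n−11) + 11·3^{n/2} if n is even. -/
open Finset Pointwise

/-- The number of subsets `S` of `U` such that `k ∉ S + S`. -/
def missCount (U : Finset ℤ) (k : ℤ) : ℤ :=
  ∑ S ∈ U.powerset, if k ∈ S + S then 0 else 1

theorem mem_insert_add_insert_iff {t : Finset ℤ} {x k : ℤ} (h : k - x ∉ insert x t) :
    k ∈ insert x t + insert x t ↔ k ∈ t + t := by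
  simp only [mem_add]
  constructor
  · rintro ⟨a, ha, b, hb, rfl⟩
    have hax : a ≠ x := by
      rintro rfl
      exact h (by simpa using hb)
    have hbx : b ≠ x := by
      rintro rfl
      exact h (by simpa using ha)
    exact ⟨a, mem_of_mem_insert_of_ne ha hax, b, mem_of_mem_insert_of_ne hb hbx, rfl⟩
  · rintro ⟨a, ha, b, hb, rfl⟩
    exact ⟨a, mem_insert_of_mem ha, b, mem_insert_of_mem hb, rfl⟩

theorem missCount_insert_free {U : Finset ℤ} {x k : ℤ} (hx : x ∉ U) (h : k - x ∉ insert x U) :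
    missCount (insert x U) k = 2 * missCount U k := by
  unfold missCount
  rw [sum_powerset_insert hx, two_mul]
  congr 1
  refine sum_congr rfl fun t ht => ?_
  exact if_congr (mem_insert_add_insert_iff fun h' =>
    h (insert_subset_insert x (mem_powerset.1 ht) h')) rfl rfl

theorem missCount_insert_self {U : Finset ℤ} {x k : ℤ} (hx : x ∉ U) (h : x + x = k) :
    missCount (insert x U) k = missCount U k := by
  unfold missCount
  rw [sum_powerset_insert hx, add_eq_left]
  refine sum_eq_zero fun t _ => if_pos ?_
  exact mem_add.2 ⟨x, mem_insert_self x t, x, mem_insert_self x t, h⟩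

theorem missCount_insert_pair {U : Finset ℤ} {x y k : ℤ} (hx : x ∉ U) (hy : y ∉ U) (hxy : x ≠ y)
    (h : x + y = k) : missCount (insert x (insert y U)) k = 3 * missCount U k := by
  have hx' : x ∉ insert y U := by simp [hx, hxy]
  have hkx : k - x = y := by omega
  have hky : k - y = x := by omega
  unfold missCount
  rw [sum_powerset_insert hx', sum_powerset_insert hy, sum_powerset_insert hy]
  have e₁ : ∑ t ∈ U.powerset, (if k ∈ insert y t + insert y t then (0 : ℤ) else 1) =
      ∑ t ∈ U.powerset, if k ∈ t + t then 0 else 1 := by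
    refine sum_congr rfl fun t ht => ?_
    refine if_congr (mem_insert_add_insert_iff ?_) rfl rfl
    rw [hky]
    exact fun h' => hx' (insert_subset_insert y (mem_powerset.1 ht) h')
  have e₂ : ∑ t ∈ U.powerset, (if k ∈ insert x t + insert x t then (0 : ℤ) else 1) =
      ∑ t ∈ U.powerset, if k ∈ t + t then 0 else 1 := by
    refine sum_congr rfl fun t ht => ?_
    refine if_congr (mem_insert_add_insert_iff ?_) rfl rfl
    rw [hkx, mem_insert, not_or]
    exact ⟨hxy.symm, fun h' => hy (mem_powerset.1 ht h')⟩
  have e₃ : ∑ t ∈ U.powerset, (if k ∈ insert x (insert y t) + insert x (insert y t)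
      then (0 : ℤ) else 1) = 0 :=
    sum_eq_zero fun t _ => if_pos (mem_add.2 ⟨x, by simp, y, by simp, h⟩)
  rw [e₁, e₂, e₃]
  ring

theorem missCount_union_free {U V : Finset ℤ} {k : ℤ} (hd : Disjoint V U)
    (h : ∀ x ∈ V, k - x ∉ V ∪ U) : missCount (V ∪ U) k = 2 ^ #V * missCount U k := by
  induction V using Finset.induction_on with
  | empty => simp
  | insert x V hx ih =>
    rw [disjoint_insert_left] at hd
    rw [insert_union] at h ⊢
    rw [missCount_insert_free (by simp [hx, hd.1]) (h x (mem_insert_self x V)), ih hd.2,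
      card_insert_of_notMem hx]
    · ring
    · exact fun y hy h' => h y (mem_insert_of_mem hy) (mem_insert_of_mem h')

/-- The number of subsets `S` of an interval of `m + 1` integers such that `S + S` misses the sum
of the two endpoints. -/
def centralMissCount : ℕ → ℤ
  | 0 => 1
  | 1 => 3
  | m + 2 => 3 * centralMissCount m

theorem missCount_Icc_central (m : ℕ) (a : ℤ) :
    missCount (Icc a (a + m)) (a + (a + m)) = centralMissCount m := by
  induction m using Nat.twoStepInduction generalizing a with
  | zero =>
    have : Icc a (a + (0 : ℕ)) = insert a ∅ := by simp
    rw [this, missCount_insert_self (by simp) (by simp)]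
    simp [missCount, centralMissCount]
  | one =>
    have : Icc a (a + (1 : ℕ)) = insert a (insert (a + 1) ∅) := by
      ext; simp; omega
    rw [this, missCount_insert_pair (by simp) (by simp) (by simp) (by simp)]
    simp [missCount, centralMissCount]
  | more m ih _ =>
    have : Icc a (a + (m + 2 : ℕ)) =
        insert a (insert (a + (m + 2 : ℕ)) (Icc (a + 1) (a + 1 + m))) := by
      ext; simp; omega
    rw [this, missCount_insert_pair (by simp) (by simp; omega) (by omega) rfl, centralMissCount,
      ← ih (a + 1)]
    congr 2
    push_cast
    ring

theorem missCount_Icc_low {i m : ℕ} (h : i ≤ m) :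
    missCount (Icc 0 (m : ℤ)) i = 2 ^ (m - i) * centralMissCount i := by
  have e : Icc 0 (m : ℤ) = Ioc (i : ℤ) m ∪ Icc 0 (i : ℤ) := by
    ext; simp; omega
  have hc := missCount_Icc_central i 0
  simp only [zero_add] at hc
  rw [e, missCount_union_free, hc, Int.card_Ioc]
  · congr 2; omega
  · rw [disjoint_left]; intro x; simp; omega
  · intro x; simp; omega

theorem missCount_Icc_high {i m : ℕ} (h : i ≤ m) :
    missCount (Icc 0 (m : ℤ)) (2 * m - i) = 2 ^ (m - i) * centralMissCount i := by
  have e : Icc 0 (m : ℤ) = Ico 0 ((m : ℤ) - i) ∪ Icc ((m : ℤ) - i) m := by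
    ext; simp; omega
  have hc := missCount_Icc_central i ((m : ℤ) - i)
  rw [show (m : ℤ) - i + i = m by ring, show (m : ℤ) - i + m = 2 * m - i by ring] at hc
  rw [e, missCount_union_free, hc, Int.card_Ico]
  · congr 2; omega
  · rw [disjoint_left]; intro x; simp; omega
  · intro x; simp; omega

theorem card_add_self_eq_sum {S : Finset ℤ} {m : ℕ} (hS : S ⊆ Icc 0 (m : ℤ)) :
    (#(S + S) : ℤ) = ∑ i ∈ range (2 * m + 1), (1 - if (i : ℤ) ∈ S + S then 0 else 1) := by
  have e : S + S = ((range (2 * m + 1)).filter fun i : ℕ => (i : ℤ) ∈ S + S).image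
      (Nat.cast : ℕ → ℤ) := by
    ext k
    simp only [mem_image, mem_filter, mem_range]
    constructor
    · intro hk
      obtain ⟨a, ha, b, hb, rfl⟩ := mem_add.1 hk
      have ha' := mem_Icc.1 (hS ha)
      have hb' := mem_Icc.1 (hS hb)
      have hab : ((a + b).toNat : ℤ) = a + b := Int.toNat_of_nonneg (by omega)
      exact ⟨(a + b).toNat, ⟨by omega, by rwa [hab]⟩, hab⟩
    · rintro ⟨i, ⟨_, hi⟩, rfl⟩
      exact hi
  conv_lhs => rw [e, card_image_of_injective _ Nat.cast_injective, card_filter]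
  push_cast
  refine sum_congr rfl fun i _ => ?_
  split_ifs <;> rfl

theorem sum_card_add_self (m : ℕ) :
    ∑ S ∈ (Icc 0 (m : ℤ)).powerset, (#(S + S) : ℤ) =
      ∑ i ∈ range (2 * m + 1), (2 ^ (m + 1) - missCount (Icc 0 (m : ℤ)) i) := by
  rw [sum_congr rfl fun S hS => card_add_self_eq_sum (mem_powerset.1 hS), sum_comm]
  refine sum_congr rfl fun i _ => ?_
  rw [sum_sub_distrib, missCount]
  simp

theorem sum_missCount (m : ℕ) :
    ∑ i ∈ range (2 * m + 1), missCount (Icc 0 (m : ℤ)) i =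
      2 * ∑ i ∈ range m, 2 ^ (m - i) * centralMissCount i + centralMissCount m := by
  rw [show 2 * m + 1 = (m + 1) + m by ring, sum_range_add, sum_range_succ,
    ← sum_range_reflect (fun i => missCount (Icc 0 (m : ℤ)) ((m + 1 + i : ℕ) : ℤ)),
    missCount_Icc_low le_rfl,
    sum_congr rfl fun i hi => missCount_Icc_low (mem_range.1 hi).le]
  have e : ∑ i ∈ range m, missCount (Icc 0 (m : ℤ)) ((m + 1 + (m - 1 - i) : ℕ) : ℤ) =
      ∑ i ∈ range m, 2 ^ (m - i) * centralMissCount i := by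
    refine sum_congr rfl fun i hi => ?_
    rw [mem_range] at hi
    rw [← missCount_Icc_high hi.le]
    congr 1
    omega
  rw [e]
  simp
  ring

theorem centralMissCount_two_mul (j : ℕ) : centralMissCount (2 * j) = 3 ^ j := by
  induction j with
  | zero => rfl
  | succ j ih => rw [mul_add, mul_one, centralMissCount, ih, pow_succ']

theorem centralMissCount_two_mul_add_one (j : ℕ) : centralMissCount (2 * j + 1) = 3 ^ (j + 1) := by
  induction j with
  | zero => rfl
  | succ j ih =>
    rw [show 2 * (j + 1) + 1 = 2 * j + 1 + 2 by ring, centralMissCount, ih, pow_succ' _ (j + 1)]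

theorem sum_two_pow_mul_centralMissCount_succ (m : ℕ) :
    ∑ i ∈ range (m + 1), 2 ^ (m + 1 - i) * centralMissCount i =
      2 * ∑ i ∈ range m, 2 ^ (m - i) * centralMissCount i + 2 * centralMissCount m := by
  rw [sum_range_succ, mul_sum]
  congr 1
  · refine sum_congr rfl fun i hi => ?_
    rw [mem_range] at hi
    rw [Nat.sub_add_comm hi.le, pow_succ]
    ring
  · simp

theorem sum_two_pow_mul_centralMissCount (j : ℕ) :
    ∑ i ∈ range (2 * j), 2 ^ (2 * j - i) * centralMissCount i = 10 * (4 ^ j - 3 ^ j) := by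
  induction j with
  | zero => simp
  | succ j ih =>
    rw [show 2 * (j + 1) = 2 * j + 1 + 1 by ring, sum_two_pow_mul_centralMissCount_succ,
      sum_two_pow_mul_centralMissCount_succ, ih, centralMissCount_two_mul,
      centralMissCount_two_mul_add_one]
    ring

theorem average_sumset_size (n : ℕ) (hn : 0 < n) :
    (∑ S ∈ (Finset.Icc (0 : ℤ) (n - 1)).powerset, ((S + S).card : ℤ))
      = 2 ^ n * (2 * n - 11) +
        (if Odd n then 19 * 3 ^ ((n - 1) / 2) else 11 * 3 ^ (n / 2)) := by
  obtain ⟨m, rfl⟩ : ∃ m, n = m + 1 := ⟨n - 1, by omega⟩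
  rw [show ((m + 1 : ℕ) : ℤ) - 1 = m by push_cast; ring, sum_card_add_self, sum_sub_distrib,
    sum_missCount]
  simp only [sum_const, card_range, nsmul_eq_mul]
  obtain ⟨j, rfl | rfl⟩ := Nat.even_or_odd' m
  · rw [if_pos ⟨j, rfl⟩, sum_two_pow_mul_centralMissCount, centralMissCount_two_mul,
      show (2 * j + 1 - 1) / 2 = j by omega, pow_succ, pow_mul]
    push_cast
    ring
  · rw [if_neg (by rw [Nat.not_odd_iff_even]; exact ⟨j + 1, by ring⟩),
      sum_two_pow_mul_centralMissCount_succ, sum_two_pow_mul_centralMissCount,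
      centralMissCount_two_mul, centralMissCount_two_mul_add_one,
      show (2 * j + 1 + 1) / 2 = j + 1 by omega, pow_succ, pow_succ, pow_mul]
    push_cast
    ring
end

section
/- There is an absolute constant C > 0 such that for every positive integer n, the sum over all subsets S of {0, 1, ..., n−1} of |S−S| differs from 2^n·(2n−7) by at most C·n·6^{n/3}; that is, |Σ_{S ⊆ {0,...,n−1}} |S−S| − 2^n(2n−7)| ≤ C·n·6^{n/3}. -/
open Finset Pointwise

/-- Number of subsets of `U` that contain no pair `{i, i + k}` with `i ∈ P`, for disjoint pairs. -/
theorem card_powerset_filter_avoid_pairs (k : ℤ) (P : Finset ℤ) : ∀ U : Finset ℤ,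
    (∀ i ∈ P, i ∈ U ∧ i + k ∈ U ∧ ∀ j ∈ P, i + k ≠ j) →
    4 ^ P.card * {S ∈ U.powerset | ∀ i ∈ P, ¬(i ∈ S ∧ i + k ∈ S)}.card
      = 3 ^ P.card * 2 ^ U.card := by
  induction P using Finset.induction_on with
  | empty => intro U _; simp
  | insert a P ha ih =>
    intro U hU
    obtain ⟨haU, hbU, hab⟩ := hU a (mem_insert_self a P)
    have hk : a + k ≠ a := hab a (mem_insert_self a P)
    set V := (U.erase a).erase (a + k) with hV
    have hbV : a + k ∉ V := by simp [hV]
    have haV : a ∉ insert (a + k) V := by simp [hV, hk.symm]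
    have hUV : U = insert a (insert (a + k) V) := by
      rw [hV, insert_erase (by simp [hk, hbU]), insert_erase haU]
    have hPV : ∀ i ∈ P, i ∈ V ∧ i + k ∈ V ∧ ∀ j ∈ P, i + k ≠ j := by
      intro i hi
      obtain ⟨h1, h2, h3⟩ := hU i (mem_insert_of_mem hi)
      have h4 := h3 a (mem_insert_self a P)
      have h5 := hab i (mem_insert_of_mem hi)
      have h6 : i ≠ a := fun h => ha (h ▸ hi)
      refine ⟨?_, ?_, fun j hj => h3 j (mem_insert_of_mem hj)⟩
      · simp [hV, h1, h6, h5.symm]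
      · simp [hV, h2, h4, h6]
    have key : {S ∈ U.powerset | ∀ i ∈ insert a P, ¬(i ∈ S ∧ i + k ∈ S)}.card
        = 3 * {S ∈ V.powerset | ∀ i ∈ P, ¬(i ∈ S ∧ i + k ∈ S)}.card := by
      rw [card_filter, hUV, sum_powerset_insert haV, sum_powerset_insert hbV,
        sum_powerset_insert hbV, card_filter, mul_sum, ← sum_add_distrib, ← sum_add_distrib,
        ← sum_add_distrib]
      refine sum_congr rfl fun S hS => ?_
      rw [mem_powerset] at hS
      have haS : a ∉ S := fun h => haV (mem_insert_of_mem (hS h))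
      have hbS : a + k ∉ S := fun h => hbV (hS h)
      have hne : ∀ i ∈ P, i ≠ a ∧ i + k ≠ a ∧ i ≠ a + k ∧ i + k ≠ a + k := by
        intro i hi
        obtain ⟨h1, h2, -⟩ := hPV i hi
        simp only [hV, mem_erase] at h1 h2
        exact ⟨h1.2.1, h2.2.1, h1.1, h2.1⟩
      have e (T : Finset ℤ) (hT : ∀ i, i ≠ a → i ≠ a + k → (i ∈ T ↔ i ∈ S)) :
          (∀ i ∈ P, ¬(i ∈ T ∧ i + k ∈ T)) ↔ ∀ i ∈ P, ¬(i ∈ S ∧ i + k ∈ S) := by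
        refine forall₂_congr fun i hi => ?_
        obtain ⟨h1, h2, h3, h4⟩ := hne i hi
        rw [hT i h1 h3, hT (i + k) h2 h4]
      simp only [forall_mem_insert]
      simp only [e (insert (a + k) S) (by intro i h1 h2; simp [h2]),
        e (insert a S) (by intro i h1 h2; simp [h1]),
        e (insert a (insert (a + k) S)) (by intro i h1 h2; simp [h1, h2])]
      have hk0 : k ≠ 0 := by rintro rfl; simp at hk
      simp [haS, hbS, hk0]
      split_ifs <;> rfl
    rw [key, card_insert_of_notMem ha, hUV, card_insert_of_notMem haV, card_insert_of_notMem hbV]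
    have := ih V hPV
    rw [pow_succ, pow_succ, pow_add]
    linear_combination 12 * this

/-- The number of subsets of `{0, …, n - 1}` whose difference set does not contain `d`. -/
noncomputable def numAvoidDiff (n : ℕ) (d : ℤ) : ℕ :=
  {S ∈ (Icc (0 : ℤ) (n - 1)).powerset | ∀ i ∈ S, i + d ∉ S}.card

theorem numAvoidDiff_neg (n : ℕ) (d : ℤ) : numAvoidDiff n (-d) = numAvoidDiff n d := by
  unfold numAvoidDiff
  congr 1
  refine filter_congr fun S _ => ⟨fun h i hi hd => h _ hd ?_, fun h i hi hd => h _ hd ?_⟩ <;>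
    simpa using hi

theorem numAvoidDiff_zero (n : ℕ) : numAvoidDiff n 0 = 1 := by
  unfold numAvoidDiff
  rw [card_eq_one]
  refine ⟨∅, ?_⟩
  ext S
  simp only [mem_filter, mem_powerset, add_zero, mem_singleton]
  constructor
  · rintro ⟨-, h⟩
    exact eq_empty_of_forall_notMem fun i hi => h i hi hi
  · rintro rfl
    simp

theorem sum_Icc_neg_of_even (g : ℤ → ℝ) (hg : ∀ d, g (-d) = g d) (m : ℕ) :
    ∑ d ∈ Icc (-(m : ℤ)) m, g d = g 0 + 2 * ∑ j ∈ range m, g (j + 1) := by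
  induction m with
  | zero => simp
  | succ m ih =>
    have h : Icc (-((m + 1 : ℕ) : ℤ)) ((m + 1 : ℕ) : ℤ)
        = insert (-((m : ℤ) + 1)) (insert ((m : ℤ) + 1) (Icc (-(m : ℤ)) m)) := by
      ext x
      simp only [mem_Icc, mem_insert]
      push_cast
      omega
    rw [h, sum_insert, sum_insert, ih, sum_range_succ, hg]
    · ring
    · simp
    · simp only [mem_Icc, mem_insert]
      omega

theorem sum_card_sub_self (m : ℕ) :
    ∑ S ∈ (Icc (0 : ℤ) ((m + 1 : ℕ) - 1)).powerset, ((S - S).card : ℝ)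
      = (2 * m + 1) * 2 ^ (m + 1) - 1
        - 2 * ∑ j ∈ range m, (numAvoidDiff (m + 1) (j + 1) : ℝ) := by
  have h1 : ∀ S ∈ (Icc (0 : ℤ) ((m + 1 : ℕ) - 1)).powerset, ((S - S).card : ℝ)
      = ∑ d ∈ Icc (-(m : ℤ)) m, (1 - if ∀ i ∈ S, i + d ∉ S then (1 : ℝ) else 0) := by
    intro S hS
    have : S - S = {d ∈ Icc (-(m : ℤ)) m | ¬ ∀ i ∈ S, i + d ∉ S} := by
      ext d
      simp only [mem_sub, mem_filter, mem_Icc, not_forall, not_not]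
      constructor
      · rintro ⟨y, hy, z, hz, rfl⟩
        have h2 := mem_Icc.1 (mem_powerset.1 hS hy)
        have h3 := mem_Icc.1 (mem_powerset.1 hS hz)
        push_cast at h2 h3
        exact ⟨by omega, z, hz, by simpa using hy⟩
      · rintro ⟨-, i, hi, hd⟩
        exact ⟨_, hd, i, hi, by ring⟩
    rw [this, card_filter]
    push_cast
    refine sum_congr rfl fun d _ => ?_
    split_ifs <;> simp_all
  have h2 (d : ℤ) : ∑ S ∈ (Icc (0 : ℤ) ((m + 1 : ℕ) - 1)).powerset,
      (1 - if ∀ i ∈ S, i + d ∉ S then (1 : ℝ) else 0)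
      = 2 ^ (m + 1) - numAvoidDiff (m + 1) d := by
    rw [sum_sub_distrib, numAvoidDiff, card_filter]
    simp
  rw [sum_congr rfl h1, sum_comm, sum_congr rfl fun d _ => h2 d, sum_Icc_neg_of_even,
    sum_sub_distrib, numAvoidDiff_zero]
  · simp
    ring
  · intro d
    rw [numAvoidDiff_neg]

theorem numAvoidDiff_eq {n k : ℕ} (hkn : k ≤ n) (h : n ≤ 2 * k) :
    (numAvoidDiff n k : ℝ) = 2 ^ n * (3 / 4) ^ (n - k) := by
  have key := card_powerset_filter_avoid_pairs k (Icc (0 : ℤ) (n - k - 1)) (Icc (0 : ℤ) (n - 1))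
    (by
      intro i hi
      simp only [mem_Icc] at hi ⊢
      refine ⟨by omega, by omega, fun j hj => by omega⟩)
  have hf : {S ∈ (Icc (0 : ℤ) (n - 1)).powerset |
      ∀ i ∈ Icc (0 : ℤ) (n - k - 1), ¬(i ∈ S ∧ i + k ∈ S)}.card = numAvoidDiff n k := by
    unfold numAvoidDiff
    congr 1
    refine filter_congr fun S hS => ⟨fun h i hi hd => h i ?_ ⟨hi, hd⟩, fun h i _ hd => h i hd.1 hd.2⟩
    have h1 := mem_Icc.1 (mem_powerset.1 hS hi)
    have h2 := mem_Icc.1 (mem_powerset.1 hS hd)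
    rw [mem_Icc]
    omega
  have hc1 : (Icc (0 : ℤ) (n - k - 1)).card = n - k := by rw [Int.card_Icc]; omega
  have hc2 : (Icc (0 : ℤ) (n - 1)).card = n := by rw [Int.card_Icc]; omega
  rw [hf, hc1, hc2] at key
  have key' : (4 : ℝ) ^ (n - k) * numAvoidDiff n k = 3 ^ (n - k) * 2 ^ n := by exact_mod_cast key
  rw [div_pow, mul_div_assoc', eq_div_iff (by positivity)]
  linarith

theorem exists_numAvoidDiff_le {n k : ℕ} (hk : 0 < k) (h : 2 * k ≤ n) :
    ∃ p, n ≤ 3 * p ∧ (numAvoidDiff n k : ℝ) ≤ 2 ^ n * (3 / 4) ^ p := by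
  set P : Finset ℤ := {i ∈ Icc (0 : ℤ) (n - k - 1) | i % (2 * k) < k} with hP
  have hk' : (0 : ℤ) < 2 * k := by omega
  have key := card_powerset_filter_avoid_pairs k P (Icc (0 : ℤ) (n - 1))
    (by
      intro i hi
      simp only [hP, mem_Icc, mem_filter] at hi ⊢
      refine ⟨by omega, by omega, fun j hj hij => ?_⟩
      have h1 := Int.emod_nonneg i hk'.ne'
      have h2 := Int.emod_add_mul_ediv i (2 * k)
      have h3 : j = (i % (2 * k) + k) + 2 * k * (i / (2 * k)) := by linarith
      have h4 : j % (2 * k) = i % (2 * k) + k := by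
        rw [h3, Int.add_mul_emod_self_left, Int.emod_eq_of_lt (by omega) (by omega)]
      omega)
  have hf : numAvoidDiff n k ≤
      {S ∈ (Icc (0 : ℤ) (n - 1)).powerset | ∀ i ∈ P, ¬(i ∈ S ∧ i + k ∈ S)}.card :=
    card_le_card (monotone_filter_right _ fun S _ h i _ hd => h i hd.1 hd.2)
  have hc2 : (Icc (0 : ℤ) (n - 1)).card = n := by rw [Int.card_Icc]; omega
  refine ⟨P.card, ?_, ?_⟩
  · have hcov : Icc (0 : ℤ) (n - 1) ⊆
        P ∪ (P.image (· + (k : ℤ)) ∪ P.image (· + (2 * k : ℤ))) := by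
      intro x hx
      simp only [mem_union, mem_image]
      simp only [hP, mem_Icc, mem_filter] at hx ⊢
      have h1 := Int.emod_nonneg x hk'.ne'
      have h2 := Int.emod_add_mul_ediv x (2 * k)
      have h0 := Int.emod_lt_of_pos x hk'
      by_cases hxk : x % (2 * k) < k
      · by_cases hxn : x + k < n
        · left; omega
        · right; right
          have h5 : ¬ x < 2 * k := fun hlt => by
            rw [Int.emod_eq_of_lt hx.1 hlt] at hxk
            omega
          refine ⟨x - 2 * k, ⟨by omega, ?_⟩, by ring⟩
          rwa [Int.sub_emod_right]
      · right; left
        have h3 : x - k = (x % (2 * k) - k) + 2 * k * (x / (2 * k)) := by linarith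
        have h4 : (x - k) % (2 * k) = x % (2 * k) - k := by
          rw [h3, Int.add_mul_emod_self_left, Int.emod_eq_of_lt (by omega) (by omega)]
        have h5 : ¬ x < k := fun hlt => by
          rw [Int.emod_eq_of_lt hx.1 (by omega)] at hxk
          omega
        exact ⟨x - k, ⟨by omega, by omega⟩, by ring⟩
    have h1 := card_le_card hcov
    have h2 := card_union_le P (P.image (· + (k : ℤ)) ∪ P.image (· + (2 * k : ℤ)))
    have h3 := card_union_le (P.image (· + (k : ℤ))) (P.image (· + (2 * k : ℤ)))
    have h4 := card_image_le (s := P) (f := (· + (k : ℤ)))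
    have h5 := card_image_le (s := P) (f := (· + (2 * k : ℤ)))
    omega
  · rw [hc2] at key
    have h1 := Nat.mul_le_mul_left (4 ^ P.card) hf
    rw [key] at h1
    have h2 : (4 : ℝ) ^ P.card * numAvoidDiff n k ≤ 3 ^ P.card * 2 ^ n := by exact_mod_cast h1
    rw [div_pow, mul_div_assoc', le_div_iff₀ (by positivity)]
    linarith

theorem two_pow_mul_three_quarters_pow_le {n p : ℕ} (h : n ≤ 3 * p) :
    (2 : ℝ) ^ n * (3 / 4) ^ p ≤ 6 ^ ((n : ℝ) / 3) := by
  have hT : ((6 : ℝ) ^ ((n : ℝ) / 3)) ^ 3 = 6 ^ n := by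
    rw [← Real.rpow_natCast, ← Real.rpow_mul (by norm_num), ← Real.rpow_natCast 6 n]
    congr 1
    push_cast
    ring
  refine le_of_pow_le_pow_left₀ (n := 3) (by norm_num) (by positivity) ?_
  rw [hT, mul_pow, ← pow_mul, ← pow_mul, mul_comm p 3, mul_comm n 3, pow_mul]
  calc ((2 : ℝ) ^ 3) ^ n * (3 / 4) ^ (3 * p) ≤ (2 ^ 3) ^ n * (3 / 4) ^ n := by
        gcongr ?_ * ?_
        exact pow_le_pow_of_le_one (by norm_num) (by norm_num) h
    _ = 6 ^ n := by rw [← mul_pow]; norm_num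

theorem abs_numAvoidDiff_sub_le {n k : ℕ} (hk : 0 < k) (hkn : k ≤ n) :
    |(numAvoidDiff n k : ℝ) - 2 ^ n * (3 / 4) ^ (n - k)| ≤ 6 ^ ((n : ℝ) / 3) := by
  rcases le_total n (2 * k) with h | h
  · rw [numAvoidDiff_eq hkn h, sub_self, abs_zero]
    positivity
  · obtain ⟨p, hp, hle⟩ := exists_numAvoidDiff_le hk h
    have h1 := hle.trans (two_pow_mul_three_quarters_pow_le hp)
    have h2 := two_pow_mul_three_quarters_pow_le (n := n) (p := n - k) (by omega)
    exact abs_sub_le_of_nonneg_of_le (by positivity) h1 (by positivity) h2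

theorem sum_two_pow_mul_three_quarters_pow (m : ℕ) :
    ∑ j ∈ range m, (2 : ℝ) ^ (m + 1) * (3 / 4) ^ (m + 1 - (j + 1))
      = 3 * 2 ^ (m + 1) - 4 * (2 ^ (m + 1) * (3 / 4) ^ (m + 1)) := by
  have h : ∑ j ∈ range m, (3 / 4 : ℝ) ^ (m - j) = 3 - 4 * (3 / 4) ^ (m + 1) := by
    induction m with
    | zero => norm_num
    | succ m ih =>
      rw [sum_range_succ', sum_congr rfl fun j _ => by rw [Nat.add_sub_add_right], ih]
      simp only [Nat.sub_zero]
      ring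
  simp only [Nat.add_sub_add_right]
  rw [← mul_sum, h]
  ring

theorem average_difference_set_size :
    ∃ C : ℝ, 0 < C ∧ ∀ n : ℕ, 0 < n →
      |(∑ S ∈ (Finset.Icc (0 : ℤ) (n - 1)).powerset, ((S - S).card : ℝ))
          - 2 ^ n * (2 * n - 7)| ≤ C * n * (6 : ℝ) ^ ((n : ℝ) / 3) := by
  refine ⟨11, by norm_num, fun n hn => ?_⟩
  obtain ⟨m, rfl⟩ := Nat.exists_eq_succ_of_ne_zero hn.ne'
  rw [Nat.succ_eq_add_one, sum_card_sub_self]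
  set T : ℝ := (6 : ℝ) ^ (((m + 1 : ℕ) : ℝ) / 3) with hT
  have hT1 : 1 ≤ T := Real.one_le_rpow (by norm_num) (by positivity)
  have hdiff : |∑ j ∈ range m, ((numAvoidDiff (m + 1) (j + 1) : ℝ)
      - 2 ^ (m + 1) * (3 / 4) ^ (m + 1 - (j + 1)))| ≤ m * T := by
    refine (abs_sum_le_sum_abs _ _).trans ?_
    refine (sum_le_card_nsmul _ _ T fun j hj => ?_).trans (by simp)
    have := abs_numAvoidDiff_sub_le (n := m + 1) (k := j + 1) (by omega)
      (by have := mem_range.1 hj; omega)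
    exact_mod_cast this
  rw [sum_sub_distrib, sum_two_pow_mul_three_quarters_pow] at hdiff
  have hE := two_pow_mul_three_quarters_pow_le (n := m + 1) (p := m + 1) (by omega)
  have hE0 : (0 : ℝ) ≤ 2 ^ (m + 1) * (3 / 4) ^ (m + 1) := by positivity
  have hmT : 0 ≤ m * T := by positivity
  rw [← hT] at hE
  generalize (2 : ℝ) ^ (m + 1) * (3 / 4) ^ (m + 1) = E at *
  rw [abs_le] at hdiff ⊢
  push_cast
  constructor <;> nlinarith [hdiff.1, hdiff.2]
end

section
/- Fix integers a and d with d ≠ 0, and for each n let P_n = {a + i·d : 0 ≤ i ≤ n−1}. Then the average over all subsets S of P_n of |S−S| is asymptotic to 2n−7, and the average over all subsets S of P_n of |S+S| is asymptotic to 2n−11; precisely, 2^{−n}·Σ_{S ⊆ P_n} |S−S| − (2n−7) → 0 and 2^{−n}·Σ_{S ⊆ P_n} |S+S| − (2n−11) → 0 as n → ∞. -/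
open Finset Pointwise Filter

/-- The number of subsets of `U` containing no pair `{i, f i}`, `i ∈ I`, of a matching. -/
lemma card_filter_avoid_matching {α : Type*} [DecidableEq α] (f : α → α) (I : Finset α) :
    ∀ U : Finset α, I ⊆ U → (∀ i ∈ I, f i ∈ U) → Set.InjOn f I → (∀ i ∈ I, f i ∉ I) →
      (#{S ∈ U.powerset | ∀ i ∈ I, i ∈ S → f i ∉ S} : ℝ) = (3 / 4) ^ #I * 2 ^ #U := by
  induction I using Finset.induction_on with
  | empty => intro U _ _ _ _; simp
  | insert a I ha ih =>
    intro U hIU hfU hinj hdisj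
    have haU : a ∈ U := hIU (mem_insert_self _ _)
    have hfa : f a ∈ U := hfU a (mem_insert_self _ _)
    have hne : f a ≠ a := fun h => hdisj a (mem_insert_self _ _) (by simp [h])
    have hfaI : f a ∉ I := fun h => hdisj a (mem_insert_self _ _) (mem_insert_of_mem h)
    have hf_ne_a : ∀ i ∈ I, f i ≠ a := fun i hi h =>
      hdisj i (mem_insert_of_mem hi) (by simp [h])
    have hf_ne : ∀ i ∈ I, f i ≠ f a := fun i hi h =>
      ha (hinj (mem_insert_of_mem hi) (mem_insert_self _ _) h ▸ hi)
    set V := (U.erase a).erase (f a) with hV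
    have hfaV : f a ∉ V := notMem_erase _ _
    have haV : a ∉ insert (f a) V := by simp [hV, hne.symm]
    have hU : U = insert a (insert (f a) V) := by
      rw [hV, insert_erase (mem_erase.2 ⟨hne, hfa⟩), insert_erase haU]
    have hIV : I ⊆ V := fun i hi => mem_erase.2
      ⟨fun h => hfaI (h ▸ hi), mem_erase.2 ⟨fun h => ha (h ▸ hi), hIU (mem_insert_of_mem hi)⟩⟩
    have hfV : ∀ i ∈ I, f i ∈ V := fun i hi => mem_erase.2
      ⟨hf_ne i hi, mem_erase.2 ⟨hf_ne_a i hi, hfU i (mem_insert_of_mem hi)⟩⟩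
    have key := ih V hIV hfV (hinj.mono (by simp)) fun i hi h =>
      hdisj i (mem_insert_of_mem hi) (mem_insert_of_mem h)
    have hcard : #U = #V + 2 := by
      rw [hU, card_insert_of_notMem haV, card_insert_of_notMem hfaV]
    have h_ne_a : ∀ i ∈ I, i ≠ a := fun i hi h => ha (h ▸ hi)
    have h_ne_fa : ∀ i ∈ I, i ≠ f a := fun i hi h => hfaI (h ▸ hi)
    rw [card_insert_of_notMem ha, hcard, card_filter, hU, sum_powerset_insert haV,
      sum_powerset_insert hfaV, sum_powerset_insert hfaV]
    rw [card_filter] at key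
    set g : Finset α → ℕ := fun S => if ∀ i ∈ I, i ∈ S → f i ∉ S then 1 else 0 with hg
    have e₁ : ∀ S ∈ V.powerset,
        (if ∀ i ∈ insert a I, i ∈ S → f i ∉ S then 1 else 0) = g S := by
      intro S hS
      have : a ∉ S := fun h => haV (mem_insert_of_mem (mem_powerset.1 hS h))
      simp [hg, this]
    have e₂ : ∀ S ∈ V.powerset, (if ∀ i ∈ insert a I, i ∈ insert (f a) S →
        f i ∉ insert (f a) S then 1 else 0) = g S := by
      intro S hS
      have : a ∉ S := fun h => haV (mem_insert_of_mem (mem_powerset.1 hS h))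
      simp only [hg]
      congr 1
      grind
    have e₃ : ∀ S ∈ V.powerset, (if ∀ i ∈ insert a I, i ∈ insert a S →
        f i ∉ insert a S then 1 else 0) = g S := by
      intro S hS
      have : f a ∉ S := fun h => hfaV (mem_powerset.1 hS h)
      simp only [hg]
      congr 1
      grind
    have e₄ : ∀ S ∈ V.powerset, (if ∀ i ∈ insert a I, i ∈ insert a (insert (f a) S) →
        f i ∉ insert a (insert (f a) S) then 1 else 0) = 0 := by
      intro S hS
      simp
    rw [sum_congr rfl e₁, sum_congr rfl e₂, sum_congr rfl e₃, sum_congr rfl e₄]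
    push_cast at key ⊢
    rw [key, sum_const_zero]
    ring

/-- The proportion of subsets `S` of `{0, …, n - 1}` such that `d ∉ S - S`. -/
noncomputable def diffMissing (n d : ℕ) : ℝ :=
  #{S ∈ (range n).powerset | ∀ i ∈ S, i + d ∉ S} / 2 ^ n

/-- The proportion of subsets `S` of `{0, …, n - 1}` such that `k ∉ S + S`. -/
noncomputable def sumMissing (n k : ℕ) : ℝ :=
  #{S ∈ (range n).powerset | ∀ i ∈ S, ∀ j ∈ S, i + j ≠ k} / 2 ^ n

lemma diffMissing_nonneg (n d : ℕ) : 0 ≤ diffMissing n d := by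
  unfold diffMissing; positivity

lemma diffMissing_zero (n : ℕ) : diffMissing n 0 = (1 / 2) ^ n := by
  have : {S ∈ (range n).powerset | ∀ i ∈ S, i + 0 ∉ S} = {∅} := by
    ext S
    simp only [mem_filter, mem_powerset, mem_singleton, add_zero]
    constructor
    · rintro ⟨-, h⟩
      exact eq_empty_of_forall_notMem fun i hi => h i hi hi
    · rintro rfl
      simp
  rw [diffMissing, this]
  simp

lemma diffMissing_eq_of_le_two_mul {n d : ℕ} (h : n ≤ 2 * d) :
    diffMissing n d = (3 / 4) ^ (n - d) := by
  have key := card_filter_avoid_matching (· + d) (range (n - d)) (range n)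
    (by intro i; simp; omega) (by intro i; simp; omega) (by intro i; simp)
    (by intro i; simp; omega)
  have : {S ∈ (range n).powerset | ∀ i ∈ S, i + d ∉ S} =
      {S ∈ (range n).powerset | ∀ i ∈ range (n - d), i ∈ S → i + d ∉ S} := by
    refine filter_congr fun S hS => ⟨fun H i _ hi => H i hi, fun H i hi hid => ?_⟩
    have := mem_range.1 (mem_powerset.1 hS hid)
    exact H i (mem_range.2 (by omega)) hi hid
  rw [diffMissing, this, key]
  simp

lemma diffMissing_le (n d : ℕ) : diffMissing n d ≤ (9 / 10) ^ (n - d) := by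
  rcases Nat.eq_zero_or_pos d with rfl | hd
  · rw [diffMissing_zero]
    exact pow_le_pow_left₀ (by norm_num) (by norm_num) _
  set I := {i ∈ range (n - d) | i % (2 * d) < d} with hI
  have key := card_filter_avoid_matching (· + d) I (range n)
    (by intro i; simp [hI]; omega) (by intro i; simp [hI]; omega) (by intro i; simp)
    (by
      intro i hi hid
      simp only [hI, mem_filter] at hi hid
      have h₁ : (i + d) % (2 * d) = i % (2 * d) + d := by
        rw [Nat.add_mod, Nat.mod_eq_of_lt (show d < 2 * d by omega), Nat.mod_eq_of_lt (by omega)]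
      omega)
  have hcard : n - d ≤ 2 * #I := by
    have h₁ := card_filter_add_card_filter_not (s := range (n - d)) (fun i => i % (2 * d) < d)
    have h₂ : #{i ∈ range (n - d) | ¬ i % (2 * d) < d} ≤ #I := by
      refine card_le_card_of_injOn (· - d) ?_ ?_
      · intro i hi
        simp only [coe_filter, mem_range, Set.mem_ofPred_eq, hI] at hi ⊢
        have hle := Nat.mod_le i (2 * d)
        have hlt := Nat.mod_lt i (show 0 < 2 * d by omega)
        refine ⟨by omega, ?_⟩
        have e : i - d = (i % (2 * d) - d) + 2 * d * (i / (2 * d)) := by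
          have := Nat.mod_add_div i (2 * d)
          omega
        rw [e, Nat.add_mul_mod_self_left, Nat.mod_eq_of_lt (by omega)]
        omega
      · intro i hi j hj hij
        simp only [coe_filter, mem_range, Set.mem_ofPred_eq] at hi hj hij
        have := Nat.mod_le i (2 * d)
        have := Nat.mod_le j (2 * d)
        omega
    rw [card_range, ← hI] at h₁
    omega
  have hle : #{S ∈ (range n).powerset | ∀ i ∈ S, i + d ∉ S} ≤
      #{S ∈ (range n).powerset | ∀ i ∈ I, i ∈ S → i + d ∉ S} :=
    card_le_card (monotone_filter_right _ fun S _ H i _ hi => H i hi)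
  calc diffMissing n d
      ≤ (#{S ∈ (range n).powerset | ∀ i ∈ I, i ∈ S → i + d ∉ S} : ℝ) / 2 ^ n := by
        unfold diffMissing; gcongr
    _ = (3 / 4) ^ #I := by rw [key]; simp
    _ ≤ ((9 / 10) ^ 2) ^ #I := pow_le_pow_left₀ (by norm_num) (by norm_num) _
    _ = (9 / 10) ^ (2 * #I) := by rw [pow_mul]
    _ ≤ (9 / 10) ^ (n - d) := pow_le_pow_of_le_one (by norm_num) (by norm_num) hcard

lemma tendsto_sum_diffMissing :
    Tendsto (fun n : ℕ => ∑ d ∈ range (n + 1), diffMissing n d) atTop (nhds 4) := by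
  have h4 : ∑' m : ℕ, (3 / 4 : ℝ) ^ m = 4 := by
    rw [tsum_geometric_of_lt_one (by norm_num) (by norm_num)]; norm_num
  rw [← h4]
  have hsum : ∀ n : ℕ, ∑ d ∈ range (n + 1), diffMissing n d =
      ∑' m : ℕ, if m ≤ n then diffMissing n (n - m) else 0 := by
    intro n
    rw [tsum_eq_sum (s := range (n + 1)) (by intro m; simp; intro h h'; omega),
      ← sum_range_reflect]
    refine sum_congr rfl fun m hm => ?_
    rw [mem_range] at hm
    rw [if_pos (by omega)]
    congr 1
  simp_rw [hsum]
  refine tendsto_tsum_of_dominated_convergence (bound := fun m : ℕ => (9 / 10 : ℝ) ^ m)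
    (summable_geometric_of_lt_one (by norm_num) (by norm_num)) (fun m => ?_)
    (Eventually.of_forall fun n m => ?_)
  · refine tendsto_const_nhds.congr' ?_
    filter_upwards [eventually_ge_atTop (2 * m)] with n hn
    rw [if_pos (by omega), diffMissing_eq_of_le_two_mul (by omega)]
    congr 1
    omega
  · split_ifs with h
    · rw [Real.norm_of_nonneg (diffMissing_nonneg _ _)]
      refine (diffMissing_le _ _).trans_eq ?_
      congr 1
      omega
    · simp only [norm_zero]
      positivity

lemma sumMissing_eq {n k : ℕ} (hk : k < 2 * n) :
    sumMissing n k = (3 / 4) ^ ((k + 1) / 2 - (k + 1 - n)) * if Even k then 1 / 2 else 1 := by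
  set I := Ico (k + 1 - n) ((k + 1) / 2) with hI
  have hmatch (U : Finset ℕ) (hU : ∀ i < n, 2 * i ≠ k → i ∈ U) :=
    card_filter_avoid_matching (k - ·) I U
      (by intro i hi; rw [hI, mem_Ico] at hi; exact hU i (by omega) (by omega))
      (by intro i hi; rw [hI, mem_Ico] at hi; exact hU _ (by omega) (by omega))
      (by
        intro i hi j hj hij
        simp only [hI, coe_Ico, Set.mem_Ico] at hi hj hij
        omega)
      (by intro i hi; rw [hI, mem_Ico] at *; omega)
  have hequiv : ∀ S ⊆ range n, (∀ i ∈ S, ∀ j ∈ S, i + j ≠ k) ↔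
      (∀ i ∈ S, 2 * i ≠ k) ∧ ∀ i ∈ I, i ∈ S → k - i ∉ S := by
    intro S hS
    refine ⟨fun H => ⟨fun i hi h => H i hi i hi (by omega), fun i hI' hi hj =>
      H i hi _ hj (by rw [hI, mem_Ico] at hI'; omega)⟩, fun ⟨H₁, H₂⟩ => ?_⟩
    have aux : ∀ i ∈ S, ∀ j ∈ S, i < j → i + j ≠ k := by
      intro i hi j hj hij hk
      have := mem_range.1 (hS hj)
      refine H₂ i (by rw [hI, mem_Ico]; omega) hi ?_
      rwa [show k - i = j by omega]
    intro i hi j hj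
    rcases lt_trichotomy i j with h | rfl | h
    · exact aux i hi j hj h
    · have := H₁ i hi
      omega
    · rw [add_comm]
      exact aux j hj i hi h
  have hIcard : #I = (k + 1) / 2 - (k + 1 - n) := by simp [hI]
  rw [sumMissing, ← hIcard]
  split_ifs with he
  · obtain ⟨c, hc⟩ := he
    have hcn : c ∈ range n := mem_range.2 (by omega)
    have : {S ∈ (range n).powerset | ∀ i ∈ S, ∀ j ∈ S, i + j ≠ k} =
        {S ∈ ((range n).erase c).powerset | ∀ i ∈ I, i ∈ S → k - i ∉ S} := by
      ext S
      simp only [mem_filter, mem_powerset, subset_erase]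
      constructor
      · rintro ⟨hS, H⟩
        obtain ⟨H₁, H₂⟩ := (hequiv S hS).1 H
        exact ⟨⟨hS, fun h => H₁ c h (by omega)⟩, H₂⟩
      · rintro ⟨⟨hS, hcS⟩, H⟩
        refine ⟨hS, (hequiv S hS).2 ⟨fun i hi h => hcS ?_, H⟩⟩
        rwa [show c = i by omega]
    rw [this, hmatch _ (fun i hi h => mem_erase.2 ⟨by omega, mem_range.2 hi⟩),
      card_erase_of_mem hcn, card_range]
    obtain ⟨m, rfl⟩ : ∃ m, n = m + 1 := ⟨n - 1, by have := mem_range.1 hcn; omega⟩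
    rw [Nat.add_sub_cancel, pow_succ]
    field_simp
  · have : {S ∈ (range n).powerset | ∀ i ∈ S, ∀ j ∈ S, i + j ≠ k} =
        {S ∈ (range n).powerset | ∀ i ∈ I, i ∈ S → k - i ∉ S} := by
      refine filter_congr fun S hS => ?_
      rw [hequiv S (mem_powerset.1 hS)]
      exact and_iff_right fun i _ h => he ⟨i, by omega⟩
    rw [this, hmatch _ fun i hi _ => mem_range.2 hi]
    simp

lemma hasSum_three_quarters_pow : HasSum (fun m : ℕ => (3 / 4 : ℝ) ^ m) 4 := by
  convert hasSum_geometric_of_lt_one (r := (3 / 4 : ℝ)) (by norm_num) (by norm_num) using 1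
  norm_num

lemma tendsto_sum_sumMissing :
    Tendsto (fun n : ℕ => ∑ k ∈ range (2 * n), sumMissing n k) atTop (nhds 11) := by
  have hlow : HasSum (fun k : ℕ => (3 / 4 : ℝ) ^ ((k + 1) / 2) * if Even k then 1 / 2 else 1)
      (4 * (1 / 2) + 4 * (3 / 4)) := by
    refine HasSum.even_add_odd
      ((hasSum_three_quarters_pow.mul_right (1 / 2)).congr_fun fun m => ?_)
      ((hasSum_three_quarters_pow.mul_right (3 / 4)).congr_fun fun m => ?_)
    · rw [if_pos (even_two_mul m), show (2 * m + 1) / 2 = m by omega]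
    · rw [if_neg (by simp), show (2 * m + 1 + 1) / 2 = m + 1 by omega, mul_one, pow_succ]
  have hhigh : HasSum (fun k : ℕ => (3 / 4 : ℝ) ^ (k / 2) * if Even k then 1 else 1 / 2)
      (4 * 1 + 4 * (1 / 2)) := by
    refine HasSum.even_add_odd
      ((hasSum_three_quarters_pow.mul_right 1).congr_fun fun m => ?_)
      ((hasSum_three_quarters_pow.mul_right (1 / 2)).congr_fun fun m => ?_)
    · rw [if_pos (even_two_mul m), show 2 * m / 2 = m by omega]
    · rw [if_neg (by simp), show (2 * m + 1) / 2 = m by omega]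
  have h := hlow.tendsto_sum_nat.add hhigh.tendsto_sum_nat
  norm_num only at h
  refine h.congr fun n => ?_
  rw [two_mul, sum_range_add, ← sum_range_reflect (fun k => sumMissing n (n + k))]
  congr 1
  · refine sum_congr rfl fun k hk => ?_
    rw [mem_range] at hk
    rw [sumMissing_eq (by omega), show (k + 1) - n = 0 by omega, Nat.sub_zero]
  · refine sum_congr rfl fun k hk => ?_
    rw [mem_range] at hk
    rw [sumMissing_eq (by omega)]
    congr 1
    · congr 1
      omega
    · by_cases he : Even k
      · rw [if_pos he, if_neg]
        rw [Nat.even_iff] at *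
        omega
      · rw [if_neg he, if_pos]
        rw [Nat.even_iff] at *
        omega

/-- Double counting: the average over subsets `S` of `range n` of the number of `t ∈ T` which are
not missed by `S`. -/
lemma sum_card_filter_not_div {β : Type*} (n : ℕ) (T : Finset β) (p : Finset ℕ → β → Prop)
    [∀ S t, Decidable (p S t)] :
    (∑ S ∈ (range n).powerset, (#{t ∈ T | ¬ p S t} : ℝ)) / 2 ^ n =
      ∑ t ∈ T, (1 - (#{S ∈ (range n).powerset | p S t} : ℝ) / 2 ^ n) := by
  have h := sum_card_bipartiteAbove_eq_sum_card_bipartiteBelow (s := (range n).powerset) (t := T)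
    (fun S t => ¬ p S t)
  simp only [bipartiteAbove, bipartiteBelow] at h
  rw [← Nat.cast_sum, h, Nat.cast_sum, sum_div]
  refine sum_congr rfl fun t _ => ?_
  have h' := card_filter_add_card_filter_not (s := (range n).powerset) (fun S => p S t)
  rw [card_powerset, card_range] at h'
  have h'' : (2 : ℝ) ^ n = #{S ∈ (range n).powerset | p S t} +
      #{S ∈ (range n).powerset | ¬ p S t} := by exact_mod_cast h'.symm
  rw [eq_sub_iff_add_eq, ← add_div, add_comm, ← h'', div_self (by positivity)]

lemma sum_powerset_image {M α : Type*} [AddCommMonoid M] [DecidableEq α] {φ : ℕ → α}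
    (hφ : Function.Injective φ) (s : Finset ℕ) (F : Finset α → M) :
    ∑ S ∈ (s.image φ).powerset, F S = ∑ S ∈ s.powerset, F (S.image φ) := by
  rw [powerset_image, sum_image]
  exact fun S _ T _ h => image_injective hφ h

lemma card_image_progression_add {a d : ℤ} (hd : d ≠ 0) {n : ℕ} {S : Finset ℕ}
    (hS : S ⊆ range n) :
    #(S.image (fun i : ℕ => a + (i : ℤ) * d) + S.image (fun i : ℕ => a + (i : ℤ) * d)) =
      #{k ∈ range (2 * n) | ¬ ∀ i ∈ S, ∀ j ∈ S, i + j ≠ k} := by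
  have hinj : Function.Injective (fun k : ℕ => 2 * a + (k : ℤ) * d) := by
    intro i j h
    simpa [hd] using h
  refine Eq.trans ?_ (card_image_of_injective _ hinj)
  congr 1
  ext x
  simp only [Finset.mem_add, mem_image, mem_filter, mem_range, not_forall, not_not]
  constructor
  · rintro ⟨_, ⟨i, hi, rfl⟩, _, ⟨j, hj, rfl⟩, rfl⟩
    have hi' := mem_range.1 (hS hi)
    have hj' := mem_range.1 (hS hj)
    exact ⟨i + j, ⟨by omega, i, hi, j, hj, rfl⟩, by push_cast; ring⟩
  · rintro ⟨_, ⟨-, i, hi, j, hj, rfl⟩, rfl⟩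
    exact ⟨_, ⟨i, hi, rfl⟩, _, ⟨j, hj, rfl⟩, by push_cast; ring⟩

lemma card_image_progression_sub {a d : ℤ} (hd : d ≠ 0) {n : ℕ} {S : Finset ℕ}
    (hS : S ⊆ range n) :
    #(S.image (fun i : ℕ => a + (i : ℤ) * d) - S.image (fun i : ℕ => a + (i : ℤ) * d)) =
      #{z ∈ Icc (-n : ℤ) n | ¬ ∀ i ∈ S, i + z.natAbs ∉ S} := by
  have hinj : Function.Injective (fun z : ℤ => z * d) := by
    intro i j h
    simpa [hd] using h
  refine Eq.trans ?_ (card_image_of_injective _ hinj)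
  congr 1
  ext x
  simp only [Finset.mem_sub, mem_image, mem_filter, mem_Icc, not_forall, not_not]
  constructor
  · rintro ⟨_, ⟨i, hi, rfl⟩, _, ⟨j, hj, rfl⟩, rfl⟩
    have hi' := mem_range.1 (hS hi)
    have hj' := mem_range.1 (hS hj)
    refine ⟨i - j, ⟨by omega, ?_⟩, by ring⟩
    rcases le_total i j with h | h
    · refine ⟨i, hi, ?_⟩
      rwa [show i + ((i : ℤ) - j).natAbs = j by omega]
    · refine ⟨j, hj, ?_⟩
      rwa [show j + ((i : ℤ) - j).natAbs = i by omega]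
  · rintro ⟨z, ⟨-, i, hi, hj⟩, rfl⟩
    rcases le_total 0 z with h | h
    · refine ⟨_, ⟨_, hj, rfl⟩, _, ⟨i, hi, rfl⟩, ?_⟩
      rw [show ((i + z.natAbs : ℕ) : ℤ) = i + z by omega]
      ring
    · refine ⟨_, ⟨i, hi, rfl⟩, _, ⟨_, hj, rfl⟩, ?_⟩
      rw [show ((i + z.natAbs : ℕ) : ℤ) = i - z by omega]
      ring

theorem average_values_asymptotic (a d : ℤ) (hd : d ≠ 0) :
    Tendsto (fun n : ℕ =>
        (∑ S ∈ (((Finset.range n).image (fun i : ℕ => a + (i : ℤ) * d))).powerset,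
            ((S - S).card : ℝ)) / 2 ^ n - (2 * n - 7)) atTop (nhds 0) ∧
    Tendsto (fun n : ℕ =>
        (∑ S ∈ (((Finset.range n).image (fun i : ℕ => a + (i : ℤ) * d))).powerset,
            ((S + S).card : ℝ)) / 2 ^ n - (2 * n - 11)) atTop (nhds 0) := by
  have hφ : Function.Injective (fun i : ℕ => a + (i : ℤ) * d) := by
    intro i j h
    simpa [hd] using h
  constructor
  · have h := ((tendsto_sum_diffMissing.const_mul (-2)).const_add 8).add
      (tendsto_pow_atTop_nhds_zero_of_lt_one (r := (1 / 2 : ℝ)) (by norm_num) (by norm_num))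
    norm_num only at h
    refine h.congr fun n => ?_
    rw [sum_powerset_image hφ, sum_congr rfl fun S hS => congrArg (Nat.cast (R := ℝ))
      (card_image_progression_sub (a := a) (n := n) hd (mem_powerset.1 hS)),
      sum_card_filter_not_div n (Icc (-n : ℤ) n) fun S z => ∀ i ∈ S, i + z.natAbs ∉ S]
    change _ = ∑ z ∈ Icc (-n : ℤ) n, (1 - diffMissing n z.natAbs) - _
    rw [sum_Icc_of_even_eq_range (by intro z; simp)]
    simp only [Int.natAbs_natCast, Int.natAbs_zero, diffMissing_zero, sum_sub_distrib, sum_const,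
      card_range, nsmul_eq_mul]
    push_cast
    ring
  · have h := (tendsto_sum_sumMissing.const_mul (-1)).const_add 11
    norm_num only at h
    refine h.congr fun n => ?_
    rw [sum_powerset_image hφ, sum_congr rfl fun S hS => congrArg (Nat.cast (R := ℝ))
      (card_image_progression_add (a := a) (n := n) hd (mem_powerset.1 hS)),
      sum_card_filter_not_div n (range (2 * n)) fun S k => ∀ i ∈ S, ∀ j ∈ S, i + j ≠ k]
    change _ = ∑ k ∈ range (2 * n), (1 - sumMissing n k) - _
    simp only [sum_sub_distrib, sum_const, card_range, nsmul_eq_mul]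
    push_cast
    ring
end

section
/- For every integer x, there exists a set S of integers with S ⊆ {0, 1, ..., 17·|x|} such that |S+S| − |S−S| = x. -/
open Finset Pointwise

/-- An interval together with one isolated point: its difference set is larger than its sumset. -/
theorem exists_card_add_sub_card_sub_eq_neg (n : ℤ) (hn : 0 ≤ n) :
    ∃ S : Finset ℤ, S ⊆ Icc 0 (2 * n + 1) ∧
      ((S + S).card : ℤ) - ((S - S).card : ℤ) = -n := by
  set S : Finset ℤ := insert (2 * n + 1) (Icc 0 n) with hS
  have mem_S (a : ℤ) : a ∈ S ↔ a = 2 * n + 1 ∨ 0 ≤ a ∧ a ≤ n := by simp [hS]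
  have add_eq : S + S = insert (4 * n + 2) (Icc 0 (3 * n + 1)) := by
    ext t
    simp only [mem_add, mem_S, mem_insert, mem_Icc]
    constructor
    · rintro ⟨a, ha, b, hb, rfl⟩
      omega
    · intro ht
      by_cases h₁ : t ≤ n
      · exact ⟨0, by omega, t, by omega, by omega⟩
      by_cases h₂ : t ≤ 2 * n
      · exact ⟨n, by omega, t - n, by omega, by omega⟩
      · exact ⟨2 * n + 1, by omega, t - (2 * n + 1), by omega, by omega⟩
  have sub_eq : S - S = Icc (-(2 * n + 1)) (2 * n + 1) := by
    ext t
    simp only [mem_sub, mem_S, mem_Icc]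
    constructor
    · rintro ⟨a, ha, b, hb, rfl⟩
      omega
    · intro ht
      by_cases h₁ : t < -n
      · exact ⟨t + (2 * n + 1), by omega, 2 * n + 1, by omega, by omega⟩
      by_cases h₂ : t < 0
      · exact ⟨0, by omega, -t, by omega, by omega⟩
      by_cases h₃ : t ≤ n
      · exact ⟨t, by omega, 0, by omega, by omega⟩
      · exact ⟨2 * n + 1, by omega, 2 * n + 1 - t, by omega, by omega⟩
  refine ⟨S, fun a ha ↦ ?_, ?_⟩
  · rw [mem_S] at ha
    rw [mem_Icc]
    omega
  · rw [add_eq, sub_eq, card_insert_of_notMem (by simp; omega)]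
    simp only [Int.card_Icc]
    omega

/-- Congruence to an element of `{0, 1, 2, 4, 5, 9}` modulo `12`. Every class modulo `12` is a
sum of two elements of this set, but the class of `6` is not a difference of two of them. -/
def IsSumDominantResidue (a : ℤ) : Prop :=
  a % 12 = 0 ∨ a % 12 = 1 ∨ a % 12 = 2 ∨ a % 12 = 4 ∨ a % 12 = 5 ∨ a % 12 = 9

instance : DecidablePred IsSumDominantResidue := fun a ↦ by
  unfold IsSumDominantResidue
  infer_instance

/-- The integers in `[0, D]` that are congruent to an element of `{0, 1, 2, 4, 5, 9}`
modulo `12`. -/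
noncomputable def sumDominantSet (D : ℤ) : Finset ℤ := (Icc 0 D).filter IsSumDominantResidue

theorem mem_sumDominantSet {D a : ℤ} :
    a ∈ sumDominantSet D ↔ (0 ≤ a ∧ a ≤ D) ∧
      (a % 12 = 0 ∨ a % 12 = 1 ∨ a % 12 = 2 ∨ a % 12 = 4 ∨ a % 12 = 5 ∨ a % 12 = 9) := by
  simp [sumDominantSet, IsSumDominantResidue]

theorem mem_add_sumDominantSet {D t : ℤ} (hD : D % 12 = 4 ∨ D % 12 = 5) (ht₀ : 0 ≤ t)
    (htD : t ≤ 2 * D) (hne : D % 12 = 4 → t ≠ 2 * D - 1) :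
    t ∈ sumDominantSet D + sumDominantSet D := by
  have of_residue (p : ℤ) (hp : p = 0 ∨ p = 1 ∨ p = 2 ∨ p = 4 ∨ p = 5 ∧ D % 12 = 5) (hpt : p ≤ t)
      (htp : t - p - 12 * (D / 12) ≤ D)
      (hres : (t - p) % 12 = 0 ∨ (t - p) % 12 = 1 ∨ (t - p) % 12 = 2 ∨ (t - p) % 12 = 4 ∨
        (t - p) % 12 = 5 ∨ (t - p) % 12 = 9) : t ∈ sumDominantSet D + sumDominantSet D := by
    rw [mem_add]
    by_cases h : t - p ≤ D
    · refine ⟨p, ?_, t - p, ?_, by ring⟩ <;> rw [mem_sumDominantSet] <;> omega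
    · refine ⟨p + 12 * (D / 12), ?_, t - (p + 12 * (D / 12)), ?_, by ring⟩ <;>
        rw [mem_sumDominantSet] <;> omega
  by_cases h₀ : t % 12 = 0
  · exact of_residue 0 (by omega) (by omega) (by omega) (by omega)
  by_cases h₁ : t % 12 ≤ 3
  · exact of_residue 1 (by omega) (by omega) (by omega) (by omega)
  by_cases h₂ : t % 12 = 7 ∨ t % 12 = 11
  · exact of_residue 2 (by omega) (by omega) (by omega) (by omega)
  by_cases h₄ : t % 12 ≤ 9
  · exact of_residue 4 (by omega) (by omega) (by omega) (by omega)
  rcases hD with hD | hD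
  · exact of_residue 1 (by omega) (by omega) (by omega) (by omega)
  · exact of_residue 5 (by omega) (by omega) (by omega) (by omega)

theorem mem_sub_sumDominantSet {D t : ℤ} (hD : D % 12 = 4 ∨ D % 12 = 5) (ht₀ : 0 ≤ t)
    (htD : t ≤ D) (hne : t % 12 ≠ 6) : t ∈ sumDominantSet D - sumDominantSet D := by
  have of_residue (p : ℤ) (h : t + p ∈ sumDominantSet D) (hp : p ∈ sumDominantSet D) :
      t ∈ sumDominantSet D - sumDominantSet D :=
    mem_sub.2 ⟨t + p, h, p, hp, by ring⟩
  simp only [mem_sumDominantSet] at of_residue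
  by_cases h₁ : t % 12 = 3 ∨ t % 12 = 8 ∨ t % 12 = 11
  · exact of_residue 1 (by omega) (by omega)
  by_cases h₂ : t % 12 = 7 ∨ t % 12 = 10
  · exact of_residue 2 (by omega) (by omega)
  · exact of_residue 0 (by omega) (by omega)

theorem sub_sumDominantSet {D : ℤ} (hD : D % 12 = 4 ∨ D % 12 = 5) :
    sumDominantSet D - sumDominantSet D =
      Icc (-D) D \ (Ico (-(D / 12)) (D / 12)).image (fun j ↦ 12 * j + 6) := by
  ext t
  simp only [mem_sdiff, mem_image, mem_Icc, mem_Ico, not_exists, not_and]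
  constructor
  · intro h
    obtain ⟨a, ha, b, hb, rfl⟩ := mem_sub.1 h
    rw [mem_sumDominantSet] at ha hb
    refine ⟨by omega, fun j _ ↦ by omega⟩
  · rintro ⟨⟨h₁, h₂⟩, h⟩
    have hne : t % 12 ≠ 6 := fun h₆ ↦ h (t / 12) (by omega) (by omega)
    rcases le_total 0 t with ht | ht
    · exact mem_sub_sumDominantSet hD ht h₂ hne
    · obtain ⟨a, ha, b, hb, hab⟩ :=
        mem_sub.1 (mem_sub_sumDominantSet (t := -t) hD (by omega) (by omega) (by omega))
      exact mem_sub.2 ⟨b, hb, a, ha, by omega⟩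

theorem card_sub_sumDominantSet {D : ℤ} (hD₀ : 0 ≤ D) (hD : D % 12 = 4 ∨ D % 12 = 5) :
    ((sumDominantSet D - sumDominantSet D).card : ℤ) = 2 * D + 1 - 2 * (D / 12) := by
  have hsub : (Ico (-(D / 12)) (D / 12)).image (fun j ↦ 12 * j + 6) ⊆ Icc (-D) D := by
    intro t ht
    obtain ⟨j, hj, rfl⟩ := mem_image.1 ht
    rw [mem_Ico] at hj
    rw [mem_Icc]
    omega
  rw [sub_sumDominantSet hD, cast_card_sdiff hsub,
    card_image_of_injective _ fun a b h ↦ by simpa using h]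
  simp only [Int.card_Icc, Int.card_Ico]
  omega

theorem card_add_sumDominantSet_of_mod_eq_five {D : ℤ} (hD₀ : 0 ≤ D) (hD : D % 12 = 5) :
    ((sumDominantSet D + sumDominantSet D).card : ℤ) = 2 * D + 1 := by
  have h : sumDominantSet D + sumDominantSet D = Icc 0 (2 * D) := by
    ext t
    rw [mem_Icc]
    constructor
    · intro h
      obtain ⟨a, ha, b, hb, rfl⟩ := mem_add.1 h
      rw [mem_sumDominantSet] at ha hb
      omega
    · exact fun h ↦ mem_add_sumDominantSet (Or.inr hD) h.1 h.2 (by omega)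
  rw [h, Int.card_Icc]
  omega

theorem card_add_sumDominantSet_of_mod_eq_four {D : ℤ} (hD₀ : 0 ≤ D) (hD : D % 12 = 4) :
    ((sumDominantSet D + sumDominantSet D).card : ℤ) = 2 * D := by
  have h : sumDominantSet D + sumDominantSet D = (Icc 0 (2 * D)).erase (2 * D - 1) := by
    ext t
    rw [mem_erase, mem_Icc]
    constructor
    · intro h
      obtain ⟨a, ha, b, hb, rfl⟩ := mem_add.1 h
      rw [mem_sumDominantSet] at ha hb
      omega
    · exact fun h ↦ mem_add_sumDominantSet (Or.inl hD) h.2.1 h.2.2 fun _ ↦ h.1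
  rw [h, card_erase_of_mem (by rw [mem_Icc]; omega), Int.card_Icc]
  omega

theorem prescribed_imbalance (x : ℤ) :
    ∃ S : Finset ℤ, S ⊆ Finset.Icc 0 (17 * |x|) ∧
      ((S + S).card : ℤ) - ((S - S).card : ℤ) = x := by
  rcases lt_trichotomy x 0 with hx | rfl | hx
  · obtain ⟨S, hS, hcard⟩ := exists_card_add_sub_card_sub_eq_neg (-x) (by omega)
    rw [abs_of_neg hx]
    exact ⟨S, hS.trans (Icc_subset_Icc_right (by omega)), by omega⟩
  · exact ⟨∅, by simp, by simp⟩
  · have hsub (D : ℤ) (hD : D ≤ 17 * x) : sumDominantSet D ⊆ Icc 0 (17 * |x|) := by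
      rw [abs_of_pos hx]
      exact (filter_subset _ _).trans (Icc_subset_Icc_right hD)
    rcases Int.even_or_odd' x with ⟨m, rfl | rfl⟩
    · refine ⟨sumDominantSet (12 * m + 5), hsub _ (by omega), ?_⟩
      rw [card_add_sumDominantSet_of_mod_eq_five (by omega) (by omega),
        card_sub_sumDominantSet (by omega) (by omega)]
      omega
    · refine ⟨sumDominantSet (12 * (m + 1) + 4), hsub _ (by omega), ?_⟩
      rw [card_add_sumDominantSet_of_mod_eq_four (by omega) (by omega),
        card_sub_sumDominantSet (by omega) (by omega)]
      omega
end

section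
/- Let n, ℓ, u be nonnegative integers with n ≥ ℓ+u, fix L ⊆ {0,...,ℓ−1} and U ⊆ {n−u,...,n−1}, and let k be an integer with 2ℓ−1 ≤ k ≤ n−u−1. Then the number of subsets R ⊆ {ℓ,...,n−u−1} such that k is not in (L∪R∪U)+(L∪R∪U), divided by 2^{n−ℓ−u}, equals (1/2)^{|L|}·(3/4)^{(k+1)/2−ℓ} if k is odd, and equals (1/2)^{|L|+1}·(3/4)^{k/2−ℓ} if k is even. -/
open Finset Pointwise

/-- The number of subsets of `S` having no two (possibly equal) elements with sum `k`. -/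
def countAvoiding (k : ℤ) (S : Finset ℤ) : ℕ :=
  (S.powerset.filter (fun R : Finset ℤ => ∀ x ∈ R, k - x ∉ R)).card

theorem countAvoiding_union {k : ℤ} {S T : Finset ℤ} (hST : ∀ x ∈ S, x ∉ T)
    (hk : ∀ x ∈ S, k - x ∉ T) :
    countAvoiding k (S ∪ T) = countAvoiding k S * countAvoiding k T := by
  unfold countAvoiding
  rw [← Finset.card_product]
  refine Finset.card_nbij' (fun R => (R ∩ S, R ∩ T)) (fun p => p.1 ∪ p.2) ?_ ?_ ?_ ?_
  · intro R hR
    simp only [Finset.coe_filter, Finset.mem_powerset, Set.mem_ofPred_eq] at hR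
    simp only [Finset.coe_product, Finset.coe_filter, Finset.mem_powerset, Set.mem_prod,
      Set.mem_ofPred_eq, Finset.mem_inter]
    exact ⟨⟨Finset.inter_subset_right, fun x hx h => hR.2 x hx.1 h.1⟩,
      ⟨Finset.inter_subset_right, fun x hx h => hR.2 x hx.1 h.1⟩⟩
  · rintro ⟨A, B⟩ hAB
    simp only [Finset.coe_product, Finset.coe_filter, Finset.mem_powerset, Set.mem_prod,
      Set.mem_ofPred_eq] at hAB
    obtain ⟨⟨hA, hA'⟩, hB, hB'⟩ := hAB
    simp only [Finset.coe_filter, Finset.mem_powerset, Set.mem_ofPred_eq, Finset.mem_union]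
    refine ⟨Finset.union_subset_union hA hB, ?_⟩
    rintro x (hx | hx) (h | h)
    · exact hA' x hx h
    · exact hk x (hA hx) (hB h)
    · have := hk _ (hA h)
      rw [sub_sub_cancel] at this
      exact this (hB hx)
    · exact hB' x hx h
  · intro R hR
    simp only [Finset.coe_filter, Finset.mem_powerset, Set.mem_ofPred_eq] at hR
    change R ∩ S ∪ R ∩ T = R
    rw [← Finset.inter_union_distrib_left]
    exact Finset.inter_eq_left.2 hR.1
  · rintro ⟨A, B⟩ hAB
    simp only [Finset.coe_product, Finset.coe_filter, Finset.mem_powerset, Set.mem_prod,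
      Set.mem_ofPred_eq] at hAB
    obtain ⟨⟨hA, -⟩, hB, -⟩ := hAB
    refine Prod.ext ?_ ?_ <;> ext x <;>
      simp only [Finset.mem_inter, Finset.mem_union] <;>
      have := @hA x <;> have := @hB x <;> have := hST x <;> tauto

theorem countAvoiding_of_free {k : ℤ} {S : Finset ℤ} (h : ∀ x ∈ S, k - x ∉ S) :
    countAvoiding k S = 2 ^ S.card := by
  unfold countAvoiding
  rw [Finset.filter_true_of_mem, Finset.card_powerset]
  intro R hR x hx hx'
  rw [Finset.mem_powerset] at hR
  exact h x (hR hx) (hR hx')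

theorem countAvoiding_singleton {k x : ℤ} (h : k - x = x) : countAvoiding k {x} = 1 := by
  unfold countAvoiding
  rw [Finset.card_eq_one]
  refine ⟨∅, ?_⟩
  ext R
  simp only [Finset.mem_filter, Finset.mem_powerset, Finset.subset_singleton_iff,
    Finset.mem_singleton]
  constructor
  · rintro ⟨rfl | rfl, h'⟩
    · rfl
    · simp [h] at h'
  · rintro rfl
    simp

theorem countAvoiding_pair {k x : ℤ} (h : k - x ≠ x) : countAvoiding k {x, k - x} = 3 := by
  unfold countAvoiding
  have key : (({x, k - x} : Finset ℤ).powerset.filter (fun R : Finset ℤ => ∀ y ∈ R, k - y ∉ R))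
      = {∅, {x}, {k - x}} := by
    ext R
    simp only [Finset.mem_filter, Finset.mem_powerset, Finset.mem_insert, Finset.mem_singleton,
      Finset.subset_insert_iff, Finset.subset_singleton_iff]
    constructor
    · rintro ⟨hR, hR'⟩
      by_cases hx : x ∈ R
      · rcases hR with hR | hR
        · right; left
          rw [← Finset.insert_erase hx, hR]
          rfl
        · exact absurd (Finset.mem_of_mem_erase (hR ▸ Finset.mem_singleton_self _)) (hR' x hx)
      · rw [Finset.erase_eq_of_notMem hx] at hR
        tauto
    · rintro (rfl | rfl | rfl)
      · simp
      · simp [h]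
      · simp [h, h.symm]
  rw [key, Finset.card_eq_three]
  exact ⟨∅, {x}, {k - x}, (Finset.singleton_ne_empty _).symm, (Finset.singleton_ne_empty _).symm,
    fun e => h (Finset.singleton_injective e).symm, rfl⟩

theorem countAvoiding_Icc_pred {k a : ℤ} (ha : 2 * a ≤ k + 1) :
    countAvoiding k (Finset.Icc (a - 1) (k - (a - 1)))
      = countAvoiding k (Finset.Icc a (k - a)) * 3 := by
  rw [← countAvoiding_pair (k := k) (x := a - 1) (by omega), ← countAvoiding_union]
  · congr 1
    ext x
    simp only [Finset.mem_Icc, Finset.mem_union, Finset.mem_insert, Finset.mem_singleton]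
    omega
  all_goals
    intro x
    simp only [Finset.mem_Icc, Finset.mem_insert, Finset.mem_singleton]
    omega

theorem countAvoiding_Icc_odd (c : ℤ) (j : ℕ) :
    countAvoiding (2 * c - 1) (Finset.Icc (c - j) (2 * c - 1 - (c - j))) = 3 ^ j := by
  induction j with
  | zero =>
    rw [Finset.Icc_eq_empty (by push_cast; omega), countAvoiding_of_free (by simp)]
    simp
  | succ j ih =>
    rw [pow_succ, ← ih, ← countAvoiding_Icc_pred (by omega)]
    push_cast
    simp only [sub_sub]

theorem countAvoiding_Icc_even (c : ℤ) (j : ℕ) :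
    countAvoiding (2 * c) (Finset.Icc (c - j) (2 * c - (c - j))) = 3 ^ j := by
  induction j with
  | zero =>
    have : Finset.Icc (c - (0 : ℕ)) (2 * c - (c - (0 : ℕ))) = {c} := by
      ext x
      simp only [Finset.mem_Icc, Finset.mem_singleton]
      omega
    rw [this, countAvoiding_singleton (by ring), pow_zero]
  | succ j ih =>
    rw [pow_succ, ← ih, ← countAvoiding_Icc_pred (by omega)]
    push_cast
    simp only [sub_sub]

theorem filter_notMem_add_eq {n ℓ u : ℕ} {L U : Finset ℤ}
    (hL : L ⊆ Finset.Icc (0 : ℤ) ((ℓ : ℤ) - 1))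
    (hU : U ⊆ Finset.Icc ((n : ℤ) - u) ((n : ℤ) - 1))
    {k : ℤ} (hk1 : 2 * (ℓ : ℤ) - 1 ≤ k) (hk2 : k ≤ (n : ℤ) - u - 1) :
    (Finset.Icc (ℓ : ℤ) ((n : ℤ) - u - 1)).powerset.filter
        (fun R : Finset ℤ => k ∉ (L ∪ R ∪ U) + (L ∪ R ∪ U))
      = (Finset.Icc (ℓ : ℤ) (k - ℓ) ∪
          (Finset.Icc (k - ℓ + 1) ((n : ℤ) - u - 1) \ L.image (fun a => k - a))).powerset.filter
        (fun R : Finset ℤ => ∀ x ∈ R, k - x ∉ R) := by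
  have hL' : ∀ x ∈ L, 0 ≤ x ∧ x ≤ (ℓ : ℤ) - 1 := fun x hx => Finset.mem_Icc.1 (hL hx)
  have hU' : ∀ x ∈ U, (n : ℤ) - u ≤ x := fun x hx => (Finset.mem_Icc.1 (hU hx)).1
  ext R
  simp only [Finset.mem_filter, Finset.mem_powerset]
  constructor
  · rintro ⟨hR, hk⟩
    refine ⟨fun x hx => ?_, fun x hx hx' => hk (Finset.mem_add.2 ⟨x, ?_, k - x, ?_, by ring⟩)⟩
    · have hx1 := Finset.mem_Icc.1 (hR hx)
      simp only [Finset.mem_union, Finset.mem_Icc, Finset.mem_sdiff, Finset.mem_image]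
      by_cases hxk : x ≤ k - ℓ
      · exact Or.inl ⟨hx1.1, hxk⟩
      · refine Or.inr ⟨⟨by omega, hx1.2⟩, ?_⟩
        rintro ⟨a, ha, rfl⟩
        exact hk (Finset.mem_add.2 ⟨a, by simp [ha], k - a, by simp [hx], by ring⟩)
    · simp [hx]
    · simp [hx']
  · rintro ⟨hR, hk⟩
    have hR' : ∀ x ∈ R, (ℓ : ℤ) ≤ x ∧ x ≤ (n : ℤ) - u - 1 ∧ k - x ∉ L := by
      intro x hx
      have hx1 := hR hx
      simp only [Finset.mem_union, Finset.mem_Icc, Finset.mem_sdiff, Finset.mem_image] at hx1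
      rcases hx1 with hx1 | ⟨hx1, hx2⟩
      · refine ⟨hx1.1, by omega, fun h => ?_⟩
        have := hL' _ h
        omega
      · exact ⟨by omega, hx1.2, fun h => hx2 ⟨_, h, by ring⟩⟩
    refine ⟨fun x hx => Finset.mem_Icc.2 ⟨(hR' x hx).1, (hR' x hx).2.1⟩, fun h => ?_⟩
    have hnonneg : ∀ x ∈ L ∪ R ∪ U, 0 ≤ x := by
      intro x hx
      simp only [Finset.mem_union] at hx
      rcases hx with (hx | hx) | hx
      · exact (hL' x hx).1
      · have := (hR' x hx).1
        omega
      · have := hU' x hx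
        omega
    obtain ⟨x, hx, y, hy, hxy⟩ := Finset.mem_add.1 h
    have hx0 := hnonneg x hx
    have hy0 := hnonneg y hy
    obtain rfl : y = k - x := by omega
    simp only [Finset.mem_union] at hx hy
    rcases hx with (hx | hx) | hx
    · rcases hy with (hy | hy) | hy
      · have := hL' _ hx
        have := hL' _ hy
        omega
      · exact (hR' _ hy).2.2 (by simpa using hx)
      · have := hU' _ hy
        omega
    · rcases hy with (hy | hy) | hy
      · exact (hR' _ hx).2.2 hy
      · exact hk x hx hy
      · have := hU' _ hy
        omega
    · have := hU' _ hx
      omega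

theorem prob_small_sum_missing (n ℓ u : ℕ) (h : ℓ + u ≤ n) (L U : Finset ℤ)
    (hL : L ⊆ Finset.Icc (0 : ℤ) ((ℓ : ℤ) - 1))
    (hU : U ⊆ Finset.Icc ((n : ℤ) - u) ((n : ℤ) - 1))
    (k : ℤ) (hk1 : 2 * (ℓ : ℤ) - 1 ≤ k) (hk2 : k ≤ (n : ℤ) - u - 1) :
    (((Finset.Icc ((ℓ : ℤ)) ((n : ℤ) - u - 1)).powerset.filter
        (fun R : Finset ℤ => k ∉ (L ∪ R ∪ U) + (L ∪ R ∪ U))).card : ℝ) / 2 ^ (n - ℓ - u)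
      = if Odd k then (1 / 2 : ℝ) ^ L.card * (3 / 4 : ℝ) ^ ((k + 1) / 2 - (ℓ : ℤ))
        else (1 / 2 : ℝ) ^ (L.card + 1) * (3 / 4 : ℝ) ^ (k / 2 - (ℓ : ℤ)) := by
  have hL' : ∀ x ∈ L, 0 ≤ x ∧ x ≤ (ℓ : ℤ) - 1 := fun x hx => Finset.mem_Icc.1 (hL hx)
  rw [filter_notMem_add_eq hL hU hk1 hk2]
  set T := Finset.Icc (k - ℓ + 1) ((n : ℤ) - u - 1) \ L.image (fun a => k - a) with hT
  have hTmem : ∀ x ∈ T, k - ℓ + 1 ≤ x := fun x hx =>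
    (Finset.mem_Icc.1 (Finset.mem_sdiff.1 hx).1).1
  have hcard : (T.card : ℤ) + L.card = (n : ℤ) - u - 1 - (k - ℓ) := by
    have hsub : L.image (fun a => k - a) ⊆ Finset.Icc (k - ℓ + 1) ((n : ℤ) - u - 1) := by
      intro x hx
      obtain ⟨a, ha, rfl⟩ := Finset.mem_image.1 hx
      have := hL' a ha
      exact Finset.mem_Icc.2 (by omega)
    have h1 := Finset.card_sdiff_add_card_eq_card hsub
    rw [Finset.card_image_of_injective _ sub_right_injective, Int.card_Icc, ← hT] at h1
    omega
  have hcount : countAvoiding k (Finset.Icc (ℓ : ℤ) (k - ℓ) ∪ T)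
      = countAvoiding k (Finset.Icc (ℓ : ℤ) (k - ℓ)) * 2 ^ T.card := by
    rw [countAvoiding_union, countAvoiding_of_free (S := T)]
    · intro x hx hx'
      have := hTmem x hx
      have := hTmem _ hx'
      omega
    · intro x hx hx'
      have := Finset.mem_Icc.1 hx
      have := hTmem x hx'
      omega
    · intro x hx hx'
      have := Finset.mem_Icc.1 hx
      have := hTmem _ hx'
      omega
  change ((countAvoiding k (Finset.Icc (ℓ : ℤ) (k - ℓ) ∪ T) : ℕ) : ℝ) / _ = _
  rw [hcount]
  split_ifs with hodd
  · obtain ⟨c, rfl⟩ : ∃ c, k = 2 * c - 1 := by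
      obtain ⟨d, rfl⟩ := hodd
      exact ⟨d + 1, by ring⟩
    obtain ⟨j, hj⟩ := Int.le.dest (show (ℓ : ℤ) ≤ c by omega)
    have hN := countAvoiding_Icc_odd c j
    rw [show c - (j : ℤ) = ℓ by omega] at hN
    rw [hN, show (2 * c - 1 + 1) / 2 - (ℓ : ℤ) = (j : ℕ) by omega, zpow_natCast,
      show n - ℓ - u = 2 * j + T.card + L.card by omega, pow_add, pow_add, pow_mul, div_pow, div_pow]
    push_cast
    norm_num
    field_simp
  · obtain ⟨c, rfl⟩ : ∃ c, k = 2 * c := (Int.not_odd_iff_even.1 hodd).two_dvd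
    obtain ⟨j, hj⟩ := Int.le.dest (show (ℓ : ℤ) ≤ c by omega)
    have hN := countAvoiding_Icc_even c j
    rw [show c - (j : ℤ) = ℓ by omega] at hN
    rw [hN, show 2 * c / 2 - (ℓ : ℤ) = (j : ℕ) by omega, zpow_natCast,
      show n - ℓ - u = 2 * j + T.card + (L.card + 1) by omega, pow_add, pow_add, pow_mul, div_pow,
      div_pow]
    push_cast
    norm_num
    field_simp
end

section
/- Let n, ℓ, u be nonnegative integers with n ≥ ℓ+u, fix L ⊆ {0,...,ℓ−1} and U ⊆ {n−u,...,n−1}, and let k be an integer with n+ℓ−1 ≤ k ≤ 2n−2u−1. Then the number of subsets R ⊆ {ℓ,...,n−u−1} such that k is not in (L∪R∪U)+(L∪R∪U), divided by 2^{n−ℓ−u}, equals (1/2)^{|U|}·(3/4)^{n−(k+1)/2−u} if k is odd, and equals (1/2)^{|U|+1}·(3/4)^{n−1−k/2−u} if k is even. -/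
open Finset Pointwise

/-- The subsets of `S` in which no two (possibly equal) elements sum to `k`. -/
def sumAvoiding (k : ℤ) (S : Finset ℤ) : Finset (Finset ℤ) :=
  S.powerset.filter fun R => ∀ x ∈ R, ∀ y ∈ R, x + y ≠ k

lemma mem_sumAvoiding {k : ℤ} {S R : Finset ℤ} :
    R ∈ sumAvoiding k S ↔ R ⊆ S ∧ ∀ x ∈ R, ∀ y ∈ R, x + y ≠ k := by
  simp [sumAvoiding]

lemma card_sumAvoiding_union {k : ℤ} {A B : Finset ℤ} (hd : Disjoint A B)
    (hAB : ∀ a ∈ A, ∀ b ∈ B, a + b ≠ k) :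
    (sumAvoiding k (A ∪ B)).card = (sumAvoiding k A).card * (sumAvoiding k B).card := by
  rw [← card_product]
  refine card_nbij' (fun R => (R ∩ A, R ∩ B)) (fun p => p.1 ∪ p.2) ?_ ?_ ?_ ?_
  · intro R hR
    simp only [mem_coe, mem_product, mem_sumAvoiding] at hR ⊢
    exact ⟨⟨inter_subset_right, fun x hx y hy =>
        hR.2 x (mem_inter.1 hx).1 y (mem_inter.1 hy).1⟩, inter_subset_right, fun x hx y hy =>
        hR.2 x (mem_inter.1 hx).1 y (mem_inter.1 hy).1⟩
  · rintro ⟨P, Q⟩ hPQ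
    simp only [mem_coe, mem_product, mem_sumAvoiding] at hPQ ⊢
    obtain ⟨⟨hP, hP'⟩, hQ, hQ'⟩ := hPQ
    refine ⟨union_subset_union hP hQ, fun x hx y hy => ?_⟩
    rcases mem_union.1 hx with hx | hx <;> rcases mem_union.1 hy with hy | hy
    · exact hP' x hx y hy
    · exact hAB x (hP hx) y (hQ hy)
    · rw [add_comm]
      exact hAB y (hP hy) x (hQ hx)
    · exact hQ' x hx y hy
  · intro R hR
    simp only [mem_coe, mem_sumAvoiding] at hR
    simp only [← inter_union_distrib_left]
    exact inter_eq_left.2 hR.1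
  · rintro ⟨P, Q⟩ hPQ
    simp only [mem_coe, mem_product, mem_sumAvoiding] at hPQ
    obtain ⟨⟨hP, -⟩, hQ, -⟩ := hPQ
    rw [disjoint_left] at hd
    ext x
    · simp only [mem_inter, mem_union]
      exact ⟨fun hx => hx.1.resolve_right fun hq => hd hx.2 (hQ hq), fun hx => ⟨.inl hx, hP hx⟩⟩
    · simp only [mem_inter, mem_union]
      exact ⟨fun hx => hx.1.resolve_left fun hp => hd (hP hp) hx.2, fun hx => ⟨.inr hx, hQ hx⟩⟩

lemma card_sumAvoiding_of_forall_ne {k : ℤ} {B : Finset ℤ}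
    (hB : ∀ x ∈ B, ∀ y ∈ B, x + y ≠ k) : (sumAvoiding k B).card = 2 ^ B.card := by
  rw [← card_powerset, sumAvoiding, filter_true_of_mem]
  exact fun R hR x hx y hy => hB x (mem_powerset.1 hR hx) y (mem_powerset.1 hR hy)

lemma card_sumAvoiding_singleton {k j : ℤ} (hj : j + j = k) :
    (sumAvoiding k {j}).card = 1 := by
  have : sumAvoiding k {j} = {∅} := by
    ext R
    simp only [mem_sumAvoiding, subset_singleton_iff, mem_singleton]
    constructor
    · rintro ⟨rfl | rfl, h⟩
      · rfl
      · exact absurd hj (h j (mem_singleton_self j) j (mem_singleton_self j))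
    · rintro rfl
      simp
  rw [this, card_singleton]

lemma card_sumAvoiding_pair {k a b : ℤ} (hab : a + b = k) (hne : a ≠ b) :
    (sumAvoiding k {a, b}).card = 3 := by
  have : sumAvoiding k {a, b} = {∅, {a}, {b}} := by
    ext R
    simp only [mem_sumAvoiding, ← coe_subset, coe_pair, Set.subset_pair_iff_eq, coe_eq_empty,
      coe_eq_singleton, coe_eq_pair, mem_singleton, mem_insert]
    constructor
    · rintro ⟨rfl | rfl | rfl | rfl, h⟩
      · simp
      · simp
      · simp
      · exact absurd hab (h a (by simp) b (by simp))
    · rintro (rfl | rfl | rfl)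
      · simp
      · simp only [mem_singleton, forall_eq]
        exact ⟨by simp, by omega⟩
      · simp only [mem_singleton, forall_eq]
        exact ⟨by simp, by omega⟩
  rw [this, card_eq_three]
  refine ⟨∅, {a}, {b}, ?_, ?_, ?_, rfl⟩
  · exact (singleton_ne_empty a).symm
  · exact (singleton_ne_empty b).symm
  · simpa using hne

lemma card_sumAvoiding_Icc {k c d : ℤ} (hcd : c + d = k) (hle : c ≤ d + 1) (m : ℕ) :
    (sumAvoiding k (Icc (c - m) (d + m))).card = 3 ^ m * (sumAvoiding k (Icc c d)).card := by
  induction m with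
  | zero => simp
  | succ m ih =>
    have hS : Icc (c - (m + 1 : ℕ)) (d + (m + 1 : ℕ))
        = {c - (m + 1 : ℕ), d + (m + 1 : ℕ)} ∪ Icc (c - m) (d + m) := by
      ext x
      simp only [mem_union, mem_Icc, mem_insert, mem_singleton]
      omega
    rw [hS, card_sumAvoiding_union, card_sumAvoiding_pair (by omega) (by omega), ih]
    · ring
    · rw [disjoint_left]
      intro x
      simp only [mem_Icc, mem_insert, mem_singleton]
      omega
    · intro x hx y hy
      simp only [mem_Icc, mem_insert, mem_singleton] at hx hy
      omega

lemma filter_notMem_add_eq_sumAvoiding {n ℓ u : ℕ} {L U : Finset ℤ}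
    (hL : L ⊆ Icc (0 : ℤ) ((ℓ : ℤ) - 1))
    (hU : U ⊆ Icc ((n : ℤ) - u) ((n : ℤ) - 1))
    {k : ℤ} (h : ℓ + u ≤ n) (hk1 : (n : ℤ) + ℓ - 1 ≤ k) (hk2 : k ≤ 2 * (n : ℤ) - 2 * u - 1) :
    ((Icc (ℓ : ℤ) ((n : ℤ) - u - 1)).powerset.filter
        fun R : Finset ℤ => k ∉ (L ∪ R ∪ U) + (L ∪ R ∪ U))
      = sumAvoiding k (Icc (ℓ : ℤ) ((n : ℤ) - u - 1) \ U.image (k - ·)) := by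
  ext R
  simp only [mem_filter, mem_powerset, mem_sumAvoiding, mem_add, not_exists, not_and]
  constructor
  · rintro ⟨hR, hk⟩
    refine ⟨fun x hx => mem_sdiff.2 ⟨hR hx, fun hxU => ?_⟩, fun x hx y hy => ?_⟩
    · obtain ⟨y, hy, rfl⟩ := mem_image.1 hxU
      exact hk (k - y) (by simp [hx]) y (by simp [hy]) (by ring)
    · exact hk x (by simp [hx]) y (by simp [hy])
  · rintro ⟨hR, hk⟩
    have hR' : ∀ x ∈ R, (ℓ : ℤ) ≤ x ∧ x ≤ n - u - 1 ∧ ∀ y ∈ U, k - y ≠ x := by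
      intro x hx
      simpa [and_assoc] using hR hx
    have hL' : ∀ x ∈ L, 0 ≤ x ∧ x ≤ (ℓ : ℤ) - 1 := fun x hx => mem_Icc.1 (hL hx)
    have hU' : ∀ x ∈ U, (n : ℤ) - u ≤ x ∧ x ≤ n - 1 := fun x hx => mem_Icc.1 (hU hx)
    refine ⟨fun x hx => (mem_sdiff.1 (hR hx)).1, fun x hx y hy => ?_⟩
    simp only [mem_union, or_assoc] at hx hy
    rcases hx with hx | hx | hx <;> rcases hy with hy | hy | hy
    · have := hL' x hx; have := hL' y hy; omega
    · have := hL' x hx; have := hR' y hy; omega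
    · have := hL' x hx; have := hU' y hy; omega
    · have := hR' x hx; have := hL' y hy; omega
    · exact hk x hx y hy
    · have := (hR' x hx).2.2 y hy; omega
    · have := hU' x hx; have := hL' y hy; omega
    · have := (hR' y hy).2.2 x hx; omega
    · have := hU' x hx; have := hU' y hy; omega

lemma card_sumAvoiding_Icc_sdiff_image {n ℓ u : ℕ} {U : Finset ℤ}
    (hU : U ⊆ Icc ((n : ℤ) - u) ((n : ℤ) - 1))
    {k : ℤ} (hk1 : (n : ℤ) + ℓ - 1 ≤ k) (hk2 : k ≤ 2 * (n : ℤ) - 2 * u - 1) :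
    ∃ b : ℕ, (b : ℤ) + U.card = k - n + u - ℓ + 1 ∧
      (sumAvoiding k (Icc (ℓ : ℤ) ((n : ℤ) - u - 1) \ U.image (k - ·))).card
        = (sumAvoiding k (Icc (k - n + 1 + u) ((n : ℤ) - u - 1))).card * 2 ^ b := by
  have hF : U.image (k - ·) ⊆ Icc (k - n + 1) (k - n + u) := by
    intro x hx
    obtain ⟨y, hy, rfl⟩ := mem_image.1 hx
    have := mem_Icc.1 (hU hy)
    rw [mem_Icc]
    omega
  have hFI : U.image (k - ·) ⊆ Icc (ℓ : ℤ) (k - n + u) :=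
    hF.trans (Icc_subset_Icc_left (by omega))
  have hcard : (U.image (k - ·)).card = U.card :=
    card_image_of_injective _ sub_right_injective
  refine ⟨(Icc (ℓ : ℤ) (k - n + u) \ U.image (k - ·)).card, ?_, ?_⟩
  · have := card_sdiff_add_card_eq_card hFI
    rw [hcard, Int.card_Icc] at this
    omega
  · have hS : Icc (ℓ : ℤ) ((n : ℤ) - u - 1) \ U.image (k - ·)
        = Icc (k - n + 1 + u) ((n : ℤ) - u - 1)
          ∪ (Icc (ℓ : ℤ) (k - n + u) \ U.image (k - ·)) := by
      ext x
      have : x ∈ U.image (k - ·) → _ := fun hx => mem_Icc.1 (hF hx)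
      simp only [mem_union, mem_sdiff, mem_Icc]
      by_cases hx : x ∈ U.image (k - ·)
      · have := this hx
        simp only [hx, not_true_eq_false, and_false, or_false, false_iff]
        omega
      · simp only [hx, not_false_eq_true, and_true]
        omega
    rw [hS, card_sumAvoiding_union,
      card_sumAvoiding_of_forall_ne (B := Icc (ℓ : ℤ) (k - n + u) \ U.image (k - ·))]
    · intro x hx y hy
      simp only [mem_sdiff, mem_Icc] at hx hy
      omega
    · rw [disjoint_left]
      intro x
      simp only [mem_sdiff, mem_Icc]
      omega
    · intro x hx y hy
      simp only [mem_sdiff, mem_Icc] at hx hy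
      omega

lemma three_pow_mul_two_pow_div {a b m N : ℕ} (hN : N = a + 2 * m + b) :
    ((3 : ℝ) ^ m * 2 ^ b) / 2 ^ N = (1 / 2) ^ a * (3 / 4) ^ m := by
  have h4 : (4 : ℝ) ^ m = 2 ^ (2 * m) := by rw [pow_mul]; norm_num
  rw [hN, div_pow, div_pow, h4, one_pow, pow_add, pow_add]
  field_simp

theorem prob_large_sum_missing (n ℓ u : ℕ) (h : ℓ + u ≤ n) (L U : Finset ℤ)
    (hL : L ⊆ Finset.Icc (0 : ℤ) ((ℓ : ℤ) - 1))
    (hU : U ⊆ Finset.Icc ((n : ℤ) - u) ((n : ℤ) - 1))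
    (k : ℤ) (hk1 : (n : ℤ) + ℓ - 1 ≤ k) (hk2 : k ≤ 2 * (n : ℤ) - 2 * u - 1) :
    (((Finset.Icc ((ℓ : ℤ)) ((n : ℤ) - u - 1)).powerset.filter
        (fun R : Finset ℤ => k ∉ (L ∪ R ∪ U) + (L ∪ R ∪ U))).card : ℝ) / 2 ^ (n - ℓ - u)
      = if Odd k then (1 / 2 : ℝ) ^ U.card * (3 / 4 : ℝ) ^ ((n : ℤ) - (k + 1) / 2 - u)
        else (1 / 2 : ℝ) ^ (U.card + 1) * (3 / 4 : ℝ) ^ ((n : ℤ) - 1 - k / 2 - u) := by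
  obtain ⟨b, hb, hcard⟩ := card_sumAvoiding_Icc_sdiff_image hU hk1 hk2
  rw [filter_notMem_add_eq_sumAvoiding hL hU h hk1 hk2, hcard]
  split_ifs with hodd
  · obtain ⟨j, rfl⟩ := hodd
    obtain ⟨m, hm⟩ : ∃ m : ℕ, (m : ℤ) = n - u - 1 - j := ⟨_, Int.toNat_of_nonneg (by omega)⟩
    have hI : Icc (2 * j + 1 - n + 1 + u) ((n : ℤ) - u - 1) = Icc (j + 1 - m) (j + m) := by
      congr 1 <;> omega
    have hexp : (n : ℤ) - (2 * j + 1 + 1) / 2 - u = m := by omega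
    rw [hI, card_sumAvoiding_Icc (by ring) le_rfl, Icc_eq_empty (by omega),
      card_sumAvoiding_of_forall_ne (by simp), hexp, zpow_natCast,
      ← three_pow_mul_two_pow_div (b := b) (N := n - ℓ - u) (by omega)]
    simp
  · obtain ⟨j, rfl⟩ := Int.not_odd_iff_even.1 hodd
    obtain ⟨m, hm⟩ : ∃ m : ℕ, (m : ℤ) = n - u - 1 - j := ⟨_, Int.toNat_of_nonneg (by omega)⟩
    have hI : Icc (j + j - n + 1 + u) ((n : ℤ) - u - 1) = Icc (j - m) (j + m) := by
      congr 1 <;> omega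
    have hexp : (n : ℤ) - 1 - (j + j) / 2 - u = m := by omega
    rw [hI, card_sumAvoiding_Icc rfl (by omega), Icc_self,
      card_sumAvoiding_singleton rfl, hexp, zpow_natCast,
      ← three_pow_mul_two_pow_div (b := b) (N := n - ℓ - u) (by omega)]
    simp
end
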